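/- Let η ∈ (0,1/4), B ≥ 1, let a ∈ (ℤ\{0})⁴ satisfy η⁻¹ ≤ B and |a_i| ≤ B for all i, suppose A = a₁a₂a₃a₄ is not a perfect square, and let w be one of the weights w₁ or w₂. Define M(B) = B⁻¹·Σ_{q=1}^∞ q⁻⁴·S_{q,a}(0)·I_{q,a}(0) (a finite sum, since I_{q,a}(0) = 0 for all sufficiently large q). Then for every ε > 0, M(B) = 𝔊_a·σ_∞(w)·B/|A|^{1/2} + O_ε(η⁻²·B^{3/4+ε}·Δ^{3/8}/|A|^{5/16}). -/

import Mathlib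

open scoped BigOperators
open MeasureTheory Filter

attribute [local instance 0] Classical.propDecidable

noncomputable section

/-- `e(t) = exp(2πit)`. -/
def eC (t : ℝ) : ℂ := Complex.exp (2 * Real.pi * Complex.I * t)

/-- A nonzero integer `z` is squareful if `p² ∣ z` for every prime `p` dividing `z`. -/
def Squareful (z : ℤ) : Prop := ∀ p : ℕ, p.Prime → (p : ℤ) ∣ z → (p : ℤ) ^ 2 ∣ z

/-- The standard bump function in one variable. -/
def psi1 (t : ℝ) : ℝ := if |t| < 1 then Real.exp (-(1 - t ^ 2)⁻¹) else 0

/-- The smooth weight `w₁`. -/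
def w1 (η : ℝ) (x : Fin 4 → ℝ) : ℝ :=
  if ‖x‖ ≤ η then 0
  else if ‖x‖ ≤ 2 * η then Real.exp 1 * psi1 (‖x‖ / η - 2)
  else if ‖x‖ ≤ 1 - η then 1
  else if ‖x‖ ≤ 1 then Real.exp 1 * psi1 (‖x‖ / η - (1 - η) / η)
  else 0

/-- The smooth weight `w₂`. -/
def w2 (η : ℝ) (x : Fin 4 → ℝ) : ℝ :=
  if ‖x‖ ≤ η then 0
  else if ‖x‖ ≤ 2 * η then Real.exp 1 * psi1 (‖x‖ / η - 2)
  else if ‖x‖ ≤ 1 then 1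
  else if ‖x‖ ≤ 1 + η then Real.exp 1 * psi1 (‖x‖ / η - 1 / η)
  else 0

/-- `u(t) = c₀ ψ₁(4t - 3)`, normalised so that `∫ u = 1`. -/
def uFn (t : ℝ) : ℝ := (∫ s : ℝ, psi1 (4 * s - 3))⁻¹ * psi1 (4 * t - 3)

/-- Heath-Brown's function `h(x, y)`. -/
def hFn (x y : ℝ) : ℝ :=
  ∑' j : ℕ, (x * ((j : ℝ) + 1))⁻¹ *
    (uFn (x * ((j : ℝ) + 1)) - uFn (|y| / (x * ((j : ℝ) + 1))))

/-- The exponential sum `S_{q,a}(c)`. -/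
def Sqa (a c : Fin 4 → ℤ) (q : ℕ) : ℂ :=
  ∑ k ∈ (Finset.range q).filter fun k => Nat.gcd k q = 1,
    ∑ b ∈ Fintype.piFinset fun _ : Fin 4 => Finset.range q,
      eC (((((k : ℤ) * (∑ i, a i * (b i : ℤ) ^ 2) + ∑ i, (b i : ℤ) * c i) : ℤ) : ℝ) / (q : ℝ))

/-- Partial sums of the singular series `𝔊_a`. -/
def singularPartial (a : Fin 4 → ℤ) (T : ℕ) : ℂ :=
  ∑ q ∈ Finset.Icc 1 T, (1 / (q : ℂ) ^ 4) * Sqa a 0 q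

/-- The quadratic form `G(x) = Σ εᵢ xᵢ²`. -/
def Gquad (e : Fin 4 → ℤ) (x : Fin 4 → ℝ) : ℝ := ∑ i, (e i : ℝ) * x i ^ 2

/-- The singular integral `σ_∞(ε)`. -/
def sigmaInf (e : Fin 4 → ℤ) : ℂ :=
  ∫ θ : ℝ, ∫ x in Set.univ.pi fun _ : Fin 4 => Set.Icc (-1 : ℝ) 1, eC (-(θ * Gquad e x))

/-- The weighted singular integral `σ_∞(w)`. -/
def sigmaInfW (w : (Fin 4 → ℝ) → ℝ) (e : Fin 4 → ℤ) : ℂ :=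
  ∫ θ : ℝ, ∫ x : Fin 4 → ℝ, (w x : ℂ) * eC (-(θ * Gquad e x))

/-- `Pᵢ = (B / |aᵢ|)^{1/2}`. -/
def Pvec (a : Fin 4 → ℤ) (B : ℝ) (i : Fin 4) : ℝ := Real.sqrt (B / ((a i).natAbs : ℝ))

/-- The oscillatory integral `I_{q,a}(c)`. -/
def Iqa (w : (Fin 4 → ℝ) → ℝ) (a : Fin 4 → ℤ) (B : ℝ) (c : Fin 4 → ℤ) (q : ℝ) : ℂ :=
  ∫ x : Fin 4 → ℝ,
    (w (fun i => x i / Pvec a B i) : ℂ) *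
      (hFn (q / Real.sqrt B) ((∑ i, (a i : ℝ) * x i ^ 2) / B) : ℂ) *
      eC (-(∑ i, (c i : ℝ) * x i) / q)

/-- `Δ(v) = ∏ᵢ gcd(vᵢ, ∏_{j≠i} vⱼ)`. -/
def Delta4 (v : Fin 4 → ℤ) : ℕ :=
  ∏ i, Int.gcd (v i) (∏ j ∈ Finset.univ.erase i, v j)

/-- `Δ_c(a) = ∏ᵢ gcd(gcd(aᵢ,cᵢ), ∏_{j≠i} gcd(aⱼ,cⱼ))`. -/
def DeltaC (a c : Fin 4 → ℤ) : ℕ :=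
  ∏ i, Int.gcd (Int.gcd (a i) (c i) : ℤ) (∏ j ∈ Finset.univ.erase i, (Int.gcd (a j) (c j) : ℤ))

/-- The dual form `F*_a(c)`. -/
def dualForm (a c : Fin 4 → ℤ) : ℤ :=
  ∑ i, (∏ j ∈ Finset.univ.erase i, a j) * c i ^ 2

/-- The counting function `N_a(B)`. -/
def Na (a : Fin 4 → ℤ) (B : ℝ) : ℕ :=
  {x : Fin 4 → ℤ | (∀ i, x i ≠ 0) ∧ (∑ i, a i * x i ^ 2) = 0 ∧
    ∀ i, (((a i * x i ^ 2).natAbs : ℝ)) ≤ B}.ncard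

/-- The smoothly weighted counting function `N_{w,a}(B)`. -/
def Nwa (w : (Fin 4 → ℝ) → ℝ) (a : Fin 4 → ℤ) (B : ℝ) : ℝ :=
  ∑' x : Fin 4 → ℤ,
    if (∀ i, x i ≠ 0) ∧ (∑ i, a i * x i ^ 2) = 0 then
      w fun i => (x i : ℝ) / Pvec a B i
    else 0

/-- The inclusion-exclusion weights `ω(r, s, s₀)`. -/
def omegaFn (r s : Fin 4 → ℕ) (s0 : ℕ) : ℤ :=
  if (∀ i, Squarefree (r i)) ∧ (∀ i, Squarefree (s i)) ∧
      Finset.univ.gcd s = 1 ∧ (∀ i, Nat.gcd s0 (s i) = 1) ∧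
      ∀ p : ℕ, p.Prime → p ∣ (∏ i, r i) * ∏ i, s i → ∀ i, p ∣ r i * s i then
    ArithmeticFunction.moebius s0 *
      ∏ p ∈ ((∏ i, r i) * ∏ i, s i).primeFactors,
        (-1 : ℤ) ^ (((∏ i, r i) * ∏ i, s i).factorization p + 1)
  else 0

/-- The cardinality of the set `𝒩(B; r, s, s₀)`. -/
def calN (B D : ℝ) (r s : Fin 4 → ℕ) (s0 : ℕ) : ℕ :=
  {z : Fin 4 → ℤ | (∀ i, z i ≠ 0) ∧ (∀ i, Squareful (z i)) ∧
    (∀ i, (((z i).natAbs : ℝ)) ≤ B) ∧ (∑ i, z i) = 0 ∧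
    ∃ x y : Fin 4 → ℤ,
      (∀ i, 0 < x i ∧ Squarefree (y i) ∧ z i = x i ^ 2 * y i ^ 3 ∧
        (r i : ℤ) ∣ y i ∧ (s i : ℤ) ∣ x i ∧ (s0 : ℤ) ∣ x i) ∧
      (((∏ i, y i).natAbs : ℝ)) ≤ D ∧ ¬ IsSquare (∏ i, y i)}.ncard

/-- The local counting function `M_n(y, p)`. -/
def Mcount (y : Fin 4 → ℤ) (p n : ℕ) : ℕ :=
  {m : Fin 4 → ℕ | (∀ i, m i < p ^ n) ∧ ((p : ℤ) ^ n ∣ ∑ i, y i ^ 3 * (m i : ℤ) ^ 2) ∧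
    ∃ j, ¬ (p : ℤ) ∣ (m j : ℤ) * y j}.ncard

end

section Stepanov
open Polynomial

variable {F : Type*} [Field F]

lemma natDegree_lt_iff_degree_lt' {q : F[X]} {n : ℕ} (hn : n ≠ 0) :
    q.natDegree < n ↔ q.degree < n := by
  by_cases h : q = 0
  · subst h
    simp only [natDegree_zero, degree_zero]
    exact ⟨fun _ => WithBot.bot_lt_coe n, fun _ => Nat.pos_of_ne_zero hn⟩
  · exact natDegree_lt_iff_degree_lt h

/-- The operator with `D^k (f^m r) = f^(m-k) T r`. -/
noncomputable def stT (f : F[X]) (m : ℕ) : ℕ → F[X] →ₗ[F] F[X]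
  | 0 => LinearMap.id
  | k + 1 => ((LinearMap.mulLeft F (C ((m : F) - k) * derivative f)) +
      (LinearMap.mulLeft F f).comp (derivative (R := F))).comp (stT f m k)

lemma stT_succ (f : F[X]) (m k : ℕ) (r : F[X]) :
    stT f m (k + 1) r = C ((m : F) - k) * derivative f * stT f m k r +
      f * derivative (stT f m k r) := by
  simp [stT, mul_assoc]

lemma stT_deriv (f : F[X]) (m : ℕ) (r : F[X]) (k : ℕ) (hk : k ≤ m) :
    derivative^[k] (f ^ m * r) = f ^ (m - k) * stT f m k r := by
  induction k with
  | zero => simp [stT]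
  | succ k ih =>
    rw [Function.iterate_succ_apply', ih (by omega), derivative_mul, derivative_pow, stT_succ]
    obtain ⟨c, hc⟩ : ∃ c, m = k + 1 + c := ⟨m - (k + 1), by omega⟩
    subst hc
    have h1 : k + 1 + c - k = c + 1 := by omega
    have h2 : k + 1 + c - (k + 1) = c := by omega
    rw [h1, h2]
    have h3 : (C (((c + 1 : ℕ) : F)) : F[X]) = C (((k + 1 + c : ℕ) : F) - (k : F)) := by
      congr 1; push_cast; ring
    rw [Nat.add_sub_cancel, h3]
    ring

lemma stT_degree (f : F[X]) (hf : f.natDegree ≤ 3) (m : ℕ) (r : F[X]) (d : ℕ)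
    (hr : r ∈ degreeLT F d) (k : ℕ) :
    stT f m k r ∈ degreeLT F (d + 2 * k) := by
  by_cases hd : d = 0
  · subst hd
    have : r = 0 := by
      rw [mem_degreeLT] at hr
      by_contra h
      rw [degree_eq_natDegree h] at hr
      exact absurd (by exact_mod_cast hr) (Nat.not_lt_zero _)
    simp [this]
  have key : ∀ (s : F[X]) (n : ℕ), n ≠ 0 → (s ∈ degreeLT F n ↔ s.natDegree < n) := by
    intro s n hn
    rw [mem_degreeLT]
    exact (natDegree_lt_iff_degree_lt' hn).symm
  rw [key _ _ hd] at hr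
  rw [key _ _ (by omega)]
  induction k with
  | zero => simpa [stT] using hr
  | succ k ih =>
    rw [stT_succ]
    have hdf : (derivative f).natDegree ≤ 2 := (natDegree_derivative_le f).trans (by omega)
    refine lt_of_le_of_lt (natDegree_add_le _ _) (max_lt ?_ ?_)
    · refine lt_of_le_of_lt natDegree_mul_le ?_
      have : (C ((m : F) - k) * derivative f).natDegree ≤ 2 :=
        (natDegree_C_mul_le _ _).trans hdf
      omega
    · by_cases h0 : (stT f m k r).natDegree = 0
      · rw [derivative_of_natDegree_zero h0]
        simp
      · refine lt_of_le_of_lt natDegree_mul_le ?_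
        have := natDegree_derivative_le (stT f m k r)
        omega

lemma iterate_deriv_mul_Xpow (p : ℕ) [CharP F p] (q : F[X]) (j k : ℕ) :
    derivative^[k] (q * X ^ (p * j)) = derivative^[k] q * X ^ (p * j) := by
  induction k with
  | zero => simp
  | succ k ih =>
    rw [Function.iterate_succ_apply', ih, derivative_mul, Function.iterate_succ_apply']
    simp [derivative_X_pow]

lemma st_indep_one (p : ℕ) [Fact p.Prime] (f : (ZMod p)[X]) (hf : f.natDegree = 3)
    (hf0 : f.coeff 0 ≠ 0) (n : ℕ) (hp : p = 2 * n + 1) (r s : (ZMod p)[X])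
    (hr : r ∈ degreeLT (ZMod p) (n - 1)) (hs : s ∈ degreeLT (ZMod p) (n - 1))
    (hd : X ^ p ∣ r + s * f ^ n) : r = 0 ∧ s = 0 := by
  have hpp := (Fact.out : p.Prime)
  have hn1 : 1 ≤ n := by have := hpp.two_le; omega
  have zero_case : ∀ (q : (ZMod p)[X]), n - 1 = 0 → q ∈ degreeLT (ZMod p) (n - 1) → q = 0 := by
    intro q h0 hq
    rw [h0, mem_degreeLT] at hq
    by_contra h
    rw [degree_eq_natDegree h] at hq
    exact absurd (by exact_mod_cast hq) (Nat.not_lt_zero _)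
  by_cases h0 : n - 1 = 0
  · exact ⟨zero_case r h0 hr, zero_case s h0 hs⟩
  rw [mem_degreeLT, ← natDegree_lt_iff_degree_lt' h0] at hr hs
  have hfp : f ^ p = f * (f ^ n) ^ 2 := by
    rw [← pow_mul, ← pow_succ']; congr 1; omega
  have h1 : X ^ p ∣ f ^ p - C (f.coeff 0) := by
    have : f ^ p - C (f.coeff 0) = (f - C (f.coeff 0)) ^ p := by
      rw [sub_pow_char, ← C_pow, ZMod.pow_card]
    rw [this]
    apply pow_dvd_pow_of_dvd
    rw [X_dvd_iff]; simp
  have h2 : X ^ p ∣ r ^ 2 * f - s ^ 2 * C (f.coeff 0) := by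
    have e : r ^ 2 * f - s ^ 2 * C (f.coeff 0) =
        (r + s * f ^ n) * (f * (r - s * f ^ n)) + (f ^ p - C (f.coeff 0)) * s ^ 2 := by
      rw [hfp]; ring
    rw [e]
    exact dvd_add (hd.mul_right _) (h1.mul_right _)
  have h3 : r ^ 2 * f - s ^ 2 * C (f.coeff 0) = 0 := by
    by_contra hne
    have := natDegree_le_of_dvd h2 hne
    rw [natDegree_X_pow] at this
    have hb : (r ^ 2 * f - s ^ 2 * C (f.coeff 0)).natDegree < p := by
      refine lt_of_le_of_lt (natDegree_sub_le _ _) (max_lt ?_ ?_)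
      · have := natDegree_mul_le (p := r ^ 2) (q := f)
        have := natDegree_pow_le (p := r) (n := 2)
        omega
      · have := natDegree_mul_le (p := s ^ 2) (q := C (f.coeff 0))
        have := natDegree_pow_le (p := s) (n := 2)
        simp only [natDegree_C] at *
        omega
    omega
  have hfne : f ≠ 0 := by rintro rfl; simp at hf
  by_cases hr0 : r = 0
  · refine ⟨hr0, ?_⟩
    rw [hr0] at h3
    have : s ^ 2 * C (f.coeff 0) = 0 := by
      have h4 : -(s ^ 2 * C (f.coeff 0)) = 0 := by simpa using h3
      simpa using h4
    simpa [hf0] using this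
  · exfalso
    have h4 : r ^ 2 * f = s ^ 2 * C (f.coeff 0) := sub_eq_zero.mp h3
    have h5 := congrArg natDegree h4
    rw [natDegree_mul (pow_ne_zero _ hr0) hfne, natDegree_mul_C hf0, natDegree_pow,
      natDegree_pow, hf] at h5
    omega

lemma st_indep (p : ℕ) [Fact p.Prime] (f : (ZMod p)[X]) (hf : f.natDegree = 3)
    (hf0 : f.coeff 0 ≠ 0) (n : ℕ) (hp : p = 2 * n + 1) (J : ℕ) (r s : ℕ → (ZMod p)[X])
    (hr : ∀ j, r j ∈ degreeLT (ZMod p) (n - 1)) (hs : ∀ j, s j ∈ degreeLT (ZMod p) (n - 1))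
    (h0 : ∑ j ∈ Finset.range J, (r j + s j * f ^ n) * X ^ (p * j) = 0) :
    ∀ j < J, r j = 0 ∧ s j = 0 := by
  intro j
  induction j using Nat.strong_induction_on with
  | _ j ih =>
    intro hj
    apply st_indep_one p f hf hf0 n hp _ _ (hr j) (hs j)
    have hsplit : ∑ i ∈ Finset.range J, (r i + s i * f ^ n) * X ^ (p * i)
        = (r j + s j * f ^ n) * X ^ (p * j) +
          ∑ i ∈ (Finset.range J).erase j, (r i + s i * f ^ n) * X ^ (p * i) := by
      exact (Finset.add_sum_erase _ (fun i => (r i + s i * f ^ n) * X ^ (p * i))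
        (Finset.mem_range.mpr hj)).symm
    have hdiv : X ^ (p * (j + 1)) ∣
        ∑ i ∈ (Finset.range J).erase j, (r i + s i * f ^ n) * X ^ (p * i) := by
      apply Finset.dvd_sum
      intro i hi
      rw [Finset.mem_erase, Finset.mem_range] at hi
      rcases lt_or_gt_of_ne hi.1 with hlt | hgt
      · obtain ⟨e1, e2⟩ := ih i hlt hi.2
        simp [e1, e2]
      · exact (pow_dvd_pow X (Nat.mul_le_mul_left p (by omega : j + 1 ≤ i))).mul_left _
    have hd2 : X ^ (p * (j + 1)) ∣ (r j + s j * f ^ n) * X ^ (p * j) := by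
      rw [hsplit] at h0
      rw [eq_neg_of_add_eq_zero_left h0]
      exact (dvd_neg).mpr hdiv
    rw [Nat.mul_add, Nat.mul_one, pow_add, mul_comm (X ^ (p * j))] at hd2
    exact (mul_dvd_mul_iff_right (pow_ne_zero _ X_ne_zero)).mp hd2

lemma finrank_degreeLT' (d : ℕ) : Module.finrank F (degreeLT F d) = d := by
  rw [(degreeLTEquiv F d).finrank_eq]; simp

lemma finite_degreeLT' (d : ℕ) : Module.Finite F (degreeLT F d) :=
  Module.Finite.equiv (degreeLTEquiv F d).symm

/-- existence of the auxiliary coefficients -/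
lemma st_exists (f : F[X]) (hf : f.natDegree ≤ 3) (e : F) (n d l J : ℕ)
    (hcount : l * (d + J + 2 * l) < 2 * (J * d)) :
    ∃ r s : ℕ → F[X], (∀ j, r j ∈ degreeLT F d) ∧ (∀ j, s j ∈ degreeLT F d) ∧
      (∃ j < J, r j ≠ 0 ∨ s j ≠ 0) ∧
      ∀ k < l, ∑ j ∈ Finset.range J, (stT f l k (r j) + e • stT f (l + n) k (s j)) * X ^ j = 0 := by
  haveI := fun d => finite_degreeLT' (F := F) d
  let V := (Fin J → degreeLT F d) × (Fin J → degreeLT F d)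
  let inner : Fin l → V →ₗ[F] F[X] := fun k => ∑ j : Fin J,
    ((LinearMap.mulRight F (X ^ (j : ℕ))).comp ((stT f l k).comp
      ((degreeLT F d).subtype.comp ((LinearMap.proj j).comp (LinearMap.fst F _ _)))) +
    e • ((LinearMap.mulRight F (X ^ (j : ℕ))).comp ((stT f (l + n) k).comp
      ((degreeLT F d).subtype.comp ((LinearMap.proj j).comp (LinearMap.snd F _ _))))))
  have inner_apply : ∀ k (v : V), inner k v = ∑ j : Fin J,
      (stT f l k (v.1 j : F[X]) + e • stT f (l + n) k (v.2 j : F[X])) * X ^ (j : ℕ) := by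
    intro k v
    simp only [inner, LinearMap.sum_apply, LinearMap.add_apply, LinearMap.smul_apply,
      LinearMap.comp_apply, LinearMap.mulRight_apply,
      LinearMap.proj_apply, Submodule.subtype_apply, add_mul, smul_mul_assoc]
    rfl
  have hmem : ∀ k v, inner k v ∈ degreeLT F (d + J + 2 * l) := by
    intro k v
    rw [inner_apply]
    refine Submodule.sum_mem _ fun j _ => ?_
    have h1 : stT f l k (v.1 j : F[X]) + e • stT f (l + n) k (v.2 j : F[X]) ∈
        degreeLT F (d + 2 * k) :=
      Submodule.add_mem _ (stT_degree f hf _ _ d (v.1 j).2 k)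
        (Submodule.smul_mem _ _ (stT_degree f hf _ _ d (v.2 j).2 k))
    rw [mem_degreeLT] at h1 ⊢
    have hj := j.2
    have hk := k.2
    rw [degree_mul, degree_X_pow]
    by_cases hz : stT f l k (v.1 j : F[X]) + e • stT f (l + n) k (v.2 j : F[X]) = 0
    · rw [hz, degree_zero, WithBot.bot_add]; exact WithBot.bot_lt_coe _
    · rw [degree_eq_natDegree hz] at h1 ⊢
      have h1' := (Nat.cast_lt (α := WithBot ℕ)).mp h1
      have : ((stT f l k (v.1 j : F[X]) + e • stT f (l + n) k (v.2 j : F[X])).natDegree + (j : ℕ))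
        < d + J + 2 * l := by omega
      exact_mod_cast this
  let L : V →ₗ[F] (Fin l → degreeLT F (d + J + 2 * l)) :=
    LinearMap.pi fun k => LinearMap.codRestrict _ (inner k) (hmem k)
  have hker : LinearMap.ker L ≠ ⊥ := by
    apply LinearMap.ker_ne_bot_of_finrank_lt
    rw [Module.finrank_pi_fintype, Module.finrank_prod, Module.finrank_pi_fintype]
    simp only [finrank_degreeLT', Finset.sum_const, Finset.card_univ, Fintype.card_fin, smul_eq_mul]
    omega
  obtain ⟨v, hv, hv0⟩ := Submodule.exists_mem_ne_zero_of_ne_bot hker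
  have hLv : ∀ k : Fin l, inner k v = 0 := by
    intro k
    have := congrFun (LinearMap.mem_ker.mp hv) k
    exact congrArg Subtype.val this
  refine ⟨fun j => if h : j < J then (v.1 ⟨j, h⟩ : F[X]) else 0,
    fun j => if h : j < J then (v.2 ⟨j, h⟩ : F[X]) else 0, ?_, ?_, ?_, ?_⟩
  · intro j; dsimp only; split_ifs with h
    · exact (v.1 ⟨j, h⟩).2
    · exact Submodule.zero_mem _
  · intro j; dsimp only; split_ifs with h
    · exact (v.2 ⟨j, h⟩).2
    · exact Submodule.zero_mem _
  · by_contra hcon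
    push Not at hcon
    apply hv0
    ext j : 3
    · have := (hcon j j.2).1
      simpa using this
    · have := (hcon j j.2).2
      simpa using this
  · intro k hk
    have := hLv ⟨k, hk⟩
    rw [inner_apply] at this
    rw [← Fin.sum_univ_eq_sum_range (fun j => (stT f l k (if h : j < J then (v.1 ⟨j, h⟩ : F[X]) else 0)
      + e • stT f (l + n) k (if h : j < J then (v.2 ⟨j, h⟩ : F[X]) else 0)) * X ^ j) J, ← this]
    apply Finset.sum_congr rfl
    intro j _
    simp

lemma st_count (p : ℕ) [Fact p.Prime] (f : (ZMod p)[X]) (hf : f.natDegree = 3)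
    (hf0 : f.coeff 0 ≠ 0) (n : ℕ) (hp : p = 2 * n + 1) (m : ℕ) (hm : 5 ≤ m) (hmn : m ^ 2 ≤ n)
    (e : ZMod p) (he : e ≠ 0) :
    2 * m * (Finset.univ.filter fun x : ZMod p => (f.eval x) ^ n = e).card
      ≤ 2 * n * m + 16 * n + 7 * m + 6 := by
  have hcount : 2 * m * ((n - 1) + (m + 7) + 2 * (2 * m)) < 2 * ((m + 7) * (n - 1)) := by
    obtain ⟨n', rfl⟩ : ∃ n', n = n' + 1 := ⟨n - 1, (Nat.sub_add_cancel (by nlinarith [hmn, hm])).symm⟩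
    simp only [Nat.add_sub_cancel]
    nlinarith [hmn, hm]
  obtain ⟨r, s, hr, hs, hne, hvan⟩ := st_exists f hf.le e n (n - 1) (2 * m) (m + 7) hcount
  set l := 2 * m with hl
  set J := m + 7 with hJ
  have hfne : f ≠ 0 := by rintro rfl; simp at hf
  set h : (ZMod p)[X] := ∑ j ∈ Finset.range J, (f ^ l * r j + f ^ (l + n) * s j) * X ^ (p * j) with hh
  have hh' : h = f ^ l * ∑ j ∈ Finset.range J, (r j + s j * f ^ n) * X ^ (p * j) := by
    rw [hh, Finset.mul_sum]
    refine Finset.sum_congr rfl fun j _ => ?_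
    rw [pow_add]; ring
  have hhne : h ≠ 0 := by
    rw [hh']
    refine mul_ne_zero (pow_ne_zero _ hfne) fun h0 => ?_
    obtain ⟨j, hj, hj'⟩ := hne
    have := st_indep p f hf hf0 n hp J r s hr hs h0 j hj
    tauto
  have hn25 : 25 ≤ n := by nlinarith
  have hdeg : h.natDegree ≤ 2 * n * m + 16 * n + 7 * m + 6 := by
    apply natDegree_sum_le_of_forall_le
    intro j hj
    rw [Finset.mem_range] at hj
    have key : ∀ q ∈ degreeLT (ZMod p) (n - 1), q.natDegree ≤ n - 2 := by
      intro q hq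
      rw [mem_degreeLT, ← natDegree_lt_iff_degree_lt' (by omega)] at hq
      omega
    have h1 := key _ (hr j)
    have h2 := key _ (hs j)
    have e1 : (f ^ l * r j).natDegree ≤ 3 * l + 3 * n + (n - 2) := by
      refine natDegree_mul_le.trans ?_
      rw [natDegree_pow, hf]; omega
    have e2 : (f ^ (l + n) * s j).natDegree ≤ 3 * l + 3 * n + (n - 2) := by
      refine natDegree_mul_le.trans ?_
      rw [natDegree_pow, hf]; omega
    refine natDegree_mul_le.trans ?_
    rw [natDegree_X_pow]
    have e3 := (natDegree_add_le (f ^ l * r j) (f ^ (l + n) * s j)).trans (max_le e1 e2)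
    have e4 : p * j ≤ p * (m + 6) := Nat.mul_le_mul_left _ (by omega)
    have e5 : p * (m + 6) = 2 * n * m + 12 * n + m + 6 := by rw [hp]; ring
    omega
  have hroot : ∀ x ∈ (Finset.univ.filter fun x : ZMod p => (f.eval x) ^ n = e),
      l ≤ h.rootMultiplicity x := by
    intro x hx
    rw [Finset.mem_filter] at hx
    have hx := hx.2
    have : l - 1 < h.rootMultiplicity x := by
      apply lt_rootMultiplicity_of_isRoot_iterate_derivative_of_mem_nonZeroDivisors' hhne
      · intro k hk
        have hkl : k < l := by omega
        have hD : derivative^[k] h = f ^ (l - k) * ∑ j ∈ Finset.range J,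
            (stT f l k (r j) + f ^ n * stT f (l + n) k (s j)) * X ^ (p * j) := by
          rw [hh, iterate_derivative_sum, Finset.mul_sum]
          refine Finset.sum_congr rfl fun j _ => ?_
          rw [iterate_deriv_mul_Xpow, iterate_map_add, stT_deriv f l _ k hkl.le,
            stT_deriv f (l + n) _ k (by omega)]
          have : l + n - k = (l - k) + n := by omega
          rw [this, pow_add]; ring
        have hv := congrArg (eval x) (hvan k hkl)
        rw [eval_finsetSum, eval_zero] at hv
        rw [IsRoot.def, hD, eval_mul, eval_finsetSum]
        refine mul_eq_zero_of_right _ ?_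
        rw [← hv]
        refine Finset.sum_congr rfl fun j _ => ?_
        simp only [eval_mul, eval_add, eval_pow, eval_X, eval_smul, smul_eq_mul, hx]
        rw [pow_mul, ZMod.pow_card]
      · intro k hk hk0
        apply mem_nonZeroDivisors_of_ne_zero
        intro h0
        rw [ZMod.natCast_eq_zero_iff] at h0
        have := Nat.le_of_dvd (by omega) h0
        have : m ≤ n := by nlinarith
        omega
    omega
  have hsum : ∑ x ∈ (Finset.univ.filter fun x : ZMod p => (f.eval x) ^ n = e),
      h.rootMultiplicity x ≤ h.natDegree := by
    calc _ ≤ ∑ x ∈ h.roots.toFinset, h.rootMultiplicity x := by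
          apply Finset.sum_le_sum_of_subset
          intro x hx
          have := hroot x hx
          rw [Multiset.mem_toFinset, mem_roots hhne, ← rootMultiplicity_pos hhne]
          omega
      _ = h.roots.card := by
          rw [← Multiset.toFinset_sum_count_eq]
          simp
      _ ≤ h.natDegree := card_roots' h
  have h3 := Finset.card_nsmul_le_sum _ _ _ hroot
  rw [smul_eq_mul, mul_comm] at h3
  exact h3.trans (hsum.trans hdeg)

/-- Stepanov: bound for the cubic character sum. -/
lemma stepanov_cubic (p : ℕ) [Fact p.Prime] (hp2 : p ≠ 2) (f : (ZMod p)[X])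
    (hf : f.natDegree = 3) (hf0 : f.coeff 0 ≠ 0) :
    |∑ x : ZMod p, ((quadraticChar (ZMod p) (f.eval x) : ℤ) : ℝ)| ≤ 40 * Real.sqrt p := by
  have hpp := (Fact.out : p.Prime)
  obtain ⟨n, hn⟩ : ∃ n, p = 2 * n + 1 := hpp.odd_of_ne_two hp2
  have hp0 : (0 : ℝ) ≤ p := Nat.cast_nonneg p
  have hsq : Real.sqrt p ^ 2 = p := Real.sq_sqrt hp0
  have hsn := Real.sqrt_nonneg (p : ℝ)
  by_cases hsmall : n < 25
  · have h1 : |∑ x : ZMod p, ((quadraticChar (ZMod p) (f.eval x) : ℤ) : ℝ)| ≤ p := by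
      refine (Finset.abs_sum_le_sum_abs _ _).trans ?_
      have : ∀ x ∈ (Finset.univ : Finset (ZMod p)),
          |((quadraticChar (ZMod p) (f.eval x) : ℤ) : ℝ)| ≤ 1 := by
        intro x _
        by_cases h0 : f.eval x = 0
        · simp [h0]
        · rcases quadraticChar_dichotomy h0 with h | h <;> simp [h]
      refine (Finset.sum_le_sum this).trans ?_
      simp [ZMod.card]
    refine h1.trans ?_
    have h2 : (p : ℝ) ≤ 51 := by exact_mod_cast (by omega : p ≤ 51)
    nlinarith
  push Not at hsmall
  obtain ⟨m, hm, hmn, hmn2⟩ : ∃ m, 5 ≤ m ∧ m ^ 2 ≤ n ∧ n < (m + 1) ^ 2 := by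
    refine ⟨Nat.sqrt n, ?_, Nat.sqrt_le' n, Nat.lt_succ_sqrt' n⟩
    rw [Nat.le_sqrt]; omega
  have hchar : ringChar (ZMod p) ≠ 2 := by rwa [ZMod.ringChar_zmod_n]
  have hval : ∀ x : ZMod p, ((quadraticChar (ZMod p) x : ℤ) : ZMod p) = x ^ n := by
    intro x
    rw [quadraticChar_eq_pow_of_char_ne_two' hchar, ZMod.card]
    congr 1; omega
  set Zp := (Finset.univ.filter fun x : ZMod p => (f.eval x) ^ n = 1) with hZp
  set Zm := (Finset.univ.filter fun x : ZMod p => (f.eval x) ^ n = -1) with hZm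
  have hfne : f ≠ 0 := by rintro rfl; simp at hf
  have h1m1 : (1 : ZMod p) ≠ -1 := by
    intro h
    exact Ring.neg_one_ne_one_of_char_ne_two hchar h.symm
  have hc1 := st_count p f hf hf0 n hn m hm hmn 1 one_ne_zero
  have hc2 := st_count p f hf hf0 n hn m hm hmn (-1) (neg_ne_zero.mpr one_ne_zero)
  have hcases : ∀ x : ZMod p, ((quadraticChar (ZMod p) (f.eval x) : ℤ) : ℝ) =
      (if (f.eval x) ^ n = 1 then 1 else 0) - (if (f.eval x) ^ n = -1 then 1 else 0) := by
    intro x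
    rw [← hval]
    by_cases h0 : f.eval x = 0
    · simp [h0]
    · rcases quadraticChar_dichotomy h0 with h | h
      · simp [h, h1m1]
      · simp [h, h1m1.symm]
  have hsum : ∑ x : ZMod p, ((quadraticChar (ZMod p) (f.eval x) : ℤ) : ℝ) =
      (Zp.card : ℝ) - Zm.card := by
    simp_rw [hcases]
    rw [Finset.sum_sub_distrib, Finset.sum_boole, Finset.sum_boole]
  have hroots : p ≤ Zp.card + Zm.card + 3 := by
    have hsub : (Finset.univ : Finset (ZMod p)) ⊆ (Zp ∪ Zm) ∪ f.roots.toFinset := by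
      intro x _
      by_cases h0 : f.eval x = 0
      · apply Finset.mem_union_right
        simpa [hfne] using h0
      · apply Finset.mem_union_left
        have := hval (f.eval x)
        rcases quadraticChar_dichotomy h0 with h | h
        · rw [h] at this
          apply Finset.mem_union_left
          simp [hZp, ← this]
        · rw [h] at this
          apply Finset.mem_union_right
          simp [hZm, ← this]
    have h1 := Finset.card_le_card hsub
    rw [Finset.card_univ, ZMod.card] at h1
    have h2 := Finset.card_union_le (Zp ∪ Zm) f.roots.toFinset
    have h3 := Finset.card_union_le Zp Zm
    have h4 := (Multiset.toFinset_card_le f.roots).trans (card_roots' f)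
    omega
  have hmp : (m : ℝ) ≤ Real.sqrt p := by
    apply Real.le_sqrt_of_sq_le
    exact_mod_cast (by omega : m ^ 2 ≤ p)
  have hnR : (p : ℝ) = 2 * n + 1 := by exact_mod_cast hn
  have hc1' : 2 * (m : ℝ) * Zp.card ≤ 2 * n * m + 16 * n + 7 * m + 6 := by exact_mod_cast hc1
  have hc2' : 2 * (m : ℝ) * Zm.card ≤ 2 * n * m + 16 * n + 7 * m + 6 := by
    rw [← hZm] at hc2
    exact_mod_cast hc2
  have hr' : (p : ℝ) ≤ Zp.card + Zm.card + 3 := by exact_mod_cast hroots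
  have hm' : (5 : ℝ) ≤ m := by exact_mod_cast hm
  have hn2' : (n : ℝ) + 1 ≤ ((m : ℝ) + 1) ^ 2 := by exact_mod_cast hmn2
  rw [hsum]
  have key : ∀ a b : ℝ, 2 * (m : ℝ) * a ≤ 2 * n * m + 16 * n + 7 * m + 6 → (p : ℝ) ≤ a + b + 3 →
      a - b ≤ 40 * Real.sqrt p := by
    intro a b ha hb
    have h1 : (m : ℝ) * (a - b) ≤ m * (40 * m) := by nlinarith
    have h2 : a - b ≤ 40 * m := le_of_mul_le_mul_left h1 (by linarith)
    linarith
  rw [abs_le]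
  constructor
  · have := key _ _ hc2' (by linarith : (p : ℝ) ≤ Zm.card + Zp.card + 3)
    linarith
  · exact key _ _ hc1' hr'

end Stepanov

section Crt
open Polynomial

lemma sum_range_mul_coprime {R : Type*} [CommRing R] (m n : ℕ) (hm : 0 < m) (hn : 0 < n)
    (h : Nat.Coprime m n) (f g : ℕ → R) (hf : ∀ x, f (x % m) = f x) (hg : ∀ x, g (x % n) = g x) :
    ∑ x ∈ Finset.range (m * n), f x * g x =
      (∑ x ∈ Finset.range m, f x) * ∑ x ∈ Finset.range n, g x := by
  rw [Finset.sum_mul_sum, ← Finset.sum_product']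
  refine Finset.sum_bij (fun x _ => (x % m, x % n)) ?_ ?_ ?_ ?_
  · intro x _
    simp [Nat.mod_lt, hm, hn]
  · intro x hx y hy hxy
    rw [Finset.mem_range] at hx hy
    simp only [Prod.mk.injEq] at hxy
    have := (Nat.modEq_and_modEq_iff_modEq_mul h).mp ⟨hxy.1, hxy.2⟩
    exact Nat.ModEq.eq_of_lt_of_lt this hx hy
  · rintro ⟨a, b⟩ hab
    simp only [Finset.mem_product, Finset.mem_range] at hab
    let z := Nat.chineseRemainder h a b
    refine ⟨z, ?_, ?_⟩
    · rw [Finset.mem_range]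
      exact Nat.chineseRemainder_lt_mul h a b hm.ne' hn.ne'
    · have h1 : (z : ℕ) % m = a := by
        have := z.2.1
        rw [Nat.ModEq, Nat.mod_eq_of_lt hab.1] at this
        exact this
      have h2 : (z : ℕ) % n = b := by
        have := z.2.2
        rw [Nat.ModEq, Nat.mod_eq_of_lt hab.2] at this
        exact this
      simp [h1, h2]
  · intro x _
    simp only [hf, hg]

lemma sum_range_eq_zmod {R : Type*} [AddCommMonoid R] (p : ℕ) [NeZero p] (f : ZMod p → R) :
    ∑ x ∈ Finset.range p, f (x : ZMod p) = ∑ x : ZMod p, f x := by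
  refine Finset.sum_bij (fun x _ => (x : ZMod p)) (by simp) ?_ ?_ (by simp)
  · intro x hx y hy hxy
    rw [Finset.mem_range] at hx hy
    rw [ZMod.natCast_eq_natCast_iff] at hxy
    exact Nat.ModEq.eq_of_lt_of_lt hxy hx hy
  · intro x _
    exact ⟨x.val, Finset.mem_range.mpr (ZMod.val_lt x), by simp⟩

lemma jac_le_one (a : ℤ) (b : ℕ) : |((jacobiSym a b : ℤ) : ℝ)| ≤ 1 := by
  rcases jacobiSym.trichotomy a b with h | h | h <;> simp [h]

/-- the complete sum -/
noncomputable def TT (b : Fin 4 → ℤ) (t : ℕ) : ℝ :=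
  ∑ x ∈ Finset.range t, ((jacobiSym (∏ i, ((x : ℤ) + b i)) t : ℤ) : ℝ)

lemma TT_mul (b : Fin 4 → ℤ) (m n : ℕ) (hm : 0 < m) (hn : 0 < n) (h : Nat.Coprime m n) :
    TT b (m * n) = TT b m * TT b n := by
  unfold TT
  rw [← sum_range_mul_coprime m n hm hn h]
  · refine Finset.sum_congr rfl fun x _ => ?_
    rw [jacobiSym.mul_right' _ hm.ne' hn.ne']; push_cast; rfl
  all_goals
  · intro x
    congr 1
    apply jacobiSym.mod_left'
    apply Int.ModEq.prod
    intro i _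
    apply Int.ModEq.add_right
    push_cast
    exact Int.mod_modEq _ _

lemma TT_prime_eq (p : ℕ) [Fact p.Prime] (b : Fin 4 → ℤ) :
    TT b p = ∑ x : ZMod p, ((quadraticChar (ZMod p) (∏ i, (x + (b i : ZMod p))) : ℤ) : ℝ) := by
  rw [← sum_range_eq_zmod p (fun x : ZMod p =>
    ((quadraticChar (ZMod p) (∏ i, (x + (b i : ZMod p))) : ℤ) : ℝ))]
  refine Finset.sum_congr rfl fun x _ => ?_
  rw [← jacobiSym.legendreSym.to_jacobiSym, legendreSym]
  push_cast
  rfl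

lemma TT_prime_good (p : ℕ) [Fact p.Prime] (hp2 : p ≠ 2) (b : Fin 4 → ℤ) (i : Fin 4)
    (hgood : ∀ j, j ≠ i → ¬ (p : ℤ) ∣ b j - b i) : |TT b p| ≤ 41 * Real.sqrt p := by
  have hpp := (Fact.out : p.Prime)
  rw [TT_prime_eq]
  set c : Fin 4 → ZMod p := fun j => (b j : ZMod p) - (b i : ZMod p) with hc
  have hc0 : ∀ j, j ≠ i → c j ≠ 0 := by
    intro j hj h0
    apply hgood j hj
    rw [← ZMod.intCast_zmod_eq_zero_iff_dvd]
    push_cast; exact h0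
  set f : (ZMod p)[X] := ∏ j ∈ Finset.univ.erase i, (C (c j) * X + 1) with hf
  have hlin : ∀ j ∈ Finset.univ.erase i, (C (c j) * X + 1 : (ZMod p)[X]).natDegree = 1 := by
    intro j hj
    have := natDegree_linear (b := (1 : ZMod p)) (hc0 j (Finset.ne_of_mem_erase hj))
    simpa using this
  have hdeg : f.natDegree = 3 := by
    rw [hf, natDegree_prod]
    · rw [Finset.sum_congr rfl hlin]; simp
    · intro j hj h0
      have := hlin j hj
      rw [h0] at this; simp at this
  have hf0 : f.coeff 0 = 1 := by
    rw [coeff_zero_eq_eval_zero, hf, eval_prod]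
    simp
  have hmain := stepanov_cubic p hp2 f hdeg (by rw [hf0]; exact one_ne_zero)
  have e1 : ∑ x : ZMod p, ((quadraticChar (ZMod p) (∏ j, (x + (b j : ZMod p))) : ℤ) : ℝ) =
      ∑ y : ZMod p, ((quadraticChar (ZMod p) (y * ∏ j ∈ Finset.univ.erase i, (y + c j)) : ℤ) : ℝ) := by
    rw [← Equiv.sum_comp (Equiv.addRight (b i : ZMod p)) (fun y : ZMod p =>
      ((quadraticChar (ZMod p) (y * ∏ j ∈ Finset.univ.erase i, (y + c j)) : ℤ) : ℝ))]
    refine Finset.sum_congr rfl fun x _ => ?_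
    congr 2
    rw [← Finset.mul_prod_erase _ (fun j => x + (b j : ZMod p)) (Finset.mem_univ i)]
    simp only [Equiv.coe_addRight, hc]
    have : ∀ j, x + (b j : ZMod p) = x + (b i : ZMod p) + ((b j : ZMod p) - (b i : ZMod p)) := by
      intro j; ring
    simp only [← this]
  have e2 : ∑ y : ZMod p, ((quadraticChar (ZMod p) (y * ∏ j ∈ Finset.univ.erase i, (y + c j)) : ℤ) : ℝ)
      = ∑ y : ZMod p, (((quadraticChar (ZMod p) (f.eval y) : ℤ) : ℝ) - if y = 0 then 1 else 0) := by
    rw [← Equiv.sum_comp (Equiv.inv (ZMod p)) (fun y : ZMod p =>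
      ((quadraticChar (ZMod p) (y * ∏ j ∈ Finset.univ.erase i, (y + c j)) : ℤ) : ℝ))]
    refine Finset.sum_congr rfl fun y _ => ?_
    simp only [Equiv.inv_apply]
    by_cases hy : y = 0
    · subst hy
      rw [← coeff_zero_eq_eval_zero, hf0]
      simp
    · rw [if_neg hy, sub_zero]
      have : f.eval y = y ^ 2 * y ^ 2 * (y⁻¹ * ∏ j ∈ Finset.univ.erase i, (y⁻¹ + c j)) := by
        have h3 : y ^ 3 = ∏ j ∈ Finset.univ.erase i, y := by simp
        have h4 : y ^ 2 * y ^ 2 * (y⁻¹ * ∏ j ∈ Finset.univ.erase i, (y⁻¹ + c j)) =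
          y ^ 3 * ∏ j ∈ Finset.univ.erase i, (y⁻¹ + c j) := by field_simp
        rw [h4, h3, ← Finset.prod_mul_distrib, hf, eval_prod]
        refine Finset.prod_congr rfl fun j _ => ?_
        simp; field_simp; ring
      rw [this, map_mul _ (y ^ 2 * y ^ 2), map_mul _ (y ^ 2), quadraticChar_sq_one' hy]
      simp
  rw [e1, e2, Finset.sum_sub_distrib]
  simp only [Finset.sum_ite_eq', Finset.mem_univ, if_true]
  have h1 : 1 ≤ Real.sqrt p := Real.one_le_sqrt.mpr (by exact_mod_cast hpp.one_lt.le)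
  calc _ ≤ |∑ x : ZMod p, ((quadraticChar (ZMod p) (f.eval x) : ℤ) : ℝ)| + |(1 : ℝ)| := abs_sub _ _
    _ ≤ _ := by rw [abs_one]; linarith

lemma TT_trivial (b : Fin 4 → ℤ) (t : ℕ) : |TT b t| ≤ t := by
  unfold TT
  refine (Finset.abs_sum_le_sum_abs _ _).trans ?_
  refine (Finset.sum_le_sum fun x _ => jac_le_one _ _).trans ?_
  simp

/-- induction over squarefree numbers -/
lemma sqf_induction {P : ℕ → Prop} (one : P 1)
    (prime_mul : ∀ p a : ℕ, p.Prime → Nat.Coprime p a → Squarefree a → P a → P (p * a))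
    (t : ℕ) (ht : Squarefree t) : P t := by
  induction t using induction_on_primes with
  | zero => simp at ht
  | one => exact one
  | prime_mul p a hp ih =>
    have := Nat.squarefree_mul_iff.mp ht
    exact prime_mul p a hp this.1 this.2.2 (ih this.2.2)

lemma TT_bound (b : Fin 4 → ℤ) (i : Fin 4) (t : ℕ) (hsq : Squarefree t) (hodd : Odd t) :
    |TT b t| ≤ 41 ^ (t.primeFactors.card) * Real.sqrt t *
      Real.sqrt (Int.gcd t (∏ j ∈ Finset.univ.erase i, (b j - b i))) := by
  revert hodd
  refine sqf_induction (P := fun t => Odd t → |TT b t| ≤ 41 ^ (t.primeFactors.card) * Real.sqrt t *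
      Real.sqrt (Int.gcd t (∏ j ∈ Finset.univ.erase i, (b j - b i)))) ?_ ?_ t hsq
  · intro _
    simp [TT]
  · intro p a hp hpa ha ih hodd
    haveI : Fact p.Prime := ⟨hp⟩
    have hop := Nat.odd_mul.mp hodd
    have hp2 : p ≠ 2 := by
      rintro rfl
      exact absurd hop.1 (by decide)
    set D := ∏ j ∈ Finset.univ.erase i, (b j - b i) with hD
    rw [TT_mul b p a hp.pos (Nat.pos_of_ne_zero ha.ne_zero) hpa, abs_mul,
      Nat.Coprime.primeFactors_mul hpa, Finset.card_union_of_disjoint hpa.disjoint_primeFactors, hp.primeFactors]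
    have hg : (Int.gcd ((p * a : ℕ) : ℤ) D) = Int.gcd p D * Int.gcd a D := by
      simp only [Int.gcd, Int.natAbs_natCast]
      exact Nat.Coprime.mul_gcd hpa _
    have hp' : |TT b p| ≤ 41 * Real.sqrt p * Real.sqrt (Int.gcd p D) := by
      by_cases hgood : ∀ j, j ≠ i → ¬ (p : ℤ) ∣ b j - b i
      · refine (TT_prime_good p hp2 b i hgood).trans ?_
        have : (1 : ℝ) ≤ Real.sqrt (Int.gcd p D) := by
          rw [Real.one_le_sqrt]
          have : 0 < Int.gcd p D := Int.gcd_pos_of_ne_zero_left _ (by exact_mod_cast hp.ne_zero)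
          exact_mod_cast this
        nlinarith [Real.sqrt_nonneg (p : ℝ)]
      · push Not at hgood
        obtain ⟨j, hj, hdj⟩ := hgood
        have hpD : (p : ℤ) ∣ D := hdj.trans (Finset.dvd_prod_of_mem (fun j => b j - b i) (by simp [hj]))
        have : Int.gcd p D = p := by
          rw [Int.gcd, Int.natAbs_natCast]
          exact Nat.gcd_eq_left (Int.natCast_dvd.mp hpD)
        rw [this, mul_assoc, Real.mul_self_sqrt (by positivity)]
        have := TT_trivial b p
        have h0 : (0 : ℝ) ≤ p := by positivity
        linarith
    rw [hg]
    push_cast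
    rw [Real.sqrt_mul (by positivity), Real.sqrt_mul (by positivity)]
    calc |TT b p| * |TT b a| ≤ (41 * Real.sqrt p * Real.sqrt (Int.gcd p D)) *
        (41 ^ (a.primeFactors.card) * Real.sqrt a * Real.sqrt (Int.gcd a D)) := by
          gcongr
          exact ih hop.2
      _ = _ := by
        rw [Finset.card_singleton, pow_add]; ring

end Crt

section Ari

lemma omega_bound (K : ℝ) (hK : 1 ≤ K) (ε : ℝ) (hε : 0 < ε) :
    ∃ C : ℝ, 1 ≤ C ∧ ∀ n : ℕ, n ≠ 0 → K ^ (n.primeFactors.card) ≤ C * (n : ℝ) ^ ε := by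
  set P : ℕ := ⌈K ^ (1 / ε)⌉₊ with hP
  refine ⟨K ^ (P + 1), one_le_pow₀ hK, fun n hn => ?_⟩
  have h1 : ∀ p ∈ n.primeFactors, K ≤ (if p < P + 1 then K else 1) * (p : ℝ) ^ ε := by
    intro p hp
    have hpp := Nat.prime_of_mem_primeFactors hp
    split_ifs with h
    · have : (1 : ℝ) ≤ (p : ℝ) ^ ε :=
        Real.one_le_rpow (by exact_mod_cast hpp.one_lt.le) hε.le
      nlinarith
    · rw [one_mul]
      have h2 : K ^ (1 / ε) ≤ p := (Nat.le_ceil _).trans (by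
        have : P ≤ p := by omega
        exact_mod_cast this)
      calc K = (K ^ (1 / ε)) ^ ε := by
            rw [← Real.rpow_mul (by linarith)]
            rw [one_div, inv_mul_cancel₀ hε.ne', Real.rpow_one]
        _ ≤ _ := Real.rpow_le_rpow (by positivity) h2 hε.le
  calc K ^ (n.primeFactors.card) = ∏ p ∈ n.primeFactors, K := by simp
    _ ≤ ∏ p ∈ n.primeFactors, ((if p < P + 1 then K else 1) * (p : ℝ) ^ ε) :=
        Finset.prod_le_prod (fun _ _ => by linarith) h1
    _ = (∏ p ∈ n.primeFactors, (if p < P + 1 then K else 1)) * (∏ p ∈ n.primeFactors, (p : ℝ)) ^ ε := by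
        rw [Finset.prod_mul_distrib, Real.finset_prod_rpow _ _ (fun _ _ => by positivity)]
    _ ≤ K ^ (P + 1) * (n : ℝ) ^ ε := by
        gcongr
        · rw [Finset.prod_ite, Finset.prod_const_one, mul_one, Finset.prod_const]
          refine pow_le_pow_right₀ hK ?_
          calc _ ≤ (Finset.range (P + 1)).card := Finset.card_le_card (by
                intro p hp
                simp only [Finset.mem_filter] at hp
                exact Finset.mem_range.mpr hp.2)
            _ = _ := by simp
        · have := Nat.le_of_dvd (Nat.pos_of_ne_zero hn) (Nat.prod_primeFactors_dvd n)
          have h2 : ((∏ p ∈ n.primeFactors, p : ℕ) : ℝ) ≤ n := by exact_mod_cast this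
          push_cast at h2
          exact h2

lemma card_divisors_sqf (t : ℕ) (ht : Squarefree t) : t.divisors.card = 2 ^ t.primeFactors.card := by
  refine sqf_induction (P := fun t => t.divisors.card = 2 ^ t.primeFactors.card) (by simp) ?_ t ht
  intro p a hp hpa ha ih
  rw [Nat.Coprime.card_divisors_mul hpa, ih, Nat.Coprime.primeFactors_mul hpa,
    Finset.card_union_of_disjoint hpa.disjoint_primeFactors, hp.primeFactors, hp.divisors]
  rw [Finset.card_pair hp.one_lt.ne, Finset.card_singleton, pow_add]; rfl

lemma card_mult_le (d B : ℕ) : ((Finset.Icc 1 B).filter (fun h => d ∣ h)).card = B / d := by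
  have := Nat.Ioc_filter_dvd_card_eq_div B d
  rw [← this]
  rfl

lemma sum_gcd_le (t B : ℕ) (ht : t ≠ 0) :
    ∑ h ∈ Finset.Icc 1 B, ((Nat.gcd t h : ℕ) : ℝ) ≤ B * (t.divisors.card : ℝ) := by
  have h1 : ∀ h ∈ Finset.Icc 1 B, ((Nat.gcd t h : ℕ) : ℝ) ≤
      ∑ d ∈ t.divisors, if d ∣ h then (d : ℝ) else 0 := by
    intro h _
    have := Finset.single_le_sum (f := fun d : ℕ => if d ∣ h then (d : ℝ) else 0)
      (fun d _ => by positivity) (show Nat.gcd t h ∈ t.divisors by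
        simp [ht, Nat.gcd_dvd_left])
    simpa [Nat.gcd_dvd_right] using this
  refine (Finset.sum_le_sum h1).trans ?_
  rw [Finset.sum_comm]
  calc ∑ d ∈ t.divisors, ∑ h ∈ Finset.Icc 1 B, (if d ∣ h then (d : ℝ) else 0)
      ≤ ∑ d ∈ t.divisors, (B : ℝ) := by
        refine Finset.sum_le_sum fun d hd => ?_
        rw [← Finset.sum_filter, Finset.sum_const, card_mult_le, nsmul_eq_mul]
        exact_mod_cast Nat.div_mul_le_self B d
    _ = _ := by rw [Finset.sum_const, nsmul_eq_mul, mul_comm]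

lemma harm_le (A : ℕ) : ∑ d ∈ Finset.Icc 1 A, (1 / (d : ℝ)) ≤ 1 + Real.log A := by
  have := harmonic_le_one_add_log A
  rw [harmonic_eq_sum_Icc] at this
  push_cast at this
  simpa [one_div] using this

lemma sum_tau_div (A : ℕ) : ∑ a ∈ Finset.Icc 1 A, ((a.divisors.card : ℝ) / a) ≤ (1 + Real.log A) ^ 2 := by
  have h1 : ∀ a ∈ Finset.Icc 1 A, ((a.divisors.card : ℝ) / a) =
      ∑ x ∈ a.divisorsAntidiagonal, (1 / (x.1 : ℝ)) * (1 / (x.2 : ℝ)) := by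
    intro a ha
    have : ∀ x ∈ a.divisorsAntidiagonal, (1 / (x.1 : ℝ)) * (1 / (x.2 : ℝ)) = 1 / (a : ℝ) := by
      intro x hx
      rw [Nat.mem_divisorsAntidiagonal] at hx
      rw [← hx.1]; push_cast; rw [one_div_mul_one_div]
    rw [Finset.sum_congr rfl this, Finset.sum_const, nsmul_eq_mul]
    have : (a.divisorsAntidiagonal).card = a.divisors.card := by
      rw [← Nat.map_div_right_divisors, Finset.card_map]
    rw [this]; ring
  rw [Finset.sum_congr rfl h1]
  calc _ = ∑ x ∈ (Finset.Icc 1 A).biUnion (fun a => a.divisorsAntidiagonal),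
        (1 / (x.1 : ℝ)) * (1 / (x.2 : ℝ)) := by
        rw [Finset.sum_biUnion]
        intro a _ b _ hab
        simp only [Function.onFun]
        rw [Finset.disjoint_left]
        intro x hx hx'
        rw [Nat.mem_divisorsAntidiagonal] at hx hx'
        exact hab (hx.1.symm.trans hx'.1)
    _ ≤ ∑ x ∈ (Finset.Icc 1 A) ×ˢ (Finset.Icc 1 A), (1 / (x.1 : ℝ)) * (1 / (x.2 : ℝ)) := by
        refine Finset.sum_le_sum_of_subset_of_nonneg ?_ (fun _ _ _ => by positivity)
        intro x hx
        simp only [Finset.mem_biUnion, Nat.mem_divisorsAntidiagonal, Finset.mem_Icc] at hx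
        obtain ⟨a, ha, hxa, _⟩ := hx
        have hne : x.1 * x.2 ≠ 0 := by omega
        have h1 := Nat.pos_of_ne_zero (left_ne_zero_of_mul hne)
        have h2 := Nat.pos_of_ne_zero (right_ne_zero_of_mul hne)
        simp only [Finset.mem_product, Finset.mem_Icc]
        have := Nat.le_mul_of_pos_right x.1 h2
        have := Nat.le_mul_of_pos_left x.2 h1
        omega
    _ = (∑ d ∈ Finset.Icc 1 A, (1 / (d : ℝ))) ^ 2 := by
        rw [sq, Finset.sum_mul_sum, Finset.sum_product]
    _ ≤ _ := by
        have := harm_le A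
        gcongr

lemma sum_gcd_div (A : ℕ) : ∑ a ∈ Finset.Icc 1 A, ∑ a' ∈ Finset.Icc 1 A, ((Nat.gcd a a' : ℕ) : ℝ) / a ≤
    A * (1 + Real.log A) ^ 2 := by
  calc _ ≤ ∑ a ∈ Finset.Icc 1 A, A * ((a.divisors.card : ℝ) / a) := by
        refine Finset.sum_le_sum fun a ha => ?_
        rw [← Finset.sum_div, mul_div_assoc']
        gcongr
        exact sum_gcd_le a A (by simp at ha; omega)
    _ ≤ _ := by
        rw [← Finset.mul_sum]
        have := sum_tau_div A
        gcongr

/-- count of integers up to x coprime to t -/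
lemma coprime_count (t : ℕ) (ht : Squarefree t) : ∃ δ : ℝ, (2 : ℝ)⁻¹ ^ (t.primeFactors.card) ≤ δ ∧ δ ≤ 1 ∧
    ∀ x : ℕ, |((((Finset.Icc 1 x).filter (fun a => Nat.Coprime a t)).card : ℕ) : ℝ) - x * δ| ≤
      2 ^ (t.primeFactors.card + 1) - 1 := by
  refine sqf_induction (P := fun t => ∃ δ : ℝ, (2 : ℝ)⁻¹ ^ (t.primeFactors.card) ≤ δ ∧ δ ≤ 1 ∧
    ∀ x : ℕ, |((((Finset.Icc 1 x).filter (fun a => Nat.Coprime a t)).card : ℕ) : ℝ) - x * δ| ≤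
      2 ^ (t.primeFactors.card + 1) - 1) ?_ ?_ t ht
  · refine ⟨1, by simp, by simp, fun x => ?_⟩
    simp
  · intro p a hp hpa ha ⟨δ, h1, h2, h3⟩
    have hδ : 0 ≤ δ := le_trans (by positivity) h1
    rw [Nat.Coprime.primeFactors_mul hpa,
      Finset.card_union_of_disjoint hpa.disjoint_primeFactors, hp.primeFactors, Finset.card_singleton]
    have hp2 : (2 : ℝ) ≤ p := by exact_mod_cast hp.two_le
    have hpi : (p : ℝ)⁻¹ ≤ 2⁻¹ := inv_anti₀ (by norm_num) hp2
    have hpi0 : 0 ≤ (p : ℝ)⁻¹ := by positivity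
    refine ⟨(1 - (p : ℝ)⁻¹) * δ, ?_, ?_, fun x => ?_⟩
    · rw [pow_add, pow_one]
      have h5 : (2 : ℝ)⁻¹ ≤ 1 - (p : ℝ)⁻¹ := by
        norm_num at hpi ⊢
        linarith
      exact mul_le_mul h5 h1 (by positivity) (by linarith)
    · nlinarith
    · have hc : (((Finset.Icc 1 x).filter (fun b => Nat.Coprime b (p * a))).card : ℝ) =
          ((Finset.Icc 1 x).filter (fun b => Nat.Coprime b a)).card -
          ((Finset.Icc 1 (x / p)).filter (fun b => Nat.Coprime b a)).card := by
        rw [eq_sub_iff_add_eq]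
        norm_cast
        have e1 : ((Finset.Icc 1 (x / p)).filter (fun b => Nat.Coprime b a)).card =
            (((Finset.Icc 1 x).filter (fun b => Nat.Coprime b a)).filter (fun b => p ∣ b)).card := by
          refine Finset.card_bij (fun b _ => p * b) ?_ ?_ ?_
          · intro b hb
            simp only [Finset.mem_filter, Finset.mem_Icc] at hb ⊢
            refine ⟨⟨⟨?_, ?_⟩, Nat.Coprime.mul_left hpa hb.2⟩, dvd_mul_right _ _⟩
            · exact Nat.mul_pos hp.pos hb.1.1
            · rw [mul_comm]; exact (Nat.le_div_iff_mul_le hp.pos).mp hb.1.2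
          · intro b _ c _ h
            exact Nat.eq_of_mul_eq_mul_left hp.pos h
          · intro b hb
            simp only [Finset.mem_filter, Finset.mem_Icc] at hb
            obtain ⟨c, rfl⟩ := hb.2
            refine ⟨c, ?_, rfl⟩
            simp only [Finset.mem_filter, Finset.mem_Icc]
            refine ⟨⟨?_, ?_⟩, Nat.Coprime.coprime_mul_left hb.1.2⟩
            · exact Nat.pos_of_mul_pos_left (by omega : 0 < p * c)
            · rw [Nat.le_div_iff_mul_le hp.pos, mul_comm]; exact hb.1.1.2
        have e2 : (Finset.Icc 1 x).filter (fun b => Nat.Coprime b (p * a)) =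
            ((Finset.Icc 1 x).filter (fun b => Nat.Coprime b a)).filter (fun b => ¬ p ∣ b) := by
          rw [Finset.filter_filter]
          refine Finset.filter_congr fun b _ => ?_
          rw [Nat.coprime_mul_iff_right, and_comm]
          rw [Nat.coprime_comm (n := b) (m := p), hp.coprime_iff_not_dvd]
        rw [e1, e2, add_comm]
        exact Finset.card_filter_add_card_filter_not _
      rw [hc]
      have ha1 := h3 x
      have ha2 := h3 (x / p)
      have hdiv1 : ((x / p : ℕ) : ℝ) ≤ x * (p : ℝ)⁻¹ := by
        have := @Nat.cast_div_le ℝ _ _ _ x p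
        rwa [div_eq_mul_inv] at this
      have hdiv2 : x * (p : ℝ)⁻¹ ≤ ((x / p : ℕ) : ℝ) + 1 := by
        have := Nat.lt_floor_add_one ((x : ℝ) / p)
        rw [Nat.floor_div_eq_div] at this
        rw [← div_eq_mul_inv]; exact this.le
      rw [abs_le] at ha1 ha2 ⊢
      have hp3 : (2 : ℝ) ^ (1 + a.primeFactors.card + 1) = 2 * 2 ^ (a.primeFactors.card + 1) := by ring
      rw [hp3]
      constructor <;> nlinarith

end Ari

section Gs

lemma eC_add (x y : ℝ) : eC (x + y) = eC x * eC y := by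
  unfold eC; rw [← Complex.exp_add]; push_cast; ring_nf

lemma eC_int (n : ℤ) : eC (n : ℝ) = 1 := by
  unfold eC
  rw [Complex.exp_eq_one_iff]
  exact ⟨n, by push_cast; ring⟩

lemma eC_norm (x : ℝ) : ‖eC x‖ = 1 := by
  unfold eC
  rw [Complex.norm_exp]; simp

lemma eC_zero : eC 0 = 1 := by simp [eC]

lemma eC_congr (a b : ℤ) (q : ℕ) (hq : q ≠ 0) (h : a ≡ b [ZMOD q]) : eC ((a : ℝ) / q) = eC ((b : ℝ) / q) := by
  obtain ⟨k, hk⟩ := h.symm.dvd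
  have : (a : ℝ) / q = (b : ℝ) / q + (k : ℤ) := by
    have : a = b + q * k := by linarith
    rw [this]; push_cast; field_simp
  rw [this, eC_add, eC_int, mul_one]

lemma eC_std (q : ℕ) [NeZero q] (a : ℤ) : eC ((a : ℝ) / q) = ZMod.stdAddChar (a : ZMod q) := by
  rw [ZMod.stdAddChar_coe, eC]; push_cast; ring_nf

/-- twisted Gauss sum of the Jacobi symbol -/
noncomputable def GJ (h : ℤ) (t : ℕ) : ℂ :=
  ∑ x ∈ Finset.range t, ((jacobiSym (x : ℤ) t : ℤ) : ℂ) * eC (((h * (x : ℤ) : ℤ) : ℝ) / t)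

/-- complex quadratic character -/
noncomputable def chiC (p : ℕ) [Fact p.Prime] : MulChar (ZMod p) ℂ :=
  (quadraticChar (ZMod p)).ringHomComp (Int.castRingHom ℂ)

lemma GJ_prime_eq (p : ℕ) [Fact p.Prime] (h : ℤ) :
    GJ h p = gaussSum (chiC p) ((ZMod.stdAddChar (N := p)).mulShift (h : ZMod p)) := by
  unfold GJ gaussSum
  rw [← sum_range_eq_zmod p]
  refine Finset.sum_congr rfl fun x _ => ?_
  rw [← jacobiSym.legendreSym.to_jacobiSym, legendreSym, eC_std, AddChar.mulShift_apply, chiC]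
  push_cast
  rfl

lemma chiC_quad (p : ℕ) [Fact p.Prime] : (chiC p).IsQuadratic :=
  (quadraticChar_isQuadratic (ZMod p)).comp _

lemma chiC_ne_one (p : ℕ) [Fact p.Prime] (hp : p ≠ 2) : chiC p ≠ 1 := by
  have h1 := quadraticChar_ne_one (F := ZMod p) (by rwa [ZMod.ringChar_zmod_n])
  exact (MulChar.ringHomComp_ne_one_iff (RingHom.injective_int _)).mpr h1

lemma GJ_sq_prime (p : ℕ) [Fact p.Prime] (hp : p ≠ 2) :
    GJ 1 p ^ 2 = chiC p (-1) * p := by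
  rw [GJ_prime_eq, Int.cast_one, AddChar.mulShift_one]
  rw [gaussSum_sq (chiC_ne_one p hp) (chiC_quad p) (ZMod.isPrimitive_stdAddChar p)]
  simp

lemma GJ_prime_shift (p : ℕ) [Fact p.Prime] (h : ℤ) (hh : ¬ (p : ℤ) ∣ h) :
    GJ h p = ((jacobiSym h p : ℤ) : ℂ) * GJ 1 p := by
  have h0 : (h : ZMod p) ≠ 0 := by rwa [Ne, ZMod.intCast_zmod_eq_zero_iff_dvd]
  have := gaussSum_mulShift (chiC p) (ZMod.stdAddChar (N := p)) (Units.mk0 _ h0)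
  rw [Units.val_mk0, ← GJ_prime_eq] at this
  have h1 : GJ 1 p = gaussSum (chiC p) (ZMod.stdAddChar (N := p)) := by
    rw [GJ_prime_eq, Int.cast_one, AddChar.mulShift_one]
  have h2 : chiC p (h : ZMod p) = ((jacobiSym h p : ℤ) : ℂ) := by
    rw [← jacobiSym.legendreSym.to_jacobiSym, legendreSym, chiC]; rfl
  rw [h1, ← this, h2, ← mul_assoc]
  have h3 : (jacobiSym h p) * (jacobiSym h p) = 1 := by
    rw [← sq]; apply jacobiSym.sq_one
    rw [Int.gcd_comm, ← Int.isCoprime_iff_gcd_eq_one]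
    exact (Nat.prime_iff_prime_int.mp (Fact.out : p.Prime)).coprime_iff_not_dvd.mpr hh
  have h3' : ((jacobiSym h p : ℤ) : ℂ) * ((jacobiSym h p : ℤ) : ℂ) = 1 := by exact_mod_cast h3
  rw [h3', one_mul]

lemma GJ_prime_norm (p : ℕ) [Fact p.Prime] (hp : p ≠ 2) (h : ℤ) : ‖GJ h p‖ ≤ Real.sqrt p := by
  have h1 : ‖GJ 1 p‖ = Real.sqrt p := by
    have := congrArg norm (GJ_sq_prime p hp)
    rw [norm_pow, norm_mul] at this
    have h2 : ‖chiC p (-1)‖ = 1 := by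
      have h3 : (chiC p (-1)) ^ 2 = 1 := by
        rw [← map_pow]; simp
      have := congrArg norm h3
      rw [norm_pow, norm_one] at this
      exact (pow_eq_one_iff_of_nonneg (norm_nonneg _) two_ne_zero).mp this
    rw [h2, one_mul, Complex.norm_natCast] at this
    rw [← this, Real.sqrt_sq (norm_nonneg _)]
  by_cases hh : (p : ℤ) ∣ h
  · have h0 : (h : ZMod p) = 0 := by rwa [ZMod.intCast_zmod_eq_zero_iff_dvd]
    have : GJ h p = 0 := by
      rw [GJ_prime_eq, h0, AddChar.mulShift_zero]
      unfold gaussSum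
      simp only [AddChar.one_apply, mul_one]
      exact MulChar.sum_eq_zero_of_ne_one (chiC_ne_one p hp)
    rw [this, norm_zero]; positivity
  · rw [GJ_prime_shift p h hh, norm_mul, h1]
    have h4 : ‖((jacobiSym h p : ℤ) : ℂ)‖ ≤ 1 := by
      have := jac_le_one h p
      rwa [Complex.norm_intCast]
    have := Real.sqrt_nonneg (p : ℝ)
    nlinarith

lemma GJ_mul (h : ℤ) (m n : ℕ) (hm : 0 < m) (hn : 0 < n) (hmn : Nat.Coprime m n) :
    ∃ u v : ℤ, GJ h (m * n) = GJ (h * u) m * GJ (h * v) n := by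
  have hb := Nat.gcd_eq_gcd_ab m n
  rw [hmn.gcd_eq_one] at hb
  set u := Nat.gcdA m n
  set v := Nat.gcdB m n
  refine ⟨v, u, ?_⟩
  unfold GJ
  rw [← sum_range_mul_coprime m n hm hn hmn]
  · refine Finset.sum_congr rfl fun x _ => ?_
    rw [jacobiSym.mul_right' _ hm.ne' hn.ne']
    have : (((h * (x : ℤ) : ℤ) : ℝ) / ((m * n : ℕ) : ℝ)) = (((h * v * (x : ℤ) : ℤ) : ℝ) / m) +
      (((h * u * (x : ℤ) : ℤ) : ℝ) / n) := by
      have hb' : (1 : ℝ) = m * (u : ℝ) + n * (v : ℝ) := by exact_mod_cast hb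
      have hm' : (m : ℝ) ≠ 0 := by positivity
      have hn' : (n : ℝ) ≠ 0 := by positivity
      push_cast
      field_simp
      linear_combination (h : ℝ) * x * hb'
    rw [this, eC_add]; push_cast; ring
  all_goals
  · intro x
    congr 1
    · congr 1
      apply jacobiSym.mod_left'
      push_cast
      exact Int.mod_modEq _ _
    · apply eC_congr _ _ _ (by omega)
      apply Int.ModEq.mul_left
      push_cast
      exact Int.mod_modEq _ _

lemma GJ_norm (t : ℕ) (ht : Squarefree t) (hodd : Odd t) (h : ℤ) : ‖GJ h t‖ ≤ Real.sqrt t := by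
  revert hodd h
  refine sqf_induction (P := fun t => Odd t → ∀ h, ‖GJ h t‖ ≤ Real.sqrt t) ?_ ?_ t ht
  · intro _ h
    simp [GJ, eC_zero]
  · intro p a hp hpa ha ih hodd h
    haveI : Fact p.Prime := ⟨hp⟩
    have hop := Nat.odd_mul.mp hodd
    have hp2 : p ≠ 2 := by
      rintro rfl
      exact absurd hop.1 (by decide)
    obtain ⟨u, v, huv⟩ := GJ_mul h p a hp.pos (Nat.pos_of_ne_zero ha.ne_zero) hpa
    rw [huv, norm_mul]
    push_cast
    rw [Real.sqrt_mul (by positivity)]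
    gcongr
    · exact GJ_prime_norm p hp2 _
    · exact ih hop.2 _

end Gs

section PV

lemma orth (t : ℕ) (ht : t ≠ 0) (k : ℤ) :
    ∑ h ∈ Finset.range t, eC ((((h : ℤ) * k : ℤ) : ℝ) / t) = if (t : ℤ) ∣ k then (t : ℂ) else 0 := by
  haveI : NeZero t := ⟨ht⟩
  have := AddChar.sum_mulShift (k : ZMod t) (ZMod.isPrimitive_stdAddChar t)
  simp only [ZMod.intCast_zmod_eq_zero_iff_dvd, ZMod.card] at this
  rw [← sum_range_eq_zmod t] at this
  push_cast at this
  rw [← this]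
  refine Finset.sum_congr rfl fun x _ => ?_
  rw [eC_std]; push_cast; rfl

lemma GJ_zero (t : ℕ) (ht : Squarefree t) (hodd : Odd t) (h1 : 1 < t) : GJ 0 t = 0 := by
  obtain ⟨p, hp, a, rfl⟩ := Nat.exists_prime_and_dvd h1.ne'
  haveI : Fact p.Prime := ⟨hp⟩
  have hop := Nat.odd_mul.mp hodd
  have hp2 : p ≠ 2 := by
    rintro rfl
    exact absurd hop.1 (by decide)
  have h2 := Nat.squarefree_mul_iff.mp ht
  obtain ⟨u, v, huv⟩ := GJ_mul 0 p a hp.pos (Nat.pos_of_ne_zero h2.2.2.ne_zero) h2.1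
  rw [huv, zero_mul, GJ_prime_eq, Int.cast_zero, AddChar.mulShift_zero, gaussSum_one_right (chiC_ne_one p hp2),
    zero_mul]

lemma GJ_inversion (t : ℕ) (ht : t ≠ 0) (n : ℤ) :
    (t : ℂ) * ((jacobiSym n t : ℤ) : ℂ) =
      ∑ h ∈ Finset.range t, GJ h t * eC (((-(h : ℤ) * n : ℤ) : ℝ) / t) := by
  unfold GJ
  simp only [Finset.sum_mul]
  rw [Finset.sum_comm]
  have h1 : ∀ x ∈ Finset.range t, ∑ h ∈ Finset.range t, ((jacobiSym (x : ℤ) t : ℤ) : ℂ) *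
      eC ((((h : ℤ) * (x : ℤ) : ℤ) : ℝ) / t) * eC (((-(h : ℤ) * n : ℤ) : ℝ) / t) =
      if x = (n % t).toNat then (t : ℂ) * ((jacobiSym n t : ℤ) : ℂ) else 0 := by
    intro x hx
    rw [Finset.mem_range] at hx
    have h2 : ∀ h ∈ Finset.range t, ((jacobiSym (x : ℤ) t : ℤ) : ℂ) *
      eC ((((h : ℤ) * (x : ℤ) : ℤ) : ℝ) / t) * eC (((-(h : ℤ) * n : ℤ) : ℝ) / t) =
      ((jacobiSym (x : ℤ) t : ℤ) : ℂ) * eC ((((h : ℤ) * ((x : ℤ) - n) : ℤ) : ℝ) / t) := by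
      intro h _
      rw [mul_assoc, ← eC_add]; congr 2; push_cast; ring
    rw [Finset.sum_congr rfl h2, ← Finset.mul_sum, orth t ht]
    have ht' : (t : ℤ) ≠ 0 := by exact_mod_cast ht
    have hn0 := Int.emod_nonneg n ht'
    have hcond : (t : ℤ) ∣ (x : ℤ) - n ↔ x = (n % t).toNat := by
      rw [← Int.modEq_iff_dvd, Int.ModEq]
      rw [Int.emod_eq_of_lt (a := (x : ℤ)) (by positivity) (by exact_mod_cast hx)]
      omega
    by_cases hc : (t : ℤ) ∣ (x : ℤ) - n
    · rw [if_pos hc, if_pos (hcond.mp hc), mul_comm]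
      congr 2
      exact jacobiSym.mod_left' (Int.modEq_iff_dvd.mpr hc).symm
    · rw [if_neg hc, if_neg (fun h => hc (hcond.mpr h)), mul_zero]
  rw [Finset.sum_congr rfl h1, Finset.sum_ite_eq', if_pos]
  have ht' : (t : ℤ) ≠ 0 := by exact_mod_cast ht
  have hn0 := Int.emod_nonneg n ht'
  have hn1 := Int.emod_lt_of_pos n (by omega : (0 : ℤ) < t)
  rw [Finset.mem_range]; omega

lemma geom_bound (θ : ℝ) (h0 : 0 < θ) (h1 : θ < 1) (M : ℤ) (N : ℕ) :
    ‖∑ k ∈ Finset.range N, eC (-(θ * ((M : ℝ) + k)))‖ ≤ (1 / 2) * (1 / θ + 1 / (1 - θ)) := by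
  have hpow : ∀ k : ℕ, eC (-(θ * ((M : ℝ) + k))) = eC (-(θ * M)) * eC (-θ) ^ k := by
    intro k
    induction k with
    | zero => simp
    | succ k ih =>
      rw [pow_succ, ← mul_assoc, ← ih, ← eC_add]; congr 1; push_cast; ring
  have hne : ‖eC (-θ) - 1‖ = 2 * Real.sin (Real.pi * θ) := by
    have h := Complex.norm_exp_I_mul_ofReal_sub_one (2 * Real.pi * (-θ))
    have h2 : eC (-θ) = Complex.exp (Complex.I * ((2 * Real.pi * (-θ) : ℝ) : ℂ)) := by
      unfold eC; push_cast; ring_nf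
    rw [h2, h]
    have h3 : 2 * Real.pi * (-θ) / 2 = -(Real.pi * θ) := by ring
    rw [h3, Real.sin_neg, norm_mul, norm_neg, Real.norm_eq_abs, Real.norm_eq_abs, abs_of_pos (by norm_num : (0:ℝ) < 2),
      abs_of_nonneg]
    apply Real.sin_nonneg_of_nonneg_of_le_pi (by positivity)
    nlinarith [Real.pi_pos]
  have hpos : 0 < Real.sin (Real.pi * θ) := by
    apply Real.sin_pos_of_pos_of_lt_pi (by positivity)
    nlinarith [Real.pi_pos]
  have hsin : 1 / Real.sin (Real.pi * θ) ≤ (1 / 2) * (1 / θ + 1 / (1 - θ)) := by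
    have h1' : 0 < 1 - θ := by linarith
    rcases le_total θ (1 / 2) with h | h
    · have h3 := Real.mul_le_sin (x := Real.pi * θ) (by positivity) (by nlinarith [Real.pi_pos])
      have h4 : 2 / Real.pi * (Real.pi * θ) = 2 * θ := by field_simp
      rw [h4] at h3
      calc _ ≤ 1 / (2 * θ) := one_div_le_one_div_of_le (by positivity) h3
        _ = (1 / 2) * (1 / θ) := by field_simp
        _ ≤ _ := by
          gcongr
          have : 0 < 1 / (1 - θ) := by positivity
          linarith
    · have h5 : Real.sin (Real.pi * θ) = Real.sin (Real.pi * (1 - θ)) := by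
        rw [← Real.sin_pi_sub]; ring_nf
      rw [h5]
      have h3 := Real.mul_le_sin (x := Real.pi * (1 - θ)) (by positivity) (by nlinarith [Real.pi_pos])
      have h4 : 2 / Real.pi * (Real.pi * (1 - θ)) = 2 * (1 - θ) := by field_simp
      rw [h4] at h3
      calc _ ≤ 1 / (2 * (1 - θ)) := one_div_le_one_div_of_le (by positivity) h3
        _ = (1 / 2) * (1 / (1 - θ)) := by field_simp
        _ ≤ _ := by
          gcongr
          have : 0 < 1 / θ := by positivity
          linarith
  rw [Finset.sum_congr rfl (fun k _ => hpow k), ← Finset.mul_sum, norm_mul, eC_norm, one_mul]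
  have hz : eC (-θ) ≠ 1 := by
    intro h
    rw [h, sub_self, norm_zero] at hne
    linarith
  rw [geom_sum_eq hz, norm_div, hne]
  refine le_trans ?_ hsin
  have h7 : ‖eC (-θ) ^ N - 1‖ ≤ 2 := by
    refine (norm_sub_le _ _).trans ?_
    rw [norm_pow, eC_norm, norm_one, one_pow]; norm_num
  rw [div_le_div_iff₀ (by positivity) hpos]
  nlinarith

/-- incomplete sum -/
noncomputable def SJ (t : ℕ) (M : ℤ) (N : ℕ) : ℝ := ∑ k ∈ Finset.range N, ((jacobiSym (M + k) t : ℤ) : ℝ)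

theorem polya_vinogradov (t : ℕ) (ht : Squarefree t) (hodd : Odd t) (h1 : 1 < t) (M : ℤ) (N : ℕ) :
    |SJ t M N| ≤ Real.sqrt t * (1 + Real.log t) := by
  have ht0 : t ≠ 0 := by omega
  have htp : (0 : ℝ) < t := by positivity
  have e1 : (t : ℂ) * ((SJ t M N : ℝ) : ℂ) = ∑ h ∈ Finset.range t, GJ h t *
      ∑ k ∈ Finset.range N, eC (-((h : ℝ) / t * ((M : ℝ) + k))) := by
    unfold SJ
    push_cast
    rw [Finset.mul_sum, Finset.sum_congr rfl (fun (k : ℕ) _ => GJ_inversion t ht0 (M + k)), Finset.sum_comm]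
    refine Finset.sum_congr rfl fun h _ => ?_
    rw [Finset.mul_sum]
    refine Finset.sum_congr rfl fun k _ => ?_
    congr 2; push_cast; field_simp
  have e2 : (t : ℝ) * |SJ t M N| ≤ t * (Real.sqrt t * (1 + Real.log t)) := by
    have : (t : ℝ) * |SJ t M N| = ‖(t : ℂ) * ((SJ t M N : ℝ) : ℂ)‖ := by
      rw [norm_mul, Complex.norm_natCast, Complex.norm_real, Real.norm_eq_abs]
    rw [this, e1, Finset.range_eq_Ico, Finset.sum_eq_sum_Ico_succ_bot (by omega), Nat.cast_zero]
    rw [GJ_zero t ht hodd h1, zero_mul, zero_add]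
    calc _ ≤ ∑ h ∈ Finset.Ico 1 t, Real.sqrt t * ((1 / 2) * (1 / ((h : ℝ) / t) + 1 / (1 - (h : ℝ) / t))) := by
          refine (norm_sum_le _ _).trans (Finset.sum_le_sum fun h hh => ?_)
          rw [Finset.mem_Ico] at hh
          rw [norm_mul]
          have hh1 : (0 : ℝ) < h := by exact_mod_cast hh.1
          have hh2 : (h : ℝ) < t := by exact_mod_cast hh.2
          gcongr
          · exact GJ_norm t ht hodd _
          · exact geom_bound _ (by positivity) (by rw [div_lt_one htp]; exact hh2) M N
      _ = ∑ h ∈ Finset.Ico 1 t, (t * Real.sqrt t / 2) * (1 / (h : ℝ)) +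
          ∑ h ∈ Finset.Ico 1 t, (t * Real.sqrt t / 2) * (1 / ((t - h : ℕ) : ℝ)) := by
          rw [← Finset.sum_add_distrib]
          refine Finset.sum_congr rfl fun h hh => ?_
          rw [Finset.mem_Ico] at hh
          have hh1 : (0 : ℝ) < h := by exact_mod_cast hh.1
          have hh2 : (0 : ℝ) < t - h := by rw [sub_pos]; exact_mod_cast hh.2
          rw [Nat.cast_sub hh.2.le]
          have : 1 - (h : ℝ) / t = (t - h) / t := by field_simp
          rw [this]
          field_simp
      _ = t * Real.sqrt t * ∑ h ∈ Finset.Ico 1 t, (1 / (h : ℝ)) := by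
          rw [← Finset.mul_sum, ← Finset.mul_sum]
          have := Finset.sum_Ico_reflect (fun h : ℕ => 1 / (h : ℝ)) 1 (m := t) (n := t) (by omega)
          rw [this]
          simp only [Nat.add_sub_cancel_left, Nat.add_sub_cancel]
          ring
      _ ≤ _ := by
          rw [mul_assoc]
          have h5 : ∑ h ∈ Finset.Ico 1 t, (1 / (h : ℝ)) ≤ 1 + Real.log t := by
            refine le_trans ?_ (harm_le t)
            refine Finset.sum_le_sum_of_subset_of_nonneg ?_ (fun _ _ _ => by positivity)
            intro x hx
            rw [Finset.mem_Ico] at hx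
            rw [Finset.mem_Icc]; omega
          gcongr
  exact le_of_mul_le_mul_left e2 htp

end PV

section Mom

/-- off-diagonal gcd weight -/
noncomputable def gw (t : ℕ) (x y : ℕ) : ℝ := if x = y then 0 else ((Int.gcd t ((x : ℤ) - y) : ℕ) : ℝ)

lemma gw_nonneg (t x y : ℕ) : 0 ≤ gw t x y := by unfold gw; positivity

lemma sum_gw_le (t B y : ℕ) (ht : t ≠ 0) (hy : y < B) :
    ∑ x ∈ Finset.range B, gw t x y ≤ 2 * B * (t.divisors.card : ℝ) := by
  have h0 := sum_gcd_le t B ht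
  have h1 : ∑ x ∈ (Finset.range B).filter (fun x => y < x), gw t x y ≤
      ∑ h ∈ Finset.Icc 1 B, ((Nat.gcd t h : ℕ) : ℝ) := by
    calc _ = ∑ x ∈ (Finset.range B).filter (fun x => y < x), ((Nat.gcd t (x - y) : ℕ) : ℝ) := by
          refine Finset.sum_congr rfl fun x hx => ?_
          simp only [Finset.mem_filter, Finset.mem_range] at hx
          rw [gw, if_neg (by omega), Int.gcd]
          congr 2
          omega
      _ = ∑ h ∈ ((Finset.range B).filter (fun x => y < x)).image (fun x => x - y), ((Nat.gcd t h : ℕ) : ℝ) := by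
          rw [Finset.sum_image]
          intro x hx x' hx' h
          simp only [Finset.coe_filter, Finset.mem_range, Set.mem_setOf_eq] at hx hx' h
          omega
      _ ≤ _ := by
          refine Finset.sum_le_sum_of_subset_of_nonneg ?_ (fun _ _ _ => by positivity)
          intro h hh
          simp only [Finset.mem_image, Finset.mem_filter, Finset.mem_range] at hh
          obtain ⟨x, hx, rfl⟩ := hh
          rw [Finset.mem_Icc]; omega
  have h2 : ∑ x ∈ (Finset.range B).filter (fun x => ¬ y < x), gw t x y ≤
      ∑ h ∈ Finset.Icc 1 B, ((Nat.gcd t h : ℕ) : ℝ) := by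
    calc _ = ∑ x ∈ (Finset.range B).filter (fun x => x < y), ((Nat.gcd t (y - x) : ℕ) : ℝ) := by
          have hss : (Finset.range B).filter (fun x => x < y) ⊆ (Finset.range B).filter (fun x => ¬ y < x) := by
            intro x hx
            simp only [Finset.mem_filter, Finset.mem_range] at hx ⊢
            omega
          rw [← Finset.sum_subset hss]
          · refine Finset.sum_congr rfl fun x hx => ?_
            simp only [Finset.mem_filter, Finset.mem_range] at hx
            rw [gw, if_neg (by omega), Int.gcd]
            congr 2
            omega
          · intro x hx hx'
            simp only [Finset.mem_filter, Finset.mem_range] at hx hx'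
            rw [gw, if_pos (by omega)]
      _ = ∑ h ∈ ((Finset.range B).filter (fun x => x < y)).image (fun x => y - x), ((Nat.gcd t h : ℕ) : ℝ) := by
          rw [Finset.sum_image]
          intro x hx x' hx' h
          simp only [Finset.coe_filter, Finset.mem_range, Set.mem_setOf_eq] at hx hx' h
          omega
      _ ≤ _ := by
          refine Finset.sum_le_sum_of_subset_of_nonneg ?_ (fun _ _ _ => by positivity)
          intro h hh
          simp only [Finset.mem_image, Finset.mem_filter, Finset.mem_range] at hh
          obtain ⟨x, hx, rfl⟩ := hh
          rw [Finset.mem_Icc]; omega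
  rw [← Finset.sum_filter_add_sum_filter_not _ (fun x => y < x)]
  linarith

lemma sum_gw_prod (t B : ℕ) (ht : t ≠ 0) (i : Fin 4) :
    ∑ b ∈ Fintype.piFinset (fun _ : Fin 4 => Finset.range B), ∏ j ∈ Finset.univ.erase i, gw t (b j) (b i) ≤
      B * (2 * B * (t.divisors.card : ℝ)) ^ 3 := by
  have h1 : ∀ b ∈ Fintype.piFinset (fun _ : Fin 4 => Finset.range B),
      ∏ j ∈ Finset.univ.erase i, gw t (b j) (b i) =
      ∑ y ∈ Finset.range B, ∏ j, (if j = i then (if b j = y then 1 else 0) else gw t (b j) y) := by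
    intro b hb
    rw [Fintype.mem_piFinset] at hb
    rw [Finset.sum_eq_single (b i)]
    · rw [← Finset.mul_prod_erase _ _ (Finset.mem_univ i)]
      simp only [if_true, one_mul]
      refine Finset.prod_congr rfl fun j hj => ?_
      rw [if_neg (Finset.ne_of_mem_erase hj)]
    · intro y _ hy
      rw [← Finset.mul_prod_erase _ _ (Finset.mem_univ i)]
      simp [hy.symm]
    · intro h; exact absurd (hb i) h
  rw [Finset.sum_congr rfl h1, Finset.sum_comm]
  calc _ ≤ ∑ y ∈ Finset.range B, (2 * B * (t.divisors.card : ℝ)) ^ 3 := by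
        refine Finset.sum_le_sum fun y hy => ?_
        rw [← Finset.prod_univ_sum (fun _ : Fin 4 => Finset.range B)
          (fun j x => if j = i then (if x = y then (1 : ℝ) else 0) else gw t x y)]
        rw [← Finset.mul_prod_erase _ _ (Finset.mem_univ i)]
        simp only [if_true, Finset.sum_ite_eq', hy, one_mul]
        have h3 : (2 * B * (t.divisors.card : ℝ)) ^ 3 = ∏ j ∈ Finset.univ.erase i, (2 * B * (t.divisors.card : ℝ)) := by
          simp
        rw [h3]
        refine Finset.prod_le_prod (fun j hj => ?_) (fun j hj => ?_)
        · simp only [if_neg (Finset.ne_of_mem_erase hj)]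
          exact Finset.sum_nonneg fun _ _ => gw_nonneg _ _ _
        · simp only [if_neg (Finset.ne_of_mem_erase hj)]
          exact sum_gw_le t B y ht (Finset.mem_range.mp hy)
    _ = _ := by simp

lemma gcd_prod_le {ι : Type*} (s : Finset ι) (t : ℕ) (ht : t ≠ 0) (h : ι → ℤ) :
    Int.gcd t (∏ j ∈ s, h j) ≤ ∏ j ∈ s, Int.gcd t (h j) := by
  induction s using Finset.induction_on with
  | empty => simp
  | insert a s ha ih =>
    rw [Finset.prod_insert ha, Finset.prod_insert ha]
    refine le_trans ?_ (Nat.mul_le_mul_left _ ih)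
    simp only [Int.gcd, Int.natAbs_natCast, Int.natAbs_mul]
    exact Nat.le_of_dvd (Nat.mul_pos (Nat.gcd_pos_of_pos_left _ (by omega)) (Nat.gcd_pos_of_pos_left _ (by omega)))
      (Nat.gcd_mul_right_dvd_mul_gcd _ _ _)

lemma paired_card (B : ℕ) : ((Fintype.piFinset (fun _ : Fin 4 => Finset.range B)).filter
    (fun b => ∀ i, ∃ j, j ≠ i ∧ b j = b i)).card ≤ 3 * B ^ 2 := by
  have key : ∀ f : ℕ × ℕ → (Fin 4 → ℕ), ((Finset.range B ×ˢ Finset.range B).image f).card ≤ B ^ 2 := by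
    intro f
    refine Finset.card_image_le.trans ?_
    simp [sq]
  calc _ ≤ ((Finset.range B ×ˢ Finset.range B).image (fun x => ![x.1, x.1, x.2, x.2]) ∪
      ((Finset.range B ×ˢ Finset.range B).image (fun x => ![x.1, x.2, x.1, x.2]) ∪
      (Finset.range B ×ˢ Finset.range B).image (fun x => ![x.1, x.2, x.2, x.1]))).card := by
        refine Finset.card_le_card ?_
        intro b hb
        simp only [Finset.mem_filter, Fintype.mem_piFinset] at hb
        have hq : b = ![b 0, b 1, b 2, b 3] := by
          ext k; fin_cases k <;> rfl
        have h0 := hb.2 0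
        have h1 := hb.2 1
        have h2 := hb.2 2
        have h3 := hb.2 3
        obtain ⟨j0, n0, h0⟩ := h0
        obtain ⟨j1, n1, h1⟩ := h1
        obtain ⟨j2, n2, h2⟩ := h2
        obtain ⟨j3, n3, h3⟩ := h3
        have hmem : ∀ k, b k ∈ Finset.range B := hb.1
        have hcase : (b 0 = b 1 ∧ b 2 = b 3) ∨ (b 0 = b 2 ∧ b 1 = b 3) ∨ (b 0 = b 3 ∧ b 1 = b 2) := by
          fin_cases j0 <;> fin_cases j1 <;> fin_cases j2 <;> fin_cases j3 <;> simp at n0 n1 n2 n3 h0 h1 h2 h3 <;> omega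
        simp only [Finset.mem_union, Finset.mem_image, Finset.mem_product, Prod.exists]
        rcases hcase with h | h | h
        · exact Or.inl ⟨b 0, b 2, ⟨hmem 0, hmem 2⟩, by
            rw [hq]; ext k; fin_cases k <;> simp [h.1, h.2]⟩
        · exact Or.inr (Or.inl ⟨b 0, b 1, ⟨hmem 0, hmem 1⟩, by
            rw [hq]; ext k; fin_cases k <;> simp [h.1, h.2]⟩)
        · exact Or.inr (Or.inr ⟨b 0, b 1, ⟨hmem 0, hmem 1⟩, by
            rw [hq]; ext k; fin_cases k <;> simp [h.1, h.2]⟩)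
    _ ≤ B ^ 2 + (B ^ 2 + B ^ 2) := by
        refine (Finset.card_union_le _ _).trans ?_
        refine Nat.add_le_add (key _) ?_
        refine (Finset.card_union_le _ _).trans ?_
        exact Nat.add_le_add (key _) (key _)
    _ = _ := by ring

lemma moment4 (t : ℕ) (ht : Squarefree t) (hodd : Odd t) (B : ℕ) :
    ∑ x ∈ Finset.range t, (∑ b ∈ Finset.range B, ((jacobiSym ((x : ℤ) + (b : ℤ)) t : ℤ) : ℝ)) ^ 4 ≤
      3 * (B : ℝ) ^ 2 * t + 41 ^ (t.primeFactors.card) * Real.sqrt t *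
        (4 * (B * (2 * B * (t.divisors.card : ℝ)) ^ 3)) := by
  set Ω := Fintype.piFinset (fun _ : Fin 4 => Finset.range B)
  have e1 : ∑ x ∈ Finset.range t, (∑ b ∈ Finset.range B, ((jacobiSym ((x : ℤ) + (b : ℤ)) t : ℤ) : ℝ)) ^ 4 =
      ∑ b ∈ Ω, TT (fun i => (b i : ℤ)) t := by
    unfold TT
    rw [Finset.sum_comm]
    refine Finset.sum_congr rfl fun x _ => ?_
    have : (∑ b ∈ Finset.range B, ((jacobiSym ((x : ℤ) + (b : ℤ)) t : ℤ) : ℝ)) ^ 4 =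
      ∏ i : Fin 4, ∑ b ∈ Finset.range B, ((jacobiSym ((x : ℤ) + (b : ℤ)) t : ℤ) : ℝ) := by simp
    rw [this, Finset.prod_univ_sum]
    refine Finset.sum_congr rfl fun b _ => ?_
    simp only [Fin.prod_univ_four, jacobiSym.mul_left]
    push_cast; rfl
  rw [e1, ← Finset.sum_filter_add_sum_filter_not Ω (fun b => ∀ i, ∃ j, j ≠ i ∧ b j = b i)]
  have ht0 : t ≠ 0 := ht.ne_zero
  refine add_le_add ?_ ?_
  · calc _ ≤ ∑ b ∈ Ω.filter (fun b => ∀ i, ∃ j, j ≠ i ∧ b j = b i), (t : ℝ) :=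
          Finset.sum_le_sum fun b _ => (le_abs_self _).trans (TT_trivial _ t)
      _ ≤ _ := by
        rw [Finset.sum_const, nsmul_eq_mul]
        gcongr
        exact_mod_cast paired_card B
  · set K := (41 : ℝ) ^ (t.primeFactors.card) * Real.sqrt t with hK
    have hK0 : 0 ≤ K := by positivity
    calc _ ≤ ∑ b ∈ Ω.filter (fun b => ¬ ∀ i, ∃ j, j ≠ i ∧ b j = b i),
          K * ∑ i : Fin 4, ∏ j ∈ Finset.univ.erase i, gw t (b j) (b i) := by
          refine Finset.sum_le_sum fun b hb => ?_
          rw [Finset.mem_filter] at hb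
          have hb2 := hb.2
          push Not at hb2
          obtain ⟨i, hi⟩ := hb2
          refine (le_abs_self _).trans ((TT_bound _ i t ht hodd).trans ?_)
          rw [← hK]
          gcongr
          have hP : ∀ i : Fin 4, 0 ≤ ∏ j ∈ Finset.univ.erase i, gw t (b j) (b i) :=
            fun i => Finset.prod_nonneg fun _ _ => gw_nonneg _ _ _
          refine le_trans ?_ (Finset.single_le_sum (f := fun i : Fin 4 => ∏ j ∈ Finset.univ.erase i, gw t (b j) (b i))
            (fun i _ => hP i) (Finset.mem_univ i))
          have h3 : ∏ j ∈ Finset.univ.erase i, gw t (b j) (b i) =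
            ((∏ j ∈ Finset.univ.erase i, Int.gcd t ((b j : ℤ) - b i) : ℕ) : ℝ) := by
            push_cast
            refine Finset.prod_congr rfl fun j hj => ?_
            rw [gw, if_neg (hi j (Finset.ne_of_mem_erase hj))]
          rw [h3]
          have h4 := gcd_prod_le (Finset.univ.erase i) t ht0 (fun j => (b j : ℤ) - b i)
          have h5 : (1 : ℝ) ≤ (Int.gcd t (∏ j ∈ Finset.univ.erase i, ((b j : ℤ) - b i)) : ℕ) := by
            exact_mod_cast Int.gcd_pos_of_ne_zero_left _ (by exact_mod_cast ht0)
          calc _ ≤ ((Int.gcd t (∏ j ∈ Finset.univ.erase i, ((b j : ℤ) - b i)) : ℕ) : ℝ) := by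
                rw [Real.sqrt_le_left (by linarith)]
                nlinarith
            _ ≤ _ := by exact_mod_cast h4
      _ ≤ ∑ b ∈ Ω, K * ∑ i : Fin 4, ∏ j ∈ Finset.univ.erase i, gw t (b j) (b i) := by
          refine Finset.sum_le_sum_of_subset_of_nonneg (Finset.filter_subset _ _) (fun b _ _ => ?_)
          exact mul_nonneg hK0 (Finset.sum_nonneg fun i _ => Finset.prod_nonneg fun _ _ => gw_nonneg _ _ _)
      _ = K * ∑ i : Fin 4, ∑ b ∈ Ω, ∏ j ∈ Finset.univ.erase i, gw t (b j) (b i) := by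
          rw [← Finset.mul_sum, Finset.sum_comm]
      _ ≤ K * ∑ i : Fin 4, (B * (2 * B * (t.divisors.card : ℝ)) ^ 3) := by
          gcongr with i _
          exact sum_gw_prod t B ht0 i
      _ = _ := by simp

end Mom

section Nu

lemma pair_count (t : ℕ) (A N a a' : ℕ) (M : ℤ) (ha : 1 ≤ a) (ha' : 1 ≤ a') (haA : a ≤ A) (ha'A : a' ≤ A)
    (hAN : 2 * A * N ≤ t) :
    (((Finset.range N ×ˢ Finset.range N).filter (fun k => (t : ℤ) ∣ a' * (M + k.1) - a * (M + k.2))).card : ℝ) ≤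
      1 + N * ((Nat.gcd a a' : ℕ) / (a : ℝ)) := by
  set P := (Finset.range N ×ˢ Finset.range N).filter (fun k => (t : ℤ) ∣ a' * (M + k.1) - a * (M + k.2)) with hP
  have hdiff : ∀ k ∈ P, ∀ l ∈ P, (a' : ℤ) * ((k.1 : ℤ) - l.1) = a * ((k.2 : ℤ) - l.2) := by
    intro k hk l hl
    simp only [hP, Finset.mem_filter, Finset.mem_product, Finset.mem_range] at hk hl
    have h1 := dvd_sub hk.2 hl.2
    have h2 : (a' : ℤ) * (M + k.1) - a * (M + k.2) - (a' * (M + l.1) - a * (M + l.2)) =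
      a' * ((k.1 : ℤ) - l.1) - a * ((k.2 : ℤ) - l.2) := by ring
    rw [h2] at h1
    have h3 : |(a' : ℤ) * ((k.1 : ℤ) - l.1) - a * ((k.2 : ℤ) - l.2)| < t := by
      have b1 : |(k.1 : ℤ) - l.1| ≤ N - 1 := by rw [abs_le]; omega
      have b2 : |(k.2 : ℤ) - l.2| ≤ N - 1 := by rw [abs_le]; omega
      have hN : (1 : ℤ) ≤ N := by omega
      have hA : (1 : ℤ) ≤ A := by omega
      calc _ ≤ |(a' : ℤ) * ((k.1 : ℤ) - l.1)| + |a * ((k.2 : ℤ) - l.2)| := abs_sub _ _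
        _ = (a' : ℤ) * |(k.1 : ℤ) - l.1| + a * |(k.2 : ℤ) - l.2| := by
            rw [abs_mul, abs_mul, Nat.abs_cast, Nat.abs_cast]
        _ ≤ (A : ℤ) * (N - 1) + A * (N - 1) := by
            gcongr
        _ < 2 * A * N := by nlinarith
        _ ≤ t := by exact_mod_cast hAN
    have := Int.eq_zero_of_abs_lt_dvd h1 h3
    linarith
  rcases P.eq_empty_or_nonempty with h0 | ⟨l, hl⟩
  · rw [h0]; simp; positivity
  set g := Nat.gcd a a' with hg
  have hgpos : 0 < g := Nat.gcd_pos_of_pos_left _ ha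
  set m := a / g with hm
  have ham : a = g * m := (Nat.mul_div_cancel' (Nat.gcd_dvd_left a a')).symm
  have hm0 : 0 < m := Nat.pos_of_ne_zero (by rintro h; rw [h] at ham; omega)
  have himg : P.card ≤ ((Finset.range N).filter (fun k => k ≡ l.1 [MOD m])).card := by
    refine Finset.card_le_card_of_injOn (fun k => k.1) ?_ ?_
    · intro k hk
      have hk' := hk
      simp only [hP, Finset.coe_filter, Finset.mem_product, Finset.mem_range, Set.mem_setOf_eq] at hk'
      simp only [Finset.coe_filter, Finset.mem_range, Set.mem_setOf_eq]
      refine ⟨hk'.1.1, ?_⟩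
      have h := hdiff k hk l hl
      rw [← Int.natCast_modEq_iff]
      refine (Int.modEq_iff_dvd.mpr ?_).symm
      have ha'g : a' = g * (a' / g) := (Nat.mul_div_cancel' (Nat.gcd_dvd_right a a')).symm
      have h5 : (g : ℤ) * (((a' / g : ℕ) : ℤ) * ((k.1 : ℤ) - l.1)) = g * (m * ((k.2 : ℤ) - l.2)) := by
        have e1 : (a : ℤ) = g * m := by exact_mod_cast ham
        have e2 : (a' : ℤ) = g * (a' / g : ℕ) := by exact_mod_cast ha'g
        rw [e1, e2] at h
        linarith
      have h6 := mul_left_cancel₀ (by exact_mod_cast hgpos.ne' : (g : ℤ) ≠ 0) h5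
      have hco : IsCoprime (m : ℤ) ((a' / g : ℕ) : ℤ) :=
        Nat.isCoprime_iff_coprime.mpr (Nat.coprime_div_gcd_div_gcd hgpos)
      exact hco.dvd_of_dvd_mul_left ⟨_, h6⟩
    · intro k hk k' hk' h
      simp only at h
      have h1 := hdiff k hk k' hk'
      rw [h, sub_self, mul_zero] at h1
      have h2 : (k.2 : ℤ) - k'.2 = 0 := by
        rcases mul_eq_zero.mp h1.symm with h2 | h2
        · omega
        · exact h2
      exact Prod.ext h (by omega)
  have hcnt : ((Finset.range N).filter (fun k => k ≡ l.1 [MOD m])).card ≤ N / m + 1 := by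
    have := Nat.count_modEq_card N hm0 l.1
    rw [Nat.count_eq_card_filter_range] at this
    rw [this]
    split_ifs <;> omega
  calc (P.card : ℝ) ≤ ((N / m + 1 : ℕ) : ℝ) := by exact_mod_cast himg.trans hcnt
    _ ≤ 1 + N / (m : ℝ) := by
        push_cast
        have := @Nat.cast_div_le ℝ _ _ _ N m
        linarith
    _ = _ := by
        rw [ham]; push_cast
        have : (g : ℝ) ≠ 0 := by positivity
        field_simp

lemma holder_fiber {Y X : Type*} [Fintype X] (s : Finset Y) (f : Y → X) (T : X → ℝ) :
    (∑ y ∈ s, |T (f y)|) ^ 4 ≤ (s.card : ℝ) ^ 2 *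
      (((s ×ˢ s).filter (fun z => f z.1 = f z.2)).card : ℝ) * ∑ x, T x ^ 4 := by
  set ν : X → ℝ := fun x => ((s.filter (fun y => f y = x)).card : ℝ) with hν
  have hfib : ∀ g : X → ℝ, ∑ y ∈ s, g (f y) = ∑ x, ν x * g x := by
    intro g
    rw [← Finset.sum_fiberwise s f]
    refine Finset.sum_congr rfl fun x _ => ?_
    rw [Finset.sum_congr rfl (g := fun _ => g x)]
    · simp [hν]
    · intro y hy
      rw [Finset.mem_filter] at hy
      rw [hy.2]
  have h1 : (∑ y ∈ s, |T (f y)|) ^ 2 ≤ (s.card : ℝ) * ∑ y ∈ s, T (f y) ^ 2 := by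
    have := sq_sum_le_card_mul_sum_sq (s := s) (f := fun y => |T (f y)|)
    simpa [sq_abs] using this
  have h2 : (∑ y ∈ s, T (f y) ^ 2) ^ 2 ≤ (∑ x, ν x ^ 2) * ∑ x, T x ^ 4 := by
    rw [hfib (fun x => T x ^ 2)]
    have := Finset.sum_mul_sq_le_sq_mul_sq Finset.univ ν (fun x => T x ^ 2)
    refine this.trans (le_of_eq ?_)
    congr 1
    refine Finset.sum_congr rfl fun x _ => by ring
  have h3 : ∑ x, ν x ^ 2 = (((s ×ˢ s).filter (fun z => f z.1 = f z.2)).card : ℝ) := by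
    have : ∑ x, ν x ^ 2 = ∑ x, ν x * ν x := by simp [sq]
    rw [this, ← hfib ν, Finset.card_filter, Finset.sum_product]
    push_cast
    refine Finset.sum_congr rfl fun y _ => ?_
    simp only [hν, Finset.card_filter]
    push_cast
    refine Finset.sum_congr rfl fun z _ => ?_
    simp only [eq_comm]
  rw [← h3]
  calc (∑ y ∈ s, |T (f y)|) ^ 4 = ((∑ y ∈ s, |T (f y)|) ^ 2) ^ 2 := by ring
    _ ≤ ((s.card : ℝ) * ∑ y ∈ s, T (f y) ^ 2) ^ 2 := by gcongr
    _ = (s.card : ℝ) ^ 2 * (∑ y ∈ s, T (f y) ^ 2) ^ 2 := by ring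
    _ ≤ (s.card : ℝ) ^ 2 * ((∑ x, ν x ^ 2) * ∑ x, T x ^ 4) := by gcongr
    _ = _ := by ring

lemma burgess_core (t : ℕ) (ht : Squarefree t) (hodd : Odd t) (M : ℤ) (A B N : ℕ) (hAN : 2 * A * N ≤ t) :
    (∑ a ∈ (Finset.Icc 1 A).filter (fun a => Nat.Coprime a t), ∑ k ∈ Finset.range N,
      |∑ b ∈ Finset.range B, ((jacobiSym (M + k + a * b) t : ℤ) : ℝ)|) ^ 4 ≤
    ((A : ℝ) * N) ^ 2 * ((A : ℝ) ^ 2 + N * (A * (1 + Real.log A) ^ 2)) *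
     (3 * (B : ℝ) ^ 2 * t + 41 ^ (t.primeFactors.card) * Real.sqrt t *
        (4 * (B * (2 * B * (t.divisors.card : ℝ)) ^ 3))) := by
  haveI : NeZero t := ⟨ht.ne_zero⟩
  set 𝒜 := (Finset.Icc 1 A).filter (fun a => Nat.Coprime a t) with h𝒜
  set s := 𝒜 ×ˢ Finset.range N with hs
  set f : ℕ × ℕ → ZMod t := fun y => ((M + y.2 : ℤ) : ZMod t) * ((y.1 : ZMod t))⁻¹ with hf
  set T : ZMod t → ℝ := fun x => ∑ b ∈ Finset.range B, ((jacobiSym ((x.val : ℤ) + (b : ℤ)) t : ℤ) : ℝ) with hT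
  have hinv : ∀ a ∈ 𝒜, (a : ZMod t) * (a : ZMod t)⁻¹ = 1 := by
    intro a ha
    rw [h𝒜, Finset.mem_filter] at ha
    exact ZMod.coe_mul_inv_eq_one a ha.2
  have hcardA : 𝒜.card ≤ A := by
    refine (Finset.card_filter_le _ _).trans ?_
    simp
  have e1 : ∑ a ∈ 𝒜, ∑ k ∈ Finset.range N,
      |∑ b ∈ Finset.range B, ((jacobiSym (M + k + a * b) t : ℤ) : ℝ)| = ∑ y ∈ s, |T (f y)| := by
    rw [hs, Finset.sum_product]
    refine Finset.sum_congr rfl fun a ha => Finset.sum_congr rfl fun k _ => ?_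
    have h1 : ∀ b ∈ Finset.range B, ((jacobiSym (M + k + a * b) t : ℤ) : ℝ) =
      ((jacobiSym a t : ℤ) : ℝ) * ((jacobiSym (((f (a, k)).val : ℤ) + (b : ℤ)) t : ℤ) : ℝ) := by
      intro b _
      rw [← Int.cast_mul, ← jacobiSym.mul_left]
      congr 1
      apply jacobiSym.mod_left'
      change _ ≡ _ [ZMOD t]
      rw [← ZMod.intCast_eq_intCast_iff]
      push_cast
      rw [ZMod.natCast_zmod_val]
      simp only [hf]
      push_cast
      linear_combination (-(M : ZMod t) - k) * hinv a ha
    rw [Finset.sum_congr rfl h1, ← Finset.mul_sum, abs_mul]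
    have h2 : |((jacobiSym a t : ℤ) : ℝ)| = 1 := by
      rw [h𝒜, Finset.mem_filter] at ha
      have : Int.gcd a t = 1 := by
        rw [Int.gcd_natCast_natCast]; exact ha.2
      rcases jacobiSym.eq_one_or_neg_one this with h | h <;> simp [h]
    rw [h2, one_mul]
  rw [e1]
  refine (holder_fiber s f T).trans ?_
  have e2 : ∑ x, T x ^ 4 = ∑ x ∈ Finset.range t,
      (∑ b ∈ Finset.range B, ((jacobiSym ((x : ℤ) + (b : ℤ)) t : ℤ) : ℝ)) ^ 4 := by
    rw [← sum_range_eq_zmod t]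
    refine Finset.sum_congr rfl fun x hx => ?_
    simp only [hT]
    rw [ZMod.val_natCast_of_lt (Finset.mem_range.mp hx)]
  rw [e2]
  have hcard : (s.card : ℝ) ≤ A * N := by
    rw [hs, Finset.card_product, Finset.card_range]
    push_cast
    gcongr
  have hcount : (((s ×ˢ s).filter (fun z => f z.1 = f z.2)).card : ℝ) ≤
      (A : ℝ) ^ 2 + N * (A * (1 + Real.log A) ^ 2) := by
    have hlog : 0 ≤ 1 + Real.log A := by
      rcases Nat.eq_zero_or_pos A with h | h
      · simp [h]
      · have := Real.log_nonneg (by exact_mod_cast h : (1 : ℝ) ≤ A); linarith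
    calc (((s ×ˢ s).filter (fun z => f z.1 = f z.2)).card : ℝ)
        ≤ ∑ p ∈ Finset.Icc 1 A ×ˢ Finset.Icc 1 A, (((Finset.range N ×ˢ Finset.range N).filter
          (fun k => (t : ℤ) ∣ (p.2 : ℤ) * (M + k.1) - p.1 * (M + k.2))).card : ℝ) := by
          norm_cast
          rw [← Finset.card_sigma]
          refine Finset.card_le_card_of_injOn (fun z => ⟨(z.1.1, z.2.1), (z.1.2, z.2.2)⟩) ?_ ?_
          · intro z hz
            simp only [hs, Finset.coe_filter, Finset.mem_product, Set.mem_setOf_eq] at hz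
            obtain ⟨⟨⟨h1, h2⟩, h3, h4⟩, h5⟩ := hz
            have h1' := h1
            have h3' := h3
            rw [h𝒜, Finset.mem_filter] at h1 h3
            simp only [Finset.coe_sigma, Set.mem_sigma_iff, Finset.mem_coe, Finset.mem_product, Finset.mem_filter]
            refine ⟨⟨h1.1, h3.1⟩, ⟨h2, h4⟩, ?_⟩
            rw [← ZMod.intCast_zmod_eq_zero_iff_dvd]
            simp only [hf] at h5
            push_cast at h5 ⊢
            have i1 := hinv _ h1'
            have i2 := hinv _ h3'
            linear_combination (z.1.1 : ZMod t) * (z.2.1 : ZMod t) * h5 - (z.2.1 : ZMod t) * ((M : ZMod t) + z.1.2) * i1 + (z.1.1 : ZMod t) * ((M : ZMod t) + z.2.2) * i2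
          · intro z _ z' _ h
            simp only [Sigma.mk.injEq, Prod.mk.injEq, heq_eq_eq] at h
            ext <;> simp [h]
      _ ≤ ∑ p ∈ Finset.Icc 1 A ×ˢ Finset.Icc 1 A, (1 + N * ((Nat.gcd p.1 p.2 : ℕ) / (p.1 : ℝ))) := by
          refine Finset.sum_le_sum fun p hp => ?_
          simp only [Finset.mem_product, Finset.mem_Icc] at hp
          exact pair_count t A N p.1 p.2 M hp.1.1 hp.2.1 hp.1.2 hp.2.2 hAN
      _ = (A : ℝ) ^ 2 + N * ∑ a ∈ Finset.Icc 1 A, ∑ a' ∈ Finset.Icc 1 A, ((Nat.gcd a a' : ℕ) : ℝ) / a := by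
          rw [Finset.sum_add_distrib, ← Finset.mul_sum,
            Finset.sum_product (f := fun p : ℕ × ℕ => ((Nat.gcd p.1 p.2 : ℕ) : ℝ) / (p.1 : ℝ))]
          simp [sq]
      _ ≤ _ := by
          have := sum_gcd_div A
          gcongr
  have h4 := moment4 t ht hodd B
  have h5 : 0 ≤ ∑ x ∈ Finset.range t,
      (∑ b ∈ Finset.range B, ((jacobiSym ((x : ℤ) + (b : ℤ)) t : ℤ) : ℝ)) ^ 4 :=
    Finset.sum_nonneg fun _ _ => by positivity
  exact mul_le_mul (mul_le_mul (by gcongr) (le_trans (le_of_eq (by congr!)) hcount) (by positivity) (by positivity)) h4 h5 (by positivity)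

end Nu

section Burg

lemma SJ_shift (t : ℕ) (M : ℤ) (N h : ℕ) :
    SJ t M N - SJ t (M + h) N = SJ t M h - SJ t (M + N) h := by
  have h1 : SJ t M (N + h) = SJ t M N + SJ t (M + N) h := by
    unfold SJ
    rw [Finset.sum_range_add]
    congr 1
    refine Finset.sum_congr rfl fun k _ => ?_
    push_cast; rw [add_assoc]
  have h2 : SJ t M (h + N) = SJ t M h + SJ t (M + h) N := by
    unfold SJ
    rw [Finset.sum_range_add]
    congr 1
    refine Finset.sum_congr rfl fun k _ => ?_
    push_cast; rw [add_assoc]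
  rw [add_comm h N] at h2
  linarith

lemma SJ_trivial (t : ℕ) (M : ℤ) (N : ℕ) : |SJ t M N| ≤ N := by
  unfold SJ
  refine (Finset.abs_sum_le_sum_abs _ _).trans ?_
  refine (Finset.sum_le_sum fun x _ => jac_le_one _ _).trans ?_
  simp

lemma burg_f2 (B r E K τ : ℝ) (hB : 1 ≤ B) (hr : 1 ≤ r) (hE : 1 ≤ E) (hBr : B ≤ r ^ 4) (hK : K ≤ E) (hτ : τ ≤ E)
    (hK0 : 0 ≤ K) (hτ0 : 0 ≤ τ) :
    3 * B ^ 2 * r ^ 16 + K * r ^ 8 * (4 * (B * (2 * B * τ) ^ 3)) ≤ 35 * E ^ 4 * r ^ 24 := by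
  have g1 : 3 * B ^ 2 * r ^ 16 ≤ 3 * E ^ 4 * r ^ 24 := by
    calc 3 * B ^ 2 * r ^ 16 ≤ 3 * (r ^ 4) ^ 2 * r ^ 16 := by gcongr
      _ = 3 * 1 * r ^ 24 := by ring
      _ ≤ _ := by
        gcongr
        exact one_le_pow₀ hE
  have g2 : K * r ^ 8 * (4 * (B * (2 * B * τ) ^ 3)) ≤ E * r ^ 8 * (4 * (r ^ 4 * (2 * r ^ 4 * E) ^ 3)) := by
    gcongr
  calc _ ≤ 3 * E ^ 4 * r ^ 24 + E * r ^ 8 * (4 * (r ^ 4 * (2 * r ^ 4 * E) ^ 3)) := add_le_add g1 g2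
    _ = _ := by ring

lemma burg_fin (A B N r E D V s : ℝ) (hA : 0 ≤ A) (hB : 1 ≤ B) (hN : 0 ≤ N) (hr : 1 ≤ r) (hE : 1 ≤ E)
    (hs : 0 ≤ s) (hs4 : s ^ 4 = N ^ 2) (hBge : r ^ 4 ≤ 2 * B) (hAN : N ≤ 32 * (A * B)) (hD : D = 50 * E ^ 3 * r ^ 3)
    (hV4 : V ^ 4 ≤ 70 * A ^ 3 * N ^ 3 * E ^ 6 * r ^ 24) : V ≤ (A / (2 * E)) * B * (D * s / 2) := by
  have hE0 : 0 < E := by linarith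
  refine le_of_pow_le_pow_left₀ (n := 4) (by norm_num) (by rw [hD]; positivity) (hV4.trans ?_)
  have hB3 : r ^ 12 ≤ 8 * B ^ 3 := by
    calc r ^ 12 = (r ^ 4) ^ 3 := by ring
      _ ≤ (2 * B) ^ 3 := by gcongr
      _ = _ := by ring
  have e5 : (A / (2 * E) * B * (D * s / 2)) ^ 4 =
      (50 ^ 4 / 256) * E ^ 8 * r ^ 12 * A ^ 4 * B ^ 4 * N ^ 2 := by
    rw [← hs4, hD]
    field_simp; ring
  rw [e5]
  have hNB : N * r ^ 12 ≤ (32 * (A * B)) * (8 * B ^ 3) := by gcongr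
  have hfin : 70 * (N * r ^ 12) ≤ (50 ^ 4 / 256) * E ^ 2 * (A * B ^ 4) := by
    have hq : (0 : ℝ) ≤ A * B ^ 4 := by positivity
    have hE2 : 1 ≤ E ^ 2 := one_le_pow₀ hE
    have hq2 : (A * B ^ 4) * 1 ≤ A * B ^ 4 * E ^ 2 := by gcongr
    nlinarith
  calc 70 * A ^ 3 * N ^ 3 * E ^ 6 * r ^ 24 = (A ^ 3 * N ^ 2 * E ^ 6 * r ^ 12) * (70 * (N * r ^ 12)) := by ring
    _ ≤ (A ^ 3 * N ^ 2 * E ^ 6 * r ^ 12) * ((50 ^ 4 / 256) * E ^ 2 * (A * B ^ 4)) := by gcongr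
    _ = _ := by ring

set_option maxHeartbeats 1000000 in
lemma burgess_ind (t : ℕ) (ht : Squarefree t) (hodd : Odd t) (h1 : 1 < t) (r E : ℝ) (hr1 : 1 ≤ r)
    (hr : r ^ 16 = t) (hE1 : 1 ≤ E) (hE41 : (41 : ℝ) ^ (t.primeFactors.card) ≤ E)
    (hE2 : (2 : ℝ) ^ (t.primeFactors.card) ≤ E) (hElog : 1 + Real.log t ≤ E) (N : ℕ) :
    ∀ M : ℤ, |SJ t M N| ≤ 50 * E ^ 3 * r ^ 3 * Real.sqrt N := by
  have hr0 : 0 < r := by linarith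
  have hE0 : 0 < E := by linarith
  have hE3 : 1 ≤ E ^ 3 := one_le_pow₀ hE1
  have hEE3 : E ≤ E ^ 3 := le_self_pow₀ hE1 (by norm_num)
  have hsqt : Real.sqrt t = r ^ 8 := by
    rw [← hr, show r ^ 16 = (r ^ 8) ^ 2 by ring, Real.sqrt_sq (by positivity)]
  induction N using Nat.strong_induction_on with
  | _ N ih =>
  intro M
  rcases Nat.eq_zero_or_pos N with hN0 | hNpos
  · subst hN0; simp [SJ]
  have hNR : (0 : ℝ) < N := by exact_mod_cast hNpos
  have hNs : (N : ℝ) = Real.sqrt N * Real.sqrt N := (Real.mul_self_sqrt hNR.le).symm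
  by_cases hsmall : (N : ℝ) ≤ 128 * E ^ 2 * r ^ 6
  · refine (SJ_trivial t M N).trans ?_
    have h2 : Real.sqrt N ≤ 12 * E * r ^ 3 := by
      rw [Real.sqrt_le_left (by positivity)]
      have : 0 ≤ E ^ 2 * r ^ 6 := by positivity
      nlinarith
    calc (N : ℝ) = Real.sqrt N * Real.sqrt N := hNs
      _ ≤ 12 * E * r ^ 3 * Real.sqrt N := by gcongr
      _ ≤ _ := by
        gcongr
        norm_num
  push Not at hsmall
  by_cases hbig : r ^ 10 ≤ N
  · refine (polya_vinogradov t ht hodd h1 M N).trans ?_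
    rw [hsqt]
    have h2 : r ^ 5 ≤ Real.sqrt N := by
      apply Real.le_sqrt_of_sq_le
      rw [← pow_mul]; exact hbig
    calc r ^ 8 * (1 + Real.log t) ≤ r ^ 8 * E := by gcongr
      _ = E * r ^ 3 * r ^ 5 := by ring
      _ ≤ (50 * E ^ 3) * r ^ 3 * Real.sqrt N := by
          gcongr
          linarith
  push Not at hbig
  -- parameters
  set B : ℕ := ⌊r ^ 4⌋₊ with hB
  have hB1 : 1 ≤ B := Nat.le_floor (by simpa using one_le_pow₀ hr1)
  have hBR1 : (1 : ℝ) ≤ B := by exact_mod_cast hB1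
  have hBle : (B : ℝ) ≤ r ^ 4 := Nat.floor_le (by positivity)
  have hBge : r ^ 4 ≤ 2 * B := by
    have := Nat.lt_floor_add_one (r ^ 4)
    rw [← hB] at this
    linarith
  set A : ℕ := N / (16 * B) with hA
  have hAB : A * B * 16 ≤ N := by
    have := Nat.div_mul_le_self N (16 * B)
    rw [← hA] at this
    linarith
  have hABR : (A : ℝ) * B * 16 ≤ N := by exact_mod_cast hAB
  have hAgt : (N : ℝ) < (A + 1) * (16 * B) := by
    have := Nat.lt_div_mul_add (a := N) (b := 16 * B) (by omega)
    rw [← hA] at this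
    have : N < (A + 1) * (16 * B) := by linarith
    exact_mod_cast this
  have hr46 : r ^ 4 ≤ r ^ 6 := pow_le_pow_right₀ hr1 (by norm_num)
  have hE2' : 1 ≤ E ^ 2 := one_le_pow₀ hE1
  have hA7 : 8 * E ^ 2 < (A : ℝ) + 1 := by
    have h2 : 128 * E ^ 2 * (B : ℝ) < (A + 1) * (16 * B) := by
      calc 128 * E ^ 2 * (B : ℝ) ≤ 128 * E ^ 2 * r ^ 6 := by gcongr; linarith
        _ < (N : ℝ) := hsmall
        _ < _ := hAgt
    have : (16 * (B : ℝ)) * (8 * E ^ 2) < (16 * B) * (A + 1) := by linarith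
    exact lt_of_mul_lt_mul_left this (by positivity)
  have hA1 : (1 : ℝ) ≤ A := by nlinarith
  have hAN32 : (N : ℝ) ≤ 32 * (A * B) := by nlinarith
  have hA4 : 4 * E ^ 2 ≤ A := by nlinarith
  have hAleN : (A : ℝ) ≤ N := by nlinarith
  have hAN : 2 * A * N ≤ t := by
    have : (2 : ℝ) * A * N ≤ t := by
      rw [← hr]
      have h2 : (A : ℝ) * r ^ 4 ≤ N := by nlinarith
      have h3 : (A : ℝ) * r ^ 4 * 8 ≤ N := by nlinarith
      have h4 : (A : ℝ) * r ^ 4 * 8 * N ≤ r ^ 10 * r ^ 10 := by gcongr; linarith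
      have h5 : (2 * A * N) * r ^ 4 ≤ r ^ 16 * r ^ 4 := by
        have : 0 ≤ (A : ℝ) * r ^ 4 * N := by positivity
        calc (2 * A * N) * r ^ 4 = 2 * ((A : ℝ) * r ^ 4 * N) := by ring
          _ ≤ (A : ℝ) * r ^ 4 * 8 * N := by linarith
          _ ≤ r ^ 10 * r ^ 10 := h4
          _ = _ := by ring
      exact le_of_mul_le_mul_right h5 (by positivity)
    exact_mod_cast this
  have hcore := burgess_core t ht hodd M A B N hAN
  set 𝒜 := (Finset.Icc 1 A).filter (fun a => Nat.Coprime a t) with h𝒜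
  set V := ∑ a ∈ 𝒜, ∑ k ∈ Finset.range N,
      |∑ b ∈ Finset.range B, ((jacobiSym (M + k + a * b) t : ℤ) : ℝ)| with hV
  have hV0 : 0 ≤ V := Finset.sum_nonneg fun _ _ => Finset.sum_nonneg fun _ _ => abs_nonneg _
  have hτ : (t.divisors.card : ℝ) ≤ E := by
    rw [card_divisors_sqf t ht]; push_cast; exact hE2
  have hV4 : V ^ 4 ≤ 70 * (A : ℝ) ^ 3 * N ^ 3 * E ^ 6 * r ^ 24 := by
    have hAt : (A : ℝ) ≤ t := by
      have : (A : ℝ) * 1 ≤ 2 * A * N := by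
        have : (1 : ℝ) ≤ N := by exact_mod_cast hNpos
        nlinarith
      have h2 : (2 : ℝ) * A * N ≤ t := by exact_mod_cast hAN
      linarith
    have hlogA : 1 + Real.log A ≤ E := by
      have := Real.log_le_log (by linarith) hAt
      linarith
    have hlogA0 : 0 ≤ 1 + Real.log A := by
      have := Real.log_nonneg hA1
      linarith
    have f1 : (A : ℝ) ^ 2 + N * (A * (1 + Real.log A) ^ 2) ≤ 2 * N * A * E ^ 2 := by
      have g1 : (A : ℝ) ^ 2 ≤ N * A * E ^ 2 := by
        calc (A : ℝ) ^ 2 = A * A * 1 := by ring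
          _ ≤ N * A * E ^ 2 := by gcongr
      have g2 : N * (A * (1 + Real.log A) ^ 2) ≤ N * (A * E ^ 2) := by gcongr
      linarith
    have f2 : 3 * (B : ℝ) ^ 2 * t + 41 ^ (t.primeFactors.card) * Real.sqrt t *
        (4 * (B * (2 * B * (t.divisors.card : ℝ)) ^ 3)) ≤ 35 * E ^ 4 * r ^ 24 := by
      rw [hsqt, ← hr]
      exact burg_f2 B r E _ _ hBR1 hr1 hE1 hBle hE41 hτ (pow_nonneg (by norm_num) _) (Nat.cast_nonneg _)
    calc V ^ 4 ≤ _ := hcore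
      _ ≤ ((A : ℝ) * N) ^ 2 * (2 * N * A * E ^ 2) * (35 * E ^ 4 * r ^ 24) := by
          refine mul_le_mul (mul_le_mul_of_nonneg_left f1 (sq_nonneg _)) f2 ?_ (by positivity)
          refine add_nonneg (by positivity) (mul_nonneg (mul_nonneg (pow_nonneg (by norm_num) _) (Real.sqrt_nonneg _)) ?_)
          have : (0 : ℝ) ≤ t.divisors.card := Nat.cast_nonneg _
          generalize (t.divisors.card : ℝ) = τ at this ⊢
          positivity
      _ = _ := by ring
  -- count
  have hcard : (A : ℝ) / (2 * E) ≤ 𝒜.card := by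
    obtain ⟨δ, d1, d2, d3⟩ := coprime_count t ht
    have h3 := d3 A
    rw [abs_le] at h3
    have h4 : E⁻¹ ≤ δ := by
      refine le_trans ?_ d1
      rw [inv_pow]
      exact inv_anti₀ (by positivity) hE2
    have h5 : (A : ℝ) * E⁻¹ ≤ A * δ := by gcongr
    have h6 : (2 : ℝ) ^ (t.primeFactors.card + 1) ≤ 2 * E := by
      rw [pow_succ]; linarith
    have h7 : 2 * E ≤ A / (2 * E) := by
      rw [le_div_iff₀ (by positivity)]; nlinarith
    have h8 : (A : ℝ) * E⁻¹ = 2 * (A / (2 * E)) := by field_simp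
    linarith [h3.1]
  have hcard0 : (0 : ℝ) < 𝒜.card := lt_of_lt_of_le (by positivity) hcard
  set D := 50 * E ^ 3 * r ^ 3 with hD
  have hD0 : 0 < D := by positivity
  -- main inequality
  have hmain : (𝒜.card : ℝ) * B * |SJ t M N| ≤ V + 𝒜.card * B * (D * Real.sqrt N / 2) := by
    have e1 : ∀ a ∈ 𝒜, ∀ b ∈ Finset.range B, |SJ t M N - SJ t (M + (a * b : ℕ)) N| ≤ D * Real.sqrt N / 2 := by
      intro a ha b hb
      rw [h𝒜, Finset.mem_filter, Finset.mem_Icc] at ha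
      rw [Finset.mem_range] at hb
      have hab : a * b ≤ A * B := Nat.mul_le_mul ha.1.2 hb.le
      have hlt : a * b < N := by omega
      rw [SJ_shift]
      have i1 := ih (a * b) hlt M
      have i2 := ih (a * b) hlt (M + N)
      have h5 : Real.sqrt ((a * b : ℕ) : ℝ) ≤ Real.sqrt N / 4 := by
        rw [Real.sqrt_le_left (by positivity), div_pow, Real.sq_sqrt hNR.le]
        have : ((a * b : ℕ) : ℝ) ≤ A * B := by exact_mod_cast hab
        linarith
      have h6 : D * Real.sqrt ((a * b : ℕ) : ℝ) ≤ D * (Real.sqrt N / 4) := by gcongr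
      calc _ ≤ |SJ t M (a * b)| + |SJ t (M + N) (a * b)| := abs_sub _ _
        _ ≤ _ := by linarith
    have e2 : |∑ a ∈ 𝒜, ∑ b ∈ Finset.range B, SJ t (M + (a * b : ℕ)) N| ≤ V := by
      rw [hV]
      refine (Finset.abs_sum_le_sum_abs _ _).trans (Finset.sum_le_sum fun a _ => ?_)
      unfold SJ
      rw [Finset.sum_comm]
      refine (Finset.abs_sum_le_sum_abs _ _).trans (Finset.sum_le_sum fun k _ => ?_)
      refine le_of_eq ?_
      congr 1
      refine Finset.sum_congr rfl fun b _ => ?_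
      congr 2
      push_cast; ring
    have e3 : (𝒜.card : ℝ) * B * SJ t M N = ∑ a ∈ 𝒜, ∑ b ∈ Finset.range B, SJ t (M + (a * b : ℕ)) N +
      ∑ a ∈ 𝒜, ∑ b ∈ Finset.range B, (SJ t M N - SJ t (M + (a * b : ℕ)) N) := by
      rw [← Finset.sum_add_distrib]
      have : ∀ a ∈ 𝒜, ∑ b ∈ Finset.range B, SJ t (M + (a * b : ℕ)) N +
        ∑ b ∈ Finset.range B, (SJ t M N - SJ t (M + (a * b : ℕ)) N) = B * SJ t M N := by
        intro a _
        rw [← Finset.sum_add_distrib]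
        simp
      rw [Finset.sum_congr rfl this]
      simp [mul_assoc]
    have e4 : |∑ a ∈ 𝒜, ∑ b ∈ Finset.range B, (SJ t M N - SJ t (M + (a * b : ℕ)) N)| ≤
      𝒜.card * B * (D * Real.sqrt N / 2) := by
      calc _ ≤ ∑ a ∈ 𝒜, ∑ b ∈ Finset.range B, (D * Real.sqrt N / 2) := by
            refine (Finset.abs_sum_le_sum_abs _ _).trans (Finset.sum_le_sum fun a ha => ?_)
            exact (Finset.abs_sum_le_sum_abs _ _).trans (Finset.sum_le_sum fun b hb => e1 a ha b hb)
        _ = _ := by simp; ring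
    calc (𝒜.card : ℝ) * B * |SJ t M N| = |(𝒜.card : ℝ) * B * SJ t M N| := by
          rw [abs_mul, abs_of_nonneg (mul_nonneg (Nat.cast_nonneg _) (Nat.cast_nonneg _) : (0 : ℝ) ≤ 𝒜.card * B)]
      _ ≤ _ := by
          rw [e3]
          exact (abs_add_le _ _).trans (add_le_add e2 e4)
  have hVfin : V ≤ 𝒜.card * B * (D * Real.sqrt N / 2) := by
    have h8 : V ≤ (A / (2 * E)) * B * (D * Real.sqrt N / 2) := by
      have hs4 : Real.sqrt N ^ 4 = (N : ℝ) ^ 2 := by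
        rw [show Real.sqrt N ^ 4 = (Real.sqrt N ^ 2) ^ 2 by ring, Real.sq_sqrt hNR.le]
      exact burg_fin A B N r E D V _ (by positivity) hBR1 hNR.le hr1 hE1 (Real.sqrt_nonneg _) hs4 hBge hAN32 hD hV4
    refine h8.trans ?_
    gcongr
  have hfin : (𝒜.card : ℝ) * B * |SJ t M N| ≤ 𝒜.card * B * (D * Real.sqrt N) := by
    calc _ ≤ _ := hmain
      _ ≤ _ := by linarith
  exact le_of_mul_le_mul_left hfin (mul_pos hcard0 (by linarith))

lemma log_bound (ε : ℝ) (hε : 0 < ε) : ∃ C : ℝ, 1 ≤ C ∧ ∀ x : ℝ, 1 ≤ x → 1 + Real.log x ≤ C * x ^ ε := by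
  refine ⟨1 + 1 / ε, by have : 0 < 1 / ε := by positivity
                        linarith, fun x hx => ?_⟩
  have h1 := Real.log_le_rpow_div (by linarith : 0 ≤ x) hε
  have h2 := Real.one_le_rpow hx hε.le
  have h3 : (1 + 1 / ε) * x ^ ε = x ^ ε + x ^ ε / ε := by ring
  rw [h3]; linarith

theorem burgess (ε : ℝ) (hε : 0 < ε) : ∃ C : ℝ, 1 ≤ C ∧ ∀ t : ℕ, Squarefree t → Odd t → 1 < t →
    ∀ (M : ℤ) (N : ℕ), |SJ t M N| ≤ C * (t : ℝ) ^ (3 / 16 + ε) * Real.sqrt N := by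
  obtain ⟨C1, hC1, hb1⟩ := omega_bound 41 (by norm_num) (ε / 3) (by positivity)
  obtain ⟨C2, hC2, hb2⟩ := log_bound (ε / 3) (by positivity)
  refine ⟨50 * (C1 * C2) ^ 3, ?_, ?_⟩
  · have : 1 ≤ (C1 * C2) ^ 3 := one_le_pow₀ (by nlinarith)
    linarith
  intro t ht hodd h1 M N
  have htR : (1 : ℝ) ≤ t := by exact_mod_cast h1.le
  have htp : (0 : ℝ) ≤ t := by linarith
  have hpow := Real.one_le_rpow htR (by positivity : 0 ≤ ε / 3)
  have g1 := hb1 t (by omega)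
  have hE : C1 * (t : ℝ) ^ (ε / 3) ≤ C1 * C2 * (t : ℝ) ^ (ε / 3) := by
    gcongr; nlinarith
  have hE' : C2 * (t : ℝ) ^ (ε / 3) ≤ C1 * C2 * (t : ℝ) ^ (ε / 3) := by
    gcongr; nlinarith
  have := burgess_ind t ht hodd h1 ((t : ℝ) ^ (1 / 16 : ℝ)) (C1 * C2 * (t : ℝ) ^ (ε / 3))
    (Real.one_le_rpow htR (by norm_num))
    (by rw [← Real.rpow_natCast, ← Real.rpow_mul htp]; norm_num)
    (by nlinarith [mul_le_mul hC1 hC2 (by norm_num) (by linarith)])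
    (g1.trans hE)
    (by
      refine le_trans ?_ (g1.trans hE)
      gcongr; norm_num)
    ((hb2 t htR).trans hE') N M
  refine this.trans (le_of_eq ?_)
  rw [mul_pow, ← Real.rpow_natCast ((t : ℝ) ^ (ε / 3)), ← Real.rpow_natCast ((t : ℝ) ^ (1 / 16 : ℝ)),
    ← Real.rpow_mul htp, ← Real.rpow_mul htp, add_comm (3 / 16 : ℝ), Real.rpow_add (by linarith)]
  have e1 : ε / 3 * ((3 : ℕ) : ℝ) = ε := by push_cast; ring
  have e2 : (1 / 16 : ℝ) * ((3 : ℕ) : ℝ) = 3 / 16 := by norm_num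
  rw [e1, e2]; ring

end Burg

section Gau

/-- quadratic Gauss sum -/
noncomputable def Gs (n : ℤ) (q : ℕ) : ℂ := ∑ b ∈ Finset.range q, eC (((n * (b : ℤ) ^ 2 : ℤ) : ℝ) / q)

lemma Gs_zmod (q : ℕ) [NeZero q] (n : ℤ) :
    Gs n q = ∑ b : ZMod q, ZMod.stdAddChar ((n : ZMod q) * b ^ 2) := by
  unfold Gs
  rw [← sum_range_eq_zmod q]
  refine Finset.sum_congr rfl fun x _ => ?_
  rw [eC_std]; push_cast; rfl

lemma card_mul_zero_le (q : ℕ) [NeZero q] (m : ℤ) :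
    (Finset.univ.filter (fun h : ZMod q => (m : ZMod q) * h = 0)).card ≤ Int.gcd m q := by
  have hpos : 0 < Int.gcd m q := Int.gcd_pos_of_ne_zero_right _ (by exact_mod_cast NeZero.ne q)
  refine le_trans (Finset.card_le_card ?_) (IsAddCyclic.card_nsmul_eq_zero_le (α := ZMod q) hpos)
  intro h hh
  simp only [Finset.mem_filter, Finset.mem_univ, true_and] at hh ⊢
  have e := Int.gcd_eq_gcd_ab m q
  have e2 : ((Int.gcd m q : ℤ) : ZMod q) = m * (Int.gcdA m q : ZMod q) := by
    rw [e]; push_cast; simp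
  rw [nsmul_eq_mul]
  have e3 : ((Int.gcd m q : ℕ) : ZMod q) = ((Int.gcd m q : ℤ) : ZMod q) := by push_cast; rfl
  rw [e3, e2]
  linear_combination (Int.gcdA m q : ZMod q) * hh

lemma Gs_norm_sq (n : ℤ) (q : ℕ) (hq : q ≠ 0) : ‖Gs n q‖ ^ 2 ≤ q * (Int.gcd (2 * n) q : ℝ) := by
  haveI : NeZero q := ⟨hq⟩
  have h1 : ((‖Gs n q‖ ^ 2 : ℝ) : ℂ) = ∑ h : ZMod q, ZMod.stdAddChar ((n : ZMod q) * h ^ 2) *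
      ∑ c : ZMod q, ZMod.stdAddChar (c * (((2 * n : ℤ) : ZMod q) * h)) := by
    rw [← Complex.normSq_eq_norm_sq, ← Complex.mul_conj, Gs_zmod, map_sum, Finset.sum_mul_sum, Finset.sum_comm]
    simp only [Finset.mul_sum]
    rw [Finset.sum_comm (s := (Finset.univ : Finset (ZMod q)))
      (f := fun h c => ZMod.stdAddChar ((n : ZMod q) * h ^ 2) * ZMod.stdAddChar (c * (((2 * n : ℤ) : ZMod q) * h)))]
    refine Finset.sum_congr rfl fun c _ => ?_
    rw [← Equiv.sum_comp (Equiv.addRight c)]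
    refine Finset.sum_congr rfl fun h _ => ?_
    rw [← AddChar.map_neg_eq_conj, ← AddChar.map_add_eq_mul, ← AddChar.map_add_eq_mul]
    congr 1
    simp only [Equiv.coe_addRight]
    push_cast; ring
  have h2 : ‖Gs n q‖ ^ 2 = ‖((‖Gs n q‖ ^ 2 : ℝ) : ℂ)‖ := by
    rw [Complex.norm_real, Real.norm_of_nonneg (by positivity)]
  rw [h2, h1]
  refine (norm_sum_le _ _).trans ?_
  have h3 : ∀ h : ZMod q, ‖ZMod.stdAddChar ((n : ZMod q) * h ^ 2) *
      ∑ c : ZMod q, ZMod.stdAddChar (c * (((2 * n : ℤ) : ZMod q) * h))‖ ≤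
      if ((2 * n : ℤ) : ZMod q) * h = 0 then (q : ℝ) else 0 := by
    intro h
    rw [AddChar.sum_mulShift _ (ZMod.isPrimitive_stdAddChar q), norm_mul]
    rw [AddChar.norm_apply, one_mul, ZMod.card]
    split_ifs <;> simp
  refine (Finset.sum_le_sum fun h _ => h3 h).trans ?_
  rw [← Finset.sum_filter, Finset.sum_const, nsmul_eq_mul, mul_comm]
  gcongr
  convert card_mul_zero_le q (2 * n)

lemma Gs_mul (n : ℤ) (q r : ℕ) (hq : 0 < q) (hr : 0 < r) (h : Nat.Coprime q r) :
    Gs n (q * r) = Gs (n * r) q * Gs (n * q) r := by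
  have hb := Nat.gcd_eq_gcd_ab q r
  rw [h.gcd_eq_one] at hb
  set u := Nat.gcdA q r
  set v := Nat.gcdB q r
  have key : ∀ (n : ℤ) (q r : ℕ) (hq : 0 < q) (hr : 0 < r) (u v : ℤ), ((1 : ℕ) : ℤ) = q * u + r * v →
      Gs (n * r) q = ∑ b ∈ Finset.range q, eC (((n * v * (b : ℤ) ^ 2 : ℤ) : ℝ) / q) := by
    intro n q r hq hr u v huv
    haveI : NeZero q := ⟨hq.ne'⟩
    have e1 : (r : ZMod q) * (v : ZMod q) = 1 := by
      have := congrArg (fun z : ℤ => (z : ZMod q)) huv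
      push_cast at this
      simp at this
      exact this.symm
    have e2 : ∑ b ∈ Finset.range q, eC (((n * v * (b : ℤ) ^ 2 : ℤ) : ℝ) / q) = Gs (n * v) q := rfl
    rw [e2, Gs_zmod, Gs_zmod]
    let U : (ZMod q)ˣ := ⟨v, r, by rw [mul_comm]; exact e1, e1⟩
    rw [← Equiv.sum_comp (Units.mulLeft U)]
    refine Finset.sum_congr rfl fun b _ => ?_
    congr 1
    simp only [Units.mulLeft_apply, U]
    push_cast
    linear_combination (n : ZMod q) * b ^ 2 * v * e1
  rw [key n q r hq hr u v hb, key n r q hr hq v u (by rw [hb]; ring), ← sum_range_mul_coprime q r hq hr h]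
  · unfold Gs
    refine Finset.sum_congr rfl fun x _ => ?_
    rw [← eC_add]
    congr 1
    have hb' : (1 : ℝ) = q * u + r * v := by exact_mod_cast hb
    have hq' : (q : ℝ) ≠ 0 := by positivity
    have hr' : (r : ℝ) ≠ 0 := by positivity
    push_cast
    field_simp
    linear_combination (n : ℝ) * x ^ 2 * hb'
  · intro x
    refine eC_congr _ _ q hq.ne' ?_
    push_cast
    exact Int.ModEq.mul_left _ (Int.ModEq.pow _ (Int.mod_modEq _ _))
  · intro x
    refine eC_congr _ _ r hr.ne' ?_
    push_cast
    exact Int.ModEq.mul_left _ (Int.ModEq.pow _ (Int.mod_modEq _ _))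

lemma Gs_prime (p : ℕ) [Fact p.Prime] (hp : p ≠ 2) (n : ℤ) (hn : ¬ (p : ℤ) ∣ n) : Gs n p = GJ n p := by
  have hpp : p.Prime := Fact.out
  have h0 : (n : ZMod p) ≠ 0 := by rwa [Ne, ZMod.intCast_zmod_eq_zero_iff_dvd]
  rw [Gs_zmod, GJ_prime_eq, gaussSum]
  have e1 : ∑ x : ZMod p, ZMod.stdAddChar ((n : ZMod p) * x) = 0 := by
    have := AddChar.sum_mulShift (n : ZMod p) (ZMod.isPrimitive_stdAddChar p)
    simp only [mul_comm _ (n : ZMod p)] at this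
    rw [this, if_neg h0]; simp
  have e2 : ∑ b : ZMod p, ZMod.stdAddChar ((n : ZMod p) * b ^ 2) =
      ∑ x : ZMod p, ((Finset.univ.filter (fun b : ZMod p => b ^ 2 = x)).card : ℂ) * ZMod.stdAddChar ((n : ZMod p) * x) := by
    rw [← Finset.sum_fiberwise (s := Finset.univ) (g := fun b : ZMod p => b ^ 2)]
    refine Finset.sum_congr rfl fun x _ => ?_
    rw [← nsmul_eq_mul, ← Finset.sum_const]
    refine Finset.sum_congr rfl fun b hb => ?_
    rw [Finset.mem_filter] at hb
    rw [hb.2]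
  rw [e2]
  have e3 : ∀ x : ZMod p, ((Finset.univ.filter (fun b : ZMod p => b ^ 2 = x)).card : ℂ) = chiC p x + 1 := by
    intro x
    have := quadraticChar_card_sqrts (F := ZMod p) (by rwa [ZMod.ringChar_zmod_n]) x
    have h2 : (Finset.univ.filter (fun b : ZMod p => b ^ 2 = x)) = {x_1 : ZMod p | x_1 ^ 2 = x}.toFinset := by
      ext; simp
    rw [h2]
    have h3 := congrArg (fun z : ℤ => (z : ℂ)) this
    push_cast at h3
    have h4 : chiC p x = ((quadraticChar (ZMod p) x : ℤ) : ℂ) := rfl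
    rw [h4, ← h3]
  simp only [e3, add_mul, one_mul, Finset.sum_add_distrib, e1, add_zero]
  rfl

lemma sum_range_mul_eq {R : Type*} [AddCommMonoid R] (m n : ℕ) (f : ℕ → R) :
    ∑ x ∈ Finset.range (m * n), f x = ∑ i ∈ Finset.range n, ∑ j ∈ Finset.range m, f (j + m * i) := by
  induction n with
  | zero => simp
  | succ k ih =>
    rw [Nat.mul_succ, Finset.sum_range_add, ih, Finset.sum_range_succ]
    congr 1
    refine Finset.sum_congr rfl fun j _ => ?_
    rw [add_comm]

lemma Gs_prime_pow (p : ℕ) (hpp : p.Prime) (hp : p ≠ 2) (n : ℤ) (hn : ¬ (p : ℤ) ∣ n) (k : ℕ) :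
    Gs n (p ^ (k + 2)) = p * Gs n (p ^ k) := by
  have hp0 : (p : ℝ) ≠ 0 := by exact_mod_cast hpp.ne_zero
  have e1 : Gs n (p ^ (k + 2)) = ∑ j ∈ Finset.range (p ^ (k + 1)), eC (((n * (j : ℤ) ^ 2 : ℤ) : ℝ) / (p ^ (k + 2) : ℕ)) *
      (if (p : ℤ) ∣ 2 * n * j then (p : ℂ) else 0) := by
    unfold Gs
    rw [show p ^ (k + 2) = p ^ (k + 1) * p by ring, sum_range_mul_eq, Finset.sum_comm]
    refine Finset.sum_congr rfl fun j _ => ?_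
    rw [← orth p hpp.ne_zero, Finset.mul_sum]
    refine Finset.sum_congr rfl fun i _ => ?_
    rw [← eC_add]
    have : (((n * (j : ℤ) ^ 2 : ℤ) : ℝ) / (p ^ (k + 1) * p : ℕ)) + ((((i : ℤ) * (2 * n * j) : ℤ) : ℝ) / p) =
      ((n * (j : ℤ) ^ 2 + i * (2 * n * j) * p ^ (k + 1) : ℤ) : ℝ) / (p ^ (k + 1) * p : ℕ) := by
      push_cast; field_simp
    rw [this]
    refine eC_congr _ _ _ (by have := hpp.ne_zero; positivity) ?_
    rw [Int.modEq_comm, Int.modEq_iff_dvd]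
    refine ⟨n * i ^ 2 * p ^ k, ?_⟩
    push_cast
    ring
  rw [e1, pow_succ p k, mul_comm (p ^ k) p, sum_range_mul_eq]
  unfold Gs
  rw [Finset.mul_sum]
  refine Finset.sum_congr rfl fun i _ => ?_
  rw [Finset.sum_eq_single 0]
  · have : (p : ℤ) ∣ 2 * n * ((0 + p * i : ℕ) : ℤ) := by push_cast; exact ⟨2 * n * i, by ring⟩
    rw [if_pos this, mul_comm]
    congr 2
    push_cast
    field_simp
    ring
  · intro j hj hj0
    rw [if_neg, mul_zero]
    intro h
    have hpi : Prime (p : ℤ) := Nat.prime_iff_prime_int.mp hpp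
    rcases hpi.dvd_or_dvd h with h | h
    · rcases hpi.dvd_or_dvd h with h | h
      · have := Nat.le_of_dvd (by norm_num) (by exact_mod_cast h : p ∣ 2)
        have := hpp.two_le
        omega
      · exact hn h
    · have h' : p ∣ j + p * i := by exact_mod_cast h
      have h'' : p ∣ j := (Nat.dvd_add_left (dvd_mul_right _ _)).mp h'
      have := Nat.le_of_dvd (by omega) h''
      rw [Finset.mem_range] at hj
      omega
  · intro h; exact absurd (Finset.mem_range.mpr hpp.pos) h

lemma Gs_one (n : ℤ) : Gs n 1 = 1 := by simp [Gs, eC_zero]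

lemma not_dvd_of_coprime (p : ℕ) (hp : p.Prime) (n : ℤ) (h : IsCoprime n (p : ℤ)) : ¬ (p : ℤ) ∣ n := by
  intro hd
  have := h.symm.isUnit_of_dvd' dvd_rfl hd
  rw [Int.isUnit_iff] at this
  have := hp.two_le
  omega

lemma Gs_prime_pow_main (p : ℕ) (hpp : p.Prime) (hp : p ≠ 2) (k : ℕ) :
    (∀ n : ℤ, IsCoprime n (p : ℤ) → Gs n (p ^ k) = ((jacobiSym n (p ^ k) : ℤ) : ℂ) * Gs 1 (p ^ k)) ∧
      Gs 1 (p ^ k) ^ 4 = ((p ^ k : ℕ) : ℂ) ^ 2 := by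
  haveI : Fact p.Prime := ⟨hpp⟩
  have h1 : ¬ (p : ℤ) ∣ 1 := not_dvd_of_coprime p hpp 1 isCoprime_one_left
  induction k using Nat.twoStepInduction with
  | zero => simp [Gs_one]
  | one =>
    rw [pow_one]
    constructor
    · intro n hn
      have hn' := not_dvd_of_coprime p hpp n hn
      rw [Gs_prime p hp n hn', Gs_prime p hp 1 h1, GJ_prime_shift p n hn']
    · rw [Gs_prime p hp 1 h1, show (4 : ℕ) = 2 * 2 by rfl, pow_mul, GJ_sq_prime p hp, mul_pow, ← map_pow]
      simp
  | more k ih _ =>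
    constructor
    · intro n hn
      rw [Gs_prime_pow p hpp hp n (not_dvd_of_coprime p hpp n hn), Gs_prime_pow p hpp hp 1 h1, ih.1 n hn]
      have : jacobiSym n (p ^ (k + 2)) = jacobiSym n (p ^ k) := by
        rw [jacobiSym.pow_right, jacobiSym.pow_right, pow_add, jacobiSym.sq_one (by exact Int.isCoprime_iff_gcd_eq_one.mp hn), mul_one]
      rw [this]; ring
    · rw [Gs_prime_pow p hpp hp 1 h1, mul_pow, ih.2]
      push_cast; ring

lemma Gs_main (q : ℕ) (hq0 : q ≠ 0) (hodd : Odd q) :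
    (∀ n : ℤ, IsCoprime n (q : ℤ) → Gs n q = ((jacobiSym n q : ℤ) : ℂ) * Gs 1 q) ∧
      Gs 1 q ^ 4 = (q : ℂ) ^ 2 := by
  revert hq0 hodd
  induction q using Nat.recOnPosPrimePosCoprime with
  | prime_pow p k hp hk =>
    intro _ hodd
    have hp2 : p ≠ 2 := by
      rintro rfl
      exact absurd hodd (by simp [Nat.even_pow, hk.ne'])
    have := Gs_prime_pow_main p hp hp2 k
    refine ⟨fun n hn => this.1 n ?_, this.2⟩
    push_cast at hn
    exact (IsCoprime.pow_right_iff hk).mp hn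
  | zero => intro h; exact absurd rfl h
  | one => intro _ _; simp [Gs_one]
  | coprime a b ha hb hab iha ihb =>
    intro _ hodd
    rw [Nat.odd_mul] at hodd
    obtain ⟨a1, a2⟩ := iha (by omega) hodd.1
    obtain ⟨b1, b2⟩ := ihb (by omega) hodd.2
    have cab : IsCoprime (a : ℤ) (b : ℤ) := Nat.isCoprime_iff_coprime.mpr hab
    have j1 : ((jacobiSym b a : ℤ) : ℂ) ^ 2 = 1 := by
      exact_mod_cast jacobiSym.sq_one (Int.isCoprime_iff_gcd_eq_one.mp cab.symm)
    have j2 : ((jacobiSym a b : ℤ) : ℂ) ^ 2 = 1 := by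
      exact_mod_cast jacobiSym.sq_one (Int.isCoprime_iff_gcd_eq_one.mp cab)
    have e1 : Gs 1 (a * b) = ((jacobiSym b a : ℤ) : ℂ) * Gs 1 a * (((jacobiSym a b : ℤ) : ℂ) * Gs 1 b) := by
      rw [Gs_mul 1 a b (by omega) (by omega) hab, one_mul, one_mul, a1 b cab.symm, b1 a cab]
    constructor
    · intro n hn
      push_cast at hn
      rw [IsCoprime.mul_right_iff] at hn
      rw [e1, Gs_mul n a b (by omega) (by omega) hab, a1 _ (hn.1.mul_left cab.symm), b1 _ (hn.2.mul_left cab)]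
      haveI : NeZero a := ⟨by omega⟩
      haveI : NeZero b := ⟨by omega⟩
      rw [jacobiSym.mul_left, jacobiSym.mul_left, jacobiSym.mul_right]
      push_cast; ring
    · rw [e1]
      calc _ = (((jacobiSym b a : ℤ) : ℂ) ^ 2) ^ 2 * (((jacobiSym a b : ℤ) : ℂ) ^ 2) ^ 2 * Gs 1 a ^ 4 * Gs 1 b ^ 4 := by ring
        _ = _ := by rw [j1, j2, a2, b2]; push_cast; ring

end Gau

section Sq

/-- normalized coefficient of the singular series -/
noncomputable def cq (a : Fin 4 → ℤ) (q : ℕ) : ℂ := (1 / (q : ℂ) ^ 4) * Sqa a 0 q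

/-- product of Gauss sums -/
noncomputable def PG (a : Fin 4 → ℤ) (q : ℕ) (k : ℤ) : ℂ := ∏ i, Gs (k * a i) q

lemma Sqa_eq (a : Fin 4 → ℤ) (q : ℕ) :
    Sqa a 0 q = ∑ k ∈ Finset.range q, (if Nat.gcd k q = 1 then PG a q k else 0) := by
  unfold Sqa
  rw [Finset.sum_filter]
  refine Finset.sum_congr rfl fun k _ => ?_
  by_cases hk : Nat.gcd k q = 1
  · rw [if_pos hk, if_pos hk]
    unfold PG Gs
    rw [Finset.prod_univ_sum]
    refine Finset.sum_congr rfl fun b _ => ?_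
    simp only [Fin.sum_univ_four, Fin.prod_univ_four, ← eC_add]
    congr 1
    simp only [Pi.zero_apply]
    push_cast
    ring
  · rw [if_neg hk, if_neg hk]

lemma Gs_congr (m n : ℤ) (q : ℕ) (h : m ≡ n [ZMOD q]) : Gs m q = Gs n q := by
  unfold Gs
  refine Finset.sum_congr rfl fun x hx => ?_
  rw [Finset.mem_range] at hx
  exact eC_congr _ _ _ (by omega) (Int.ModEq.mul_right _ h)

lemma PG_congr (a : Fin 4 → ℤ) (m n : ℤ) (q : ℕ) (h : m ≡ n [ZMOD q]) : PG a q m = PG a q n := by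
  unfold PG
  exact Finset.prod_congr rfl fun i _ => Gs_congr _ _ _ (Int.ModEq.mul_right _ h)

lemma sum_units_shift (a : Fin 4 → ℤ) (q r : ℕ) (hq : 0 < q) (h : Nat.Coprime q r) :
    ∑ k ∈ Finset.range q, (if Nat.gcd k q = 1 then PG a q ((k : ℤ) * r) else 0) = Sqa a 0 q := by
  rw [Sqa_eq]
  haveI : NeZero q := ⟨hq.ne'⟩
  let f : ZMod q → ℂ := fun z => if Nat.gcd z.val q = 1 then PG a q (z.val : ℤ) else 0
  have e0 : ∀ k : ℕ, (if Nat.gcd k q = 1 then PG a q k else 0) = f (k : ZMod q) := by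
    intro k
    simp only [f, ZMod.val_natCast]
    have h1 : Nat.gcd (k % q) q = Nat.gcd k q := by
      rw [← Nat.gcd_rec, Nat.gcd_comm]
    simp only [h1]
    rw [PG_congr a ((k % q : ℕ) : ℤ) k q (by push_cast; exact Int.mod_modEq _ _)]
  have e1 : ∀ k : ℕ, (if Nat.gcd k q = 1 then PG a q ((k : ℤ) * r) else 0) = f ((k : ZMod q) * r) := by
    intro k
    have := e0 (k * r)
    push_cast at this
    rw [← this]
    have h1 : Nat.gcd (k * r) q = 1 ↔ Nat.gcd k q = 1 := by
      constructor
      · intro h; exact Nat.Coprime.coprime_mul_right h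
      · intro h'; exact Nat.Coprime.mul_left h' h.symm
    simp only [h1]
  rw [Finset.sum_congr rfl fun k _ => e0 k, Finset.sum_congr rfl fun k _ => e1 k, sum_range_eq_zmod q f,
    sum_range_eq_zmod q (fun z => f (z * r))]
  exact Equiv.sum_comp (Units.mulRight (ZMod.unitOfCoprime r h.symm)) f

lemma cq_mul (a : Fin 4 → ℤ) (q r : ℕ) (hq : 0 < q) (hr : 0 < r) (h : Nat.Coprime q r) :
    cq a (q * r) = cq a q * cq a r := by
  have : Sqa a 0 (q * r) = Sqa a 0 q * Sqa a 0 r := by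
    rw [Sqa_eq, ← sum_units_shift a q r hq h, ← sum_units_shift a r q hr h.symm,
      ← sum_range_mul_coprime q r hq hr h]
    · refine Finset.sum_congr rfl fun k _ => ?_
      by_cases h1 : Nat.gcd k q = 1
      · by_cases h2 : Nat.gcd k r = 1
        · rw [if_pos (Nat.Coprime.mul_right h1 h2), if_pos h1, if_pos h2]
          unfold PG
          rw [← Finset.prod_mul_distrib]
          refine Finset.prod_congr rfl fun i _ => ?_
          rw [Gs_mul _ q r hq hr h]
          congr 2 <;> ring
        · rw [if_neg h2, mul_zero, if_neg]
          intro h3; exact h2 (Nat.Coprime.coprime_mul_left_right h3)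
      · rw [if_neg h1, zero_mul, if_neg]
        intro h3; exact h1 (Nat.Coprime.coprime_mul_right_right h3)
    · intro x
      have h1 : Nat.gcd (x % q) q = Nat.gcd x q := by rw [← Nat.gcd_rec, Nat.gcd_comm]
      simp only [h1]
      rw [PG_congr a (((x % q : ℕ) : ℤ) * r) (x * r) q (by push_cast; exact Int.ModEq.mul_right _ (Int.mod_modEq _ _))]
    · intro x
      have h1 : Nat.gcd (x % r) r = Nat.gcd x r := by rw [← Nat.gcd_rec, Nat.gcd_comm]
      simp only [h1]
      rw [PG_congr a (((x % r : ℕ) : ℤ) * q) (x * q) r (by push_cast; exact Int.ModEq.mul_right _ (Int.mod_modEq _ _))]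
  unfold cq
  rw [this]
  push_cast
  have : (q : ℂ) ≠ 0 := by exact_mod_cast hq.ne'
  have : (r : ℂ) ≠ 0 := by exact_mod_cast hr.ne'
  field_simp

lemma Gs_norm_le (n : ℤ) (q : ℕ) (hq : q ≠ 0) : ‖Gs n q‖ ≤ Real.sqrt (2 * q * (Int.gcd n q : ℝ)) := by
  apply Real.le_sqrt_of_sq_le
  refine (Gs_norm_sq n q hq).trans ?_
  have : Int.gcd (2 * n) q ≤ 2 * Int.gcd n q := by
    have h1 : Int.gcd (2 * n) q ∣ Int.gcd 2 q * Int.gcd n q := by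
      simp only [Int.gcd, Int.natAbs_mul]
      exact Nat.gcd_mul_left_dvd_mul_gcd _ _ _
    have h2 : Int.gcd 2 (q : ℤ) ≤ 2 := Nat.le_of_dvd (by norm_num) (Nat.gcd_dvd_left 2 q)
    have hp : 0 < Int.gcd 2 (q : ℤ) := Int.gcd_pos_of_ne_zero_left _ (by norm_num)
    have hp2 : 0 < Int.gcd n (q : ℤ) := Int.gcd_pos_of_ne_zero_right _ (by exact_mod_cast hq)
    exact (Nat.le_of_dvd (by positivity) h1).trans (by gcongr)
  have h2 : (Int.gcd (2 * n) q : ℝ) ≤ 2 * Int.gcd n q := by exact_mod_cast this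
  calc (q : ℝ) * (Int.gcd (2 * n) q : ℝ) ≤ q * (2 * Int.gcd n q) := by gcongr
    _ = _ := by ring

lemma cq_norm_le (a : Fin 4 → ℤ) (q : ℕ) (hq : q ≠ 0) :
    ‖cq a q‖ ≤ 4 * (q : ℝ)⁻¹ * Real.sqrt ((∏ i, Int.gcd (a i) q : ℕ) : ℝ) := by
  have hqp : (0 : ℝ) < q := by positivity
  have h1 : ‖Sqa a 0 q‖ ≤ q * ((4 * q ^ 2) * Real.sqrt ((∏ i, Int.gcd (a i) q : ℕ) : ℝ)) := by
    rw [Sqa_eq]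
    refine (norm_sum_le _ _).trans ?_
    have : ∀ k ∈ Finset.range q, ‖(if Nat.gcd k q = 1 then PG a q k else 0)‖ ≤
        (4 * q ^ 2) * Real.sqrt ((∏ i, Int.gcd (a i) q : ℕ) : ℝ) := by
      intro k _
      by_cases hk : Nat.gcd k q = 1
      · rw [if_pos hk]
        unfold PG
        rw [norm_prod]
        have e1 : ∀ i, ‖Gs (k * a i) q‖ ≤ Real.sqrt (2 * q) * Real.sqrt (Int.gcd (a i) q : ℝ) := by
          intro i
          refine (Gs_norm_le _ q hq).trans (le_of_eq ?_)
          rw [← Real.sqrt_mul (by positivity)]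
          congr 3
          simp only [Int.gcd, Int.natAbs_mul, Int.natAbs_natCast]
          exact Nat.Coprime.gcd_mul_left_cancel _ hk
        refine (Finset.prod_le_prod (fun _ _ => norm_nonneg _) fun i _ => e1 i).trans (le_of_eq ?_)
        rw [Finset.prod_mul_distrib, Finset.prod_const, Finset.card_univ, Fintype.card_fin,
          show Real.sqrt (2 * q) ^ 4 = (Real.sqrt (2 * q) ^ 2) ^ 2 by ring, Real.sq_sqrt (by positivity)]
        push_cast
        simp only [Fin.prod_univ_four]
        rw [Real.sqrt_mul (by positivity), Real.sqrt_mul (by positivity), Real.sqrt_mul (by positivity)]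
        ring
      · rw [if_neg hk, norm_zero]; positivity
    refine (Finset.sum_le_sum this).trans ?_
    simp
  unfold cq
  rw [norm_mul]
  have e2 : ‖(1 / (q : ℂ) ^ 4)‖ = 1 / (q : ℝ) ^ 4 := by simp
  rw [e2]
  calc 1 / (q : ℝ) ^ 4 * ‖Sqa a 0 q‖ ≤ 1 / (q : ℝ) ^ 4 * (q * ((4 * q ^ 2) * Real.sqrt ((∏ i, Int.gcd (a i) q : ℕ) : ℝ))) := by gcongr
    _ = _ := by field_simp

lemma cq_coprime (a : Fin 4 → ℤ) (q : ℕ) (hq : q ≠ 0) (hodd : Odd q) (h : IsCoprime (∏ i, a i) (q : ℤ)) :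
    cq a q = ((jacobiSym (∏ i, a i) q : ℤ) : ℂ) * (Nat.totient q : ℂ) / (q : ℂ) ^ 2 := by
  have hqc : (q : ℂ) ≠ 0 := by exact_mod_cast hq
  obtain ⟨g1, g2⟩ := Gs_main q hq hodd
  have hi : ∀ i, IsCoprime (a i) (q : ℤ) := fun i => IsCoprime.of_isCoprime_of_dvd_left h (Finset.dvd_prod_of_mem _ (Finset.mem_univ i))
  have h1 : Sqa a 0 q = (Nat.totient q : ℂ) * (((jacobiSym (∏ i, a i) q : ℤ) : ℂ) * q ^ 2) := by
    rw [Sqa_eq, ← Finset.sum_filter]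
    have : ∀ k ∈ (Finset.range q).filter (fun k => Nat.gcd k q = 1), PG a q k = ((jacobiSym (∏ i, a i) q : ℤ) : ℂ) * q ^ 2 := by
      intro k hk
      rw [Finset.mem_filter] at hk
      have hk' : IsCoprime (k : ℤ) (q : ℤ) := Nat.isCoprime_iff_coprime.mpr hk.2
      unfold PG
      rw [Finset.prod_congr rfl fun i _ => g1 _ (hk'.mul_left (hi i))]
      have j1 : ((jacobiSym k q : ℤ) : ℂ) ^ 2 = 1 := by
        exact_mod_cast jacobiSym.sq_one (Int.isCoprime_iff_gcd_eq_one.mp hk')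
      rw [← g2]
      simp only [Fin.prod_univ_four, jacobiSym.mul_left]
      push_cast
      calc _ = (((jacobiSym k q : ℤ) : ℂ) ^ 2) ^ 2 * (((jacobiSym (a 0) q : ℤ) : ℂ) * (jacobiSym (a 1) q : ℤ) * (jacobiSym (a 2) q : ℤ) * (jacobiSym (a 3) q : ℤ)) * Gs 1 q ^ 4 := by ring
        _ = _ := by rw [j1]; ring
    rw [Finset.sum_congr rfl this, Finset.sum_const, nsmul_eq_mul]
    congr 2
    rw [Nat.totient]
    congr 1
    ext k
    simp [Nat.coprime_comm, Nat.Coprime]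
  unfold cq
  rw [h1]
  field_simp

end Sq

section CS

/-- the character e ↦ (A/e) on odd e -/
noncomputable def chi (A : ℤ) (e : ℕ) : ℝ := if Odd e then ((jacobiSym A e : ℤ) : ℝ) else 0

lemma chi_le (A : ℤ) (e : ℕ) : |chi A e| ≤ 1 := by
  unfold chi
  split_ifs
  · exact jac_le_one _ _
  · simp

lemma chi_mul (A : ℤ) (e f : ℕ) : chi A (e * f) = chi A e * chi A f := by
  unfold chi
  by_cases he : Odd e
  · by_cases hf : Odd f
    · haveI : NeZero e := ⟨he.pos.ne'⟩
      haveI : NeZero f := ⟨hf.pos.ne'⟩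
      rw [if_pos he, if_pos hf, if_pos (he.mul hf), jacobiSym.mul_right]
      push_cast; rfl
    · rw [if_neg hf, mul_zero, if_neg (fun h => hf (Nat.odd_mul.mp h).2)]
  · rw [if_neg he, zero_mul, if_neg (fun h => he (Nat.odd_mul.mp h).1)]

lemma chi_zero (A : ℤ) : chi A 0 = 0 := by simp [chi]
lemma chi_one (A : ℤ) : chi A 1 = 1 := by simp [chi]

lemma sieve_mult (g : ℕ → ℝ) (hm : ∀ e f, g (e * f) = g e * g f) (hg : ∀ e, |g e| ≤ 1) (K : ℝ) (hK : 0 ≤ K)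
    (h0 : ∀ N : ℕ, |∑ e ∈ Finset.range (N + 1), g e| ≤ K * Real.sqrt N) (s : ℕ) (hs : s ≠ 0) :
    ∀ N : ℕ, |∑ e ∈ Finset.range (N + 1), (if Nat.Coprime e s then g e else 0)| ≤
      2 ^ (s.primeFactors.card) * K * Real.sqrt N := by
  revert hs
  induction s using induction_on_primes with
  | zero => intro h; exact absurd rfl h
  | one => intro _ N; simpa using h0 N
  | prime_mul p a hp ih =>
    intro hs N
    have ha : a ≠ 0 := right_ne_zero_of_mul hs
    by_cases hpa : p ∣ a
    · have e1 : (p * a).primeFactors = a.primeFactors := by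
        rw [Nat.primeFactors_mul hp.ne_zero ha, hp.primeFactors]
        simp [hp, hpa, ha]
      rw [e1]
      have := ih ha N
      have e2 : ∀ e : ℕ, Nat.Coprime e (p * a) ↔ Nat.Coprime e a := by
        intro e
        rw [Nat.coprime_mul_iff_right]
        exact ⟨fun h => h.2, fun h => ⟨Nat.Coprime.coprime_dvd_right hpa h, h⟩⟩
      simpa only [e2] using this
    · have hcop : Nat.Coprime p a := (Nat.Prime.coprime_iff_not_dvd hp).mpr hpa
      have e1 : (p * a).primeFactors.card = a.primeFactors.card + 1 := by
        rw [hcop.primeFactors_mul, Finset.card_union_of_disjoint hcop.disjoint_primeFactors, hp.primeFactors]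
        simp [add_comm]
      rw [e1]
      have e2 : ∑ e ∈ Finset.range (N + 1), (if Nat.Coprime e (p * a) then g e else 0) =
          ∑ e ∈ Finset.range (N + 1), (if Nat.Coprime e a then g e else 0) -
          g p * ∑ e ∈ Finset.range (N / p + 1), (if Nat.Coprime e a then g e else 0) := by
        have e3 : g p * ∑ e ∈ Finset.range (N / p + 1), (if Nat.Coprime e a then g e else 0) =
            ∑ e ∈ (Finset.range (N + 1)).filter (fun e => p ∣ e), (if Nat.Coprime e a then g e else 0) := by
          rw [Finset.mul_sum]
          refine Finset.sum_bij (fun e _ => p * e) ?_ ?_ ?_ ?_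
          · intro e he
            rw [Finset.mem_range] at he
            rw [Finset.mem_filter, Finset.mem_range]
            refine ⟨?_, dvd_mul_right _ _⟩
            have : p * e ≤ N := by
              calc p * e ≤ p * (N / p) := Nat.mul_le_mul_left _ (by omega)
                _ ≤ N := Nat.mul_div_le _ _
            omega
          · intro x _ y _ hxy
            exact Nat.eq_of_mul_eq_mul_left hp.pos hxy
          · intro b hb
            rw [Finset.mem_filter, Finset.mem_range] at hb
            obtain ⟨hb1, c, rfl⟩ := hb
            refine ⟨c, ?_, rfl⟩
            rw [Finset.mem_range]
            have : c ≤ N / p := (Nat.le_div_iff_mul_le hp.pos).mpr (by rw [mul_comm]; omega)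
            omega
          · intro e _
            have : Nat.Coprime (p * e) a ↔ Nat.Coprime e a := by
              rw [Nat.coprime_mul_iff_left]; exact ⟨fun h => h.2, fun h => ⟨hcop, h⟩⟩
            simp only [this, hm]
            split_ifs <;> simp
        rw [e3, Finset.sum_filter, ← Finset.sum_sub_distrib]
        refine Finset.sum_congr rfl fun e _ => ?_
        by_cases hpe : p ∣ e
        · rw [if_neg, if_pos hpe, sub_self]
          intro h
          have := (Nat.coprime_mul_iff_right.mp h).1
          exact (Nat.Prime.coprime_iff_not_dvd hp).mp this.symm hpe
        · have : Nat.Coprime e (p * a) ↔ Nat.Coprime e a := by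
            rw [Nat.coprime_mul_iff_right]
            exact ⟨fun h => h.2, fun h => ⟨((Nat.Prime.coprime_iff_not_dvd hp).mpr hpe).symm, h⟩⟩
          simp only [this, if_neg hpe, sub_zero]
      rw [e2]
      have i1 := ih ha N
      have i2 := ih ha (N / p)
      have i3 : Real.sqrt ((N / p : ℕ) : ℝ) ≤ Real.sqrt N := Real.sqrt_le_sqrt (by exact_mod_cast Nat.div_le_self N p)
      set Z := ∑ e ∈ Finset.range (N / p + 1), (if Nat.Coprime e a then g e else 0)
      have hk : 0 ≤ 2 ^ (a.primeFactors.card) * K := mul_nonneg (pow_nonneg (by norm_num) _) hK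
      have i4 : |g p * Z| ≤ 2 ^ (a.primeFactors.card) * K * Real.sqrt N := by
        rw [abs_mul]
        calc |g p| * |Z| ≤ 1 * |Z| := mul_le_mul_of_nonneg_right (hg p) (abs_nonneg _)
          _ ≤ _ := by
            rw [one_mul]
            exact i2.trans (mul_le_mul_of_nonneg_left i3 hk)
      refine (abs_sub _ _).trans ((add_le_add i1 i4).trans (le_of_eq ?_))
      rw [pow_succ]; ring

lemma range8 (g : ℕ → ℝ) (hg : ∀ e, |g e| ≤ 1) (K : ℝ) (hK : 0 ≤ K) (g0 : g 0 = 0)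
    (h : ∀ n : ℕ, |∑ e ∈ Finset.range (8 * n), g e| ≤ K * Real.sqrt n) (N : ℕ) :
    |∑ e ∈ Finset.range (N + 1), g e| ≤ (K + 8) * Real.sqrt N := by
  rcases Nat.eq_zero_or_pos N with rfl | hN
  · simp [g0]
  have hs : 1 ≤ Real.sqrt N := by rw [Real.one_le_sqrt]; exact_mod_cast hN
  set n := (N + 1) / 8
  set m := (N + 1) % 8
  have e1 : N + 1 = 8 * n + m := (Nat.div_add_mod _ _).symm
  rw [e1, Finset.sum_range_add]
  have h1 := h n
  have h2 : Real.sqrt n ≤ Real.sqrt N := Real.sqrt_le_sqrt (by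
    have : n ≤ N := by omega
    exact_mod_cast this)
  have h3 : |∑ k ∈ Finset.range m, g (8 * n + k)| ≤ 8 := by
    refine (Finset.abs_sum_le_sum_abs _ _).trans ((Finset.sum_le_sum fun k _ => hg _).trans ?_)
    have : m < 8 := Nat.mod_lt _ (by norm_num)
    simp
    exact_mod_cast this.le
  refine (abs_add_le _ _).trans ?_
  have h4 : K * Real.sqrt n ≤ K * Real.sqrt N := by gcongr
  linarith

lemma chi_eq_psi (σ : ℤ) (hσ : σ = 1 ∨ σ = -1) (k t : ℕ) (ht : Odd t) :
    ∃ ψ : ℕ → ℝ, (∀ e, |ψ e| ≤ 1) ∧ (∀ ρ j, ψ (ρ + 8 * j) = ψ ρ) ∧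
      (∀ e, chi (σ * 2 ^ k * t) e = ψ e * ((jacobiSym e t : ℤ) : ℝ)) := by
  have hpm : ∀ n : ℕ, |((-1 : ℝ) ^ n)| = 1 := fun n => by simp
  refine ⟨fun e => if Odd e then ((jacobiSym σ e : ℤ) : ℝ) * ((jacobiSym 2 e : ℤ) : ℝ) ^ k * (-1) ^ (t / 2 * (e / 2)) else 0, ?_, ?_, ?_⟩
  · intro e
    dsimp only
    split_ifs
    · rw [abs_mul, abs_mul, hpm, abs_pow, mul_one]
      exact mul_le_one₀ (jac_le_one _ _) (by positivity) (pow_le_one₀ (abs_nonneg _) (jac_le_one _ _))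
    · simp
  · intro ρ j
    have ho : Odd (ρ + 8 * j) ↔ Odd ρ := by
      simp only [Nat.odd_iff]; omega
    dsimp only
    by_cases h : Odd ρ
    · have h' := ho.mpr h
      rw [if_pos h, if_pos h', jacobiSym.at_two h, jacobiSym.at_two h']
      have c8 : ((ρ + 8 * j : ℕ) : ZMod 8) = ρ := by
        push_cast
        rw [show (8 : ZMod 8) = 0 by rfl]; simp
      have c4 : ((ρ + 8 * j : ℕ) : ZMod 4) = ρ := by
        push_cast
        rw [show (8 : ZMod 4) = 0 by rfl]; simp
      have e1 : jacobiSym σ (ρ + 8 * j) = jacobiSym σ ρ := by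
        rcases hσ with rfl | rfl
        · simp
        · rw [jacobiSym.at_neg_one h, jacobiSym.at_neg_one h', c4]
      have e2 : ((-1 : ℝ)) ^ (t / 2 * ((ρ + 8 * j) / 2)) = (-1) ^ (t / 2 * (ρ / 2)) := by
        rw [show (ρ + 8 * j) / 2 = ρ / 2 + 2 * (2 * j) by omega, mul_add, pow_add, mul_left_comm, pow_mul, pow_mul (-1 : ℝ) 2]
        simp
      rw [e1, c8, e2]
    · rw [if_neg h, if_neg (fun h' => h (ho.mp h'))]
  · intro e
    unfold chi
    dsimp only
    split_ifs with h
    · rw [jacobiSym.mul_left, jacobiSym.mul_left, jacobiSym.pow_left, jacobiSym.quadratic_reciprocity ht h]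
      push_cast; ring
    · simp

lemma chi_sum_large (σ : ℤ) (hσ : σ = 1 ∨ σ = -1) (k t : ℕ) (ht : Odd t) (K : ℝ) (hK : 0 ≤ K)
    (hS : ∀ (M : ℤ) (N : ℕ), |SJ t M N| ≤ K * Real.sqrt N) (N : ℕ) :
    |∑ e ∈ Finset.range (N + 1), chi (σ * 2 ^ k * t) e| ≤ (8 * K + 8) * Real.sqrt N := by
  obtain ⟨ψ, p1, p2, p3⟩ := chi_eq_psi σ hσ k t ht
  refine range8 _ (chi_le _) _ (by positivity) (chi_zero _) (fun n => ?_) N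
  rw [sum_range_mul_eq, Finset.sum_comm]
  refine (Finset.abs_sum_le_sum_abs _ _).trans ?_
  have : ∀ ρ ∈ Finset.range 8, |∑ j ∈ Finset.range n, chi (σ * 2 ^ k * t) (ρ + 8 * j)| ≤ K * Real.sqrt n := by
    intro ρ _
    simp only [p3, p2]
    rw [← Finset.mul_sum, abs_mul]
    have hc : Nat.Coprime 8 t := by
      rw [show 8 = 2 ^ 3 by rfl]; exact Nat.Coprime.pow_left _ (Nat.coprime_two_left.mpr ht)
    obtain ⟨u, v, huv⟩ := Nat.isCoprime_iff_coprime.mpr hc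
    have e1 : ∀ j : ℕ, jacobiSym ((ρ + 8 * j : ℕ) : ℤ) t = jacobiSym 8 t * jacobiSym (ρ * u + j) t := by
      intro j
      rw [← jacobiSym.mul_left]
      apply jacobiSym.mod_left'
      apply Int.ModEq.symm
      rw [Int.modEq_iff_dvd]
      refine ⟨ρ * v, ?_⟩
      push_cast at huv ⊢
      linear_combination -(ρ : ℤ) * huv
    have e2 : ∑ j ∈ Finset.range n, ((jacobiSym ((ρ + 8 * j : ℕ) : ℤ) t : ℤ) : ℝ) = ((jacobiSym 8 t : ℤ) : ℝ) * SJ t (ρ * u) n := by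
      unfold SJ
      rw [Finset.mul_sum]
      refine Finset.sum_congr rfl fun j _ => ?_
      rw [e1]; push_cast; rfl
    rw [e2, abs_mul]
    have h1 := hS (ρ * u) n
    calc |ψ ρ| * (|((jacobiSym 8 t : ℤ) : ℝ)| * |SJ t (ρ * u) n|) ≤ 1 * (1 * |SJ t (ρ * u) n|) := by
          gcongr
          · exact p1 ρ
          · exact jac_le_one _ _
      _ ≤ _ := by linarith
  refine (Finset.sum_le_sum this).trans ?_
  simp
  linarith

lemma chi_sum_one (σ : ℤ) (hσ : σ = 1 ∨ σ = -1) (k : ℕ) (hn : ¬ (σ = 1 ∧ Even k)) (N : ℕ) :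
    |∑ e ∈ Finset.range (N + 1), chi (σ * 2 ^ k * (1 : ℕ)) e| ≤ 8 * Real.sqrt N := by
  obtain ⟨ψ, p1, p2, p3⟩ := chi_eq_psi σ hσ k 1 (by decide)
  have := range8 (chi (σ * 2 ^ k * (1 : ℕ))) (chi_le _) 0 le_rfl (chi_zero _) (fun n => ?_) N
  · simpa using this
  rw [sum_range_mul_eq]
  have h1 : ∀ i ∈ Finset.range n, ∑ j ∈ Finset.range 8, chi (σ * 2 ^ k * (1 : ℕ)) (j + 8 * i) = 0 := by
    intro i _
    have e0 : ∀ j, chi (σ * 2 ^ k * (1 : ℕ)) (j + 8 * i) = chi (σ * 2 ^ k * (1 : ℕ)) j := by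
      intro j; rw [p3, p3, p2]; simp
    simp only [e0]
    simp only [chi, Finset.sum_range_succ, Finset.sum_range_zero]
    have o1 : Odd 1 := by decide
    have o3 : Odd 3 := by decide
    have o5 : Odd 5 := by decide
    have o7 : Odd 7 := by decide
    have o0 : ¬ Odd 0 := by decide
    have o2 : ¬ Odd 2 := by decide
    have o4 : ¬ Odd 4 := by decide
    have o6 : ¬ Odd 6 := by decide
    rw [if_pos o1, if_pos o3, if_pos o5, if_pos o7, if_neg o0, if_neg o2, if_neg o4, if_neg o6]
    simp only [jacobiSym.mul_left, jacobiSym.pow_left, Nat.cast_one, jacobiSym.one_left, mul_one, jacobiSym.one_right, one_pow]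
    have a3 : jacobiSym 2 3 = -1 := by norm_num
    have a5 : jacobiSym 2 5 = -1 := by norm_num
    have a7 : jacobiSym 2 7 = 1 := by norm_num
    rw [a3, a5, a7]
    have b3 : jacobiSym (-1) 3 = -1 := by norm_num
    have b5 : jacobiSym (-1) 5 = 1 := by norm_num
    have b7 : jacobiSym (-1) 7 = -1 := by norm_num
    rcases hσ with rfl | rfl
    · have : Odd k := by
        rw [← Nat.not_even_iff_odd]; intro h; exact hn ⟨rfl, h⟩
      simp [this.neg_one_pow]
    · rw [b3, b5, b7]
      rcases neg_one_pow_eq_or ℤ k with h | h <;> simp [h]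
  rw [Finset.sum_congr rfl h1]
  simp

theorem char_sum (ε : ℝ) (hε : 0 < ε) : ∃ C : ℝ, 1 ≤ C ∧ ∀ A : ℤ, A ≠ 0 → ¬ IsSquare A → ∀ N : ℕ,
    |∑ e ∈ Finset.range (N + 1), chi A e| ≤ C * (A.natAbs : ℝ) ^ (3 / 16 + ε) * Real.sqrt N := by
  obtain ⟨C1, hC1, hb⟩ := burgess (ε / 2) (by positivity)
  obtain ⟨C2, hC2, ho⟩ := omega_bound 2 (by norm_num) (ε / 2) (by positivity)
  refine ⟨16 * C1 * C2, by nlinarith, ?_⟩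
  intro A hA hsq N
  set n := A.natAbs with hn
  have hn0 : n ≠ 0 := by simpa [hn] using hA
  obtain ⟨k, m, hm, hkm⟩ := Nat.exists_eq_two_pow_mul_odd hn0
  obtain ⟨t, b, hbt, htsq⟩ := Nat.sq_mul_squarefree m
  have hm0 : m ≠ 0 := hm.pos.ne'
  have hb0 : b ≠ 0 := by rintro rfl; simp at hbt; omega
  have htodd : Odd t := by rw [← hbt] at hm; exact (Nat.odd_mul.mp hm).2
  have ht0 : 0 < t := htodd.pos
  set σ := A.sign with hσd
  have hσ : σ = 1 ∨ σ = -1 := by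
    rcases lt_or_gt_of_ne hA with h | h
    · right; exact Int.sign_eq_neg_one_of_neg h
    · left; exact Int.sign_eq_one_of_pos h
  have hAe : A = σ * 2 ^ k * t * b ^ 2 := by
    rw [← Int.sign_mul_natAbs A, ← hσd, ← hn, hkm, ← hbt]; push_cast; ring
  have hnt : (t : ℝ) ≤ n := by
    have : t ≤ n := by
      rw [hkm, ← hbt]
      calc t = 1 * (1 * t) := by ring
        _ ≤ 2 ^ k * (b ^ 2 * t) := by
          gcongr
          · exact Nat.one_le_two_pow
          · exact Nat.one_le_pow _ _ (by omega)
    exact_mod_cast this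
  have hnb : (b : ℝ) ≤ n := by
    have : b ≤ n := by
      rw [hkm, ← hbt]
      calc b = 1 * (b * 1) := by ring
        _ ≤ 2 ^ k * (b ^ 2 * t) := by
          gcongr
          · exact Nat.one_le_two_pow
          · nlinarith [Nat.pos_of_ne_zero hb0]
          · exact ht0
    exact_mod_cast this
  have hn1 : (1 : ℝ) ≤ n := by exact_mod_cast Nat.one_le_iff_ne_zero.mpr hn0
  set X : ℝ := (n : ℝ) ^ (3 / 16 + ε / 2) with hX
  have hX1 : 1 ≤ X := Real.one_le_rpow hn1 (by positivity)
  have hbase : ∀ N : ℕ, |∑ e ∈ Finset.range (N + 1), chi (σ * 2 ^ k * t) e| ≤ (16 * C1 * X) * Real.sqrt N := by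
    intro N
    have hsN := Real.sqrt_nonneg (N : ℝ)
    have hCX : 1 ≤ C1 * X := by nlinarith
    by_cases ht1 : t = 1
    · subst ht1
      refine (chi_sum_one σ hσ k ?_ N).trans ?_
      · rintro ⟨h1, r, hr⟩
        apply hsq
        rw [hAe, h1, hr]
        exact ⟨2 ^ r * b, by push_cast; ring⟩
      · gcongr; nlinarith
    · refine (chi_sum_large σ hσ k t htodd (C1 * X) (by linarith) ?_ N).trans ?_
      · intro M N
        refine (hb t htsq htodd (by omega) M N).trans ?_
        have h9 : (t : ℝ) ^ (3 / 16 + ε / 2) ≤ X := Real.rpow_le_rpow (by positivity) hnt (by positivity)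
        gcongr
      · gcongr; nlinarith
  have hcop : ∀ e, chi A e = if Nat.Coprime e b then chi (σ * 2 ^ k * t) e else 0 := by
    intro e
    unfold chi
    by_cases he : Odd e
    · rw [if_pos he, hAe, jacobiSym.mul_left, jacobiSym.pow_left]
      by_cases hc : Nat.Coprime e b
      · rw [if_pos hc, if_pos he, jacobiSym.sq_one, mul_one]
        rw [Int.gcd_natCast_natCast]; exact hc.symm
      · rw [if_neg hc]
        have : jacobiSym (b : ℤ) e = 0 := by
          haveI : NeZero e := ⟨he.pos.ne'⟩
          rw [jacobiSym.eq_zero_iff_not_coprime, Int.gcd_natCast_natCast]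
          intro h; exact hc (Nat.Coprime.symm h)
        rw [this]; simp
    · simp [he]
  rw [Finset.sum_congr rfl fun e _ => hcop e]
  refine (sieve_mult _ (chi_mul _) (chi_le _) _ (by positivity) hbase b hb0 N).trans ?_
  have h2 := ho b hb0
  have h3 : (b : ℝ) ^ (ε / 2) ≤ (n : ℝ) ^ (ε / 2) := by gcongr
  have e4 : (n : ℝ) ^ (3 / 16 + ε) = X * (n : ℝ) ^ (ε / 2) := by
    rw [hX, ← Real.rpow_add (by linarith)]; ring_nf
  rw [e4]
  calc 2 ^ (b.primeFactors.card) * (16 * C1 * X) * Real.sqrt N ≤ (C2 * (n : ℝ) ^ (ε / 2)) * (16 * C1 * X) * Real.sqrt N := by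
        gcongr
        exact h2.trans (by gcongr)
    _ = _ := by ring

end CS

section Tail

/-- the coefficients as an arithmetic function -/
noncomputable def cF (a : Fin 4 → ℤ) : ArithmeticFunction ℂ := ⟨fun q => if q = 0 then 0 else cq a q, by simp⟩
/-- the part at bad primes -/
noncomputable def cB (a : Fin 4 → ℤ) : ArithmeticFunction ℂ :=
  ⟨fun q => if q ≠ 0 ∧ q.primeFactors ⊆ (2 * (∏ i, a i).natAbs).primeFactors then cq a q else 0, by simp⟩
/-- the part at good primes -/
noncomputable def bF (A : ℤ) : ArithmeticFunction ℂ := ⟨fun n => (chi A n : ℂ) * (Nat.totient n : ℂ) / (n : ℂ) ^ 2, by simp⟩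
/-- Moebius factor -/
noncomputable def gF (A : ℤ) : ArithmeticFunction ℂ :=
  ⟨fun n => (ArithmeticFunction.moebius n : ℂ) * (chi A n : ℂ) / (n : ℂ) ^ 2, by simp⟩
/-- L-function factor -/
noncomputable def hF (A : ℤ) : ArithmeticFunction ℂ := ⟨fun n => (chi A n : ℂ) / (n : ℂ), by simp⟩

lemma bF_eq (A : ℤ) : bF A = gF A * hF A := by
  ext n
  rcases Nat.eq_zero_or_pos n with rfl | hn
  · simp
  have hT := (ArithmeticFunction.sum_eq_iff_sum_mul_moebius_eq (R := ℂ) (f := fun n => (Nat.totient n : ℂ))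
    (g := fun n => (n : ℂ))).1 (fun n hn => by exact_mod_cast Nat.sum_totient n) n hn
  rw [ArithmeticFunction.mul_apply]
  simp only [bF, gF, hF, ArithmeticFunction.coe_mk]
  rw [← hT, Finset.mul_sum, Finset.sum_div]
  refine Finset.sum_congr rfl fun x hx => ?_
  obtain ⟨h1, h2⟩ := Nat.mem_divisorsAntidiagonal.1 hx
  have h3 : x.1 ≠ 0 := by rintro h; simp [h] at h1; omega
  have h4 : x.2 ≠ 0 := by rintro h; simp [h] at h1; omega
  have h3' : (x.1 : ℂ) ≠ 0 := by exact_mod_cast h3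
  have h4' : (x.2 : ℂ) ≠ 0 := by exact_mod_cast h4
  rw [← h1, chi_mul]
  push_cast
  field_simp

lemma bF_mult (A : ℤ) : (bF A).IsMultiplicative := by
  refine ⟨by simp [bF, chi_one], fun {m n} h => ?_⟩
  simp only [bF, ArithmeticFunction.coe_mk]
  rw [chi_mul, Nat.totient_mul h]
  push_cast
  ring

lemma cq_one (a : Fin 4 → ℤ) : cq a 1 = 1 := by
  have := cq_coprime a 1 (by norm_num) (by decide) (by simpa using isCoprime_one_right)
  simpa using this

lemma cF_mult (a : Fin 4 → ℤ) : (cF a).IsMultiplicative := by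
  refine ⟨by simp [cF, cq_one], fun {m n} h => ?_⟩
  simp only [cF, ArithmeticFunction.coe_mk]
  by_cases hm : m = 0
  · simp [hm]
  by_cases hn : n = 0
  · simp [hn]
  simp [hm, hn, cq_mul a m n (Nat.pos_of_ne_zero hm) (Nat.pos_of_ne_zero hn) h]

lemma cB_mult (a : Fin 4 → ℤ) : (cB a).IsMultiplicative := by
  refine ⟨by simp [cB, cq_one], fun {m n} h => ?_⟩
  simp only [cB, ArithmeticFunction.coe_mk]
  by_cases hm : m = 0
  · simp [hm]
  by_cases hn : n = 0
  · simp [hn]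
  simp only [ne_eq, mul_eq_zero, hm, hn, or_self, not_false_eq_true, true_and, Nat.primeFactors_mul hm hn,
    Finset.union_subset_iff, cq_mul a m n (Nat.pos_of_ne_zero hm) (Nat.pos_of_ne_zero hn) h]
  by_cases h1 : m.primeFactors ⊆ (2 * (∏ i, a i).natAbs).primeFactors <;>
    by_cases h2 : n.primeFactors ⊆ (2 * (∏ i, a i).natAbs).primeFactors <;> simp [h1, h2]

lemma antidiag_left {f g : ArithmeticFunction ℂ} {p k : ℕ} (hp : p.Prime)
    (hf : f 1 = 1) (h : ∀ j, j ≠ 0 → f (p ^ j) = 0) : (f * g) (p ^ k) = g (p ^ k) := by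
  rw [ArithmeticFunction.mul_apply, Finset.sum_eq_single (1, p ^ k)]
  · simp [hf]
  · rintro ⟨x, y⟩ hx hne
    obtain ⟨h1, -⟩ := Nat.mem_divisorsAntidiagonal.1 hx
    simp only at h1
    obtain ⟨j, -, rfl⟩ := (Nat.dvd_prime_pow hp).1 (Dvd.intro _ h1)
    rcases eq_or_ne j 0 with rfl | hj
    · exfalso; apply hne; simp at h1; simp [h1]
    · simp [h j hj]
  · intro h1; exfalso; apply h1; simp [hp.ne_zero]

lemma cF_eq (a : Fin 4 → ℤ) (ha : ∏ i, a i ≠ 0) : cF a = cB a * bF (∏ i, a i) := by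
  rw [ArithmeticFunction.IsMultiplicative.eq_iff_eq_on_prime_powers _ (cF_mult a) _ ((cB_mult a).mul (bF_mult _))]
  intro p k hp
  set A := ∏ i, a i
  have hA2 : 2 * A.natAbs ≠ 0 := by simpa using ha
  by_cases hd : p ∈ (2 * A.natAbs).primeFactors
  · rw [mul_comm, antidiag_left hp (bF_mult A).1]
    · have : (p ^ k).primeFactors ⊆ (2 * A.natAbs).primeFactors := by
        intro r hr
        have h1 := Nat.mem_primeFactors.1 hr
        have := (Nat.prime_dvd_prime_iff_eq h1.1 hp).1 (h1.1.dvd_of_dvd_pow h1.2.1)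
        rwa [this]
      simp [cF, cB, hp.ne_zero, this, A]
    · intro j hj
      have : chi A (p ^ j) = 0 := by
        have h0 : chi A p = 0 := by
          unfold chi
          split_ifs with ho
          · rw [Int.cast_eq_zero, jacobiSym.eq_zero_iff]
            refine ⟨hp.ne_zero, ?_⟩
            have h2 := (Nat.mem_primeFactors.1 hd).2.1
            have h3 : p ∣ A.natAbs := by
              refine (Nat.Coprime.dvd_of_dvd_mul_left ?_ h2)
              exact ho.coprime_two_right
            have h4 : p ∣ Int.gcd A p := Int.dvd_gcd (Int.natCast_dvd.2 h3) (dvd_refl _) |> fun h => by exact_mod_cast h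
            intro h5
            rw [h5] at h4
            exact hp.one_lt.ne' (Nat.dvd_one.1 h4)
          · rfl
        obtain ⟨i, rfl⟩ := Nat.exists_eq_succ_of_ne_zero hj
        rw [Nat.succ_eq_add_one, pow_succ, chi_mul, h0, mul_zero]
      simp [bF, this]
  · rw [antidiag_left hp (cB_mult a).1]
    · have hnd : ¬ p ∣ 2 * A.natAbs := fun h => hd (Nat.mem_primeFactors.2 ⟨hp, h, hA2⟩)
      have hodd : Odd p := hp.odd_of_ne_two (by rintro rfl; exact hnd (Dvd.intro _ rfl))
      have hcop : IsCoprime A ((p ^ k : ℕ) : ℤ) := by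
        push_cast
        refine IsCoprime.pow_right ?_
        rw [Int.isCoprime_iff_gcd_eq_one, Int.gcd_comm, Int.gcd, Int.natAbs_natCast]
        exact (hp.coprime_iff_not_dvd).2 (fun h => hnd (h.mul_left _))
      have := cq_coprime a (p ^ k) (by have := hp.pos; positivity) hodd.pow hcop
      simp only [cF, bF, ArithmeticFunction.coe_mk, chi, hodd.pow, if_true]
      rw [if_neg (by simp [hp.ne_zero]), this]
      push_cast
      rfl
    · intro j hj
      have : ¬ (p ^ j).primeFactors ⊆ (2 * A.natAbs).primeFactors := by
        rw [Nat.primeFactors_prime_pow hj hp]; exact fun h => hd (h (Finset.mem_singleton_self p))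
      simp only [cB, ArithmeticFunction.coe_mk]
      rw [if_neg]
      exact fun h => this h.2

end Tail

section Tail2

lemma gcd_dvd (x y z t q : ℕ) (hx : x ≠ 0) (hy : y ≠ 0) (hz : z ≠ 0) (ht : t ≠ 0) (hq : q ≠ 0) :
    (x.gcd q * y.gcd q * z.gcd q * t.gcd q) ^ 4 ∣
    q ^ 4 * (x.gcd (y * z * t) * y.gcd (x * z * t) * z.gcd (x * y * t) * t.gcd (x * y * z)) ^ 3 := by
  have g0 : ∀ m n : ℕ, m ≠ 0 → m.gcd n ≠ 0 := fun m n hm => Nat.gcd_ne_zero_left hm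
  rw [← Nat.factorization_le_iff_dvd]
  · intro p
    have e1 := g0 x q hx
    have e2 := g0 y q hy
    have e3 := g0 z q hz
    have e4 := g0 t q ht
    have f1 := g0 x (y * z * t) hx
    have f2 := g0 y (x * z * t) hy
    have f3 := g0 z (x * y * t) hz
    have f4 := g0 t (x * y * z) ht
    rw [Nat.factorization_pow, Nat.factorization_mul (by positivity) e4, Nat.factorization_mul (by positivity) e3,
      Nat.factorization_mul e1 e2, Nat.factorization_mul (by positivity) (by positivity), Nat.factorization_pow,
      Nat.factorization_pow, Nat.factorization_mul (by positivity) f4, Nat.factorization_mul (by positivity) f3,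
      Nat.factorization_mul f1 f2, Nat.factorization_gcd hx hq, Nat.factorization_gcd hy hq,
      Nat.factorization_gcd hz hq, Nat.factorization_gcd ht hq, Nat.factorization_gcd hx (by positivity),
      Nat.factorization_gcd hy (by positivity), Nat.factorization_gcd hz (by positivity),
      Nat.factorization_gcd ht (by positivity)]
    rw [Nat.factorization_mul (a := y * z) (by positivity) ht, Nat.factorization_mul (a := x * z) (by positivity) ht,
      Nat.factorization_mul (a := x * y) (by positivity) ht, Nat.factorization_mul (a := x * y) (by positivity) hz,
      Nat.factorization_mul hx hy, Nat.factorization_mul hx hz, Nat.factorization_mul hy hz]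
    simp only [Finsupp.smul_apply, Finsupp.add_apply, Finsupp.inf_apply, smul_eq_mul]
    generalize x.factorization p = X
    generalize y.factorization p = Y
    generalize z.factorization p = Z
    generalize t.factorization p = W
    generalize q.factorization p = Q
    simp only [min_def]
    have k1 : (if X ≤ Q then X else Q) ≤ X ∧ (if X ≤ Q then X else Q) ≤ Q := by split_ifs <;> omega
    have k2 : (if Y ≤ Q then Y else Q) ≤ Y ∧ (if Y ≤ Q then Y else Q) ≤ Q := by split_ifs <;> omega
    have k3 : (if Z ≤ Q then Z else Q) ≤ Z ∧ (if Z ≤ Q then Z else Q) ≤ Q := by split_ifs <;> omega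
    have k4 : (if W ≤ Q then W else Q) ≤ W ∧ (if W ≤ Q then W else Q) ≤ Q := by split_ifs <;> omega
    revert k1 k2 k3 k4
    generalize (if X ≤ Q then X else Q) = X'
    generalize (if Y ≤ Q then Y else Q) = Y'
    generalize (if Z ≤ Q then Z else Q) = Z'
    generalize (if W ≤ Q then W else Q) = W'
    intro k1 k2 k3 k4
    split_ifs <;> omega
  · have e1 := g0 x q hx
    have e2 := g0 y q hy
    have e3 := g0 z q hz
    have e4 := g0 t q ht
    positivity
  · have f1 := g0 x (y * z * t) hx
    have f2 := g0 y (x * z * t) hy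
    have f3 := g0 z (x * y * t) hz
    have f4 := g0 t (x * y * z) ht
    positivity

lemma Delta4_eq (a : Fin 4 → ℤ) : Delta4 a = (a 0).natAbs.gcd ((a 1).natAbs * (a 2).natAbs * (a 3).natAbs) *
    (a 1).natAbs.gcd ((a 0).natAbs * (a 2).natAbs * (a 3).natAbs) *
    (a 2).natAbs.gcd ((a 0).natAbs * (a 1).natAbs * (a 3).natAbs) *
    (a 3).natAbs.gcd ((a 0).natAbs * (a 1).natAbs * (a 2).natAbs) := by
  unfold Delta4
  rw [Fin.prod_univ_four]
  have h0 : (Finset.univ.erase (0 : Fin 4)) = {1, 2, 3} := by decide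
  have h1 : (Finset.univ.erase (1 : Fin 4)) = {0, 2, 3} := by decide
  have h2 : (Finset.univ.erase (2 : Fin 4)) = {0, 1, 3} := by decide
  have h3 : (Finset.univ.erase (3 : Fin 4)) = {0, 1, 2} := by decide
  simp only [Int.gcd, Int.natAbs_mul]
  congr!
  all_goals
    first
    | (rw [show Finset.univ.erase (0 : Fin 4) = {1, 2, 3} by decide])
    | (rw [show Finset.univ.erase (1 : Fin 4) = {0, 2, 3} by decide])
    | (rw [show Finset.univ.erase (2 : Fin 4) = {0, 1, 3} by decide])
    | (rw [show Finset.univ.erase (3 : Fin 4) = {0, 1, 2} by decide])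
  all_goals
    simp [Finset.prod_insert, Int.natAbs_mul, mul_assoc]

lemma Delta4_pos (a : Fin 4 → ℤ) (ha : ∀ i, a i ≠ 0) : 0 < Delta4 a := by
  unfold Delta4
  exact Finset.prod_pos fun i _ => Int.gcd_pos_of_ne_zero_left _ (ha i)

lemma sqrt_gcd_le (a : Fin 4 → ℤ) (ha : ∀ i, a i ≠ 0) (q : ℕ) (hq : q ≠ 0) :
    Real.sqrt ((∏ i, Int.gcd (a i) q : ℕ) : ℝ) ≤ (q : ℝ) ^ (1 / 2 : ℝ) * (Delta4 a : ℝ) ^ (3 / 8 : ℝ) := by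
  set g : ℕ := ∏ i, Int.gcd (a i) q with hg
  have h := Nat.le_of_dvd (by have := Delta4_pos a ha; rw [Delta4_eq] at this; positivity)
    (gcd_dvd (a 0).natAbs (a 1).natAbs (a 2).natAbs (a 3).natAbs q (by simpa using ha 0) (by simpa using ha 1)
    (by simpa using ha 2) (by simpa using ha 3) hq)
  rw [← Delta4_eq] at h
  have hgg : g = (a 0).natAbs.gcd q * (a 1).natAbs.gcd q * (a 2).natAbs.gcd q * (a 3).natAbs.gcd q := by
    rw [hg, Fin.prod_univ_four]; rfl
  rw [← hgg] at h
  have h' : (g : ℝ) ^ 4 ≤ (q : ℝ) ^ 4 * (Delta4 a : ℝ) ^ 3 := by exact_mod_cast h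
  have e1 : Real.sqrt (g : ℝ) = ((g : ℝ) ^ 4) ^ (1 / 8 : ℝ) := by
    rw [Real.sqrt_eq_rpow, ← Real.rpow_natCast, ← Real.rpow_mul (Nat.cast_nonneg _)]; norm_num
  rw [e1]
  refine (Real.rpow_le_rpow (pow_nonneg (Nat.cast_nonneg _) _) h' (by norm_num)).trans (le_of_eq ?_)
  rw [Real.mul_rpow (pow_nonneg (Nat.cast_nonneg _) _) (pow_nonneg (Nat.cast_nonneg _) _),
    ← Real.rpow_natCast, ← Real.rpow_natCast, ← Real.rpow_mul (Nat.cast_nonneg _), ← Real.rpow_mul (Nat.cast_nonneg _)]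
  norm_num

/-- uniform Cauchy tail bound -/
def TailB (v : ArithmeticFunction ℂ) (α K : ℝ) : Prop := ∀ N N' : ℕ, N ≤ N' →
  ‖∑ n ∈ Finset.Ioc 0 N', v n - ∑ n ∈ Finset.Ioc 0 N, v n‖ ≤ K * ((N : ℝ) + 1) ^ (-α)

lemma tail_mul (u v : ArithmeticFunction ℂ) (α K M : ℝ) (hα : 0 ≤ α) (hK : 0 ≤ K) (hv : TailB v α K)
    (hu : ∀ N : ℕ, ∑ m ∈ Finset.Ioc 0 N, ‖u m‖ * (m : ℝ) ^ α ≤ M) : TailB (u * v) α (M * K) := by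
  intro N N' hN
  rw [ArithmeticFunction.sum_Ioc_mul_eq_sum_sum, ArithmeticFunction.sum_Ioc_mul_eq_sum_sum]
  have e1 : ∑ n ∈ Finset.Ioc 0 N, u n * ∑ m ∈ Finset.Ioc 0 (N / n), v m =
      ∑ n ∈ Finset.Ioc 0 N', u n * ∑ m ∈ Finset.Ioc 0 (N / n), v m := by
    refine Finset.sum_subset (Finset.Ioc_subset_Ioc_right hN) fun x hx hx' => ?_
    have : N / x = 0 := by
      rw [Nat.div_eq_zero_iff]; right
      simp only [Finset.mem_Ioc] at hx hx'; omega
    simp [this]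
  rw [e1, ← Finset.sum_sub_distrib]
  refine (norm_sum_le _ _).trans ?_
  calc _ ≤ ∑ n ∈ Finset.Ioc 0 N', (‖u n‖ * (n : ℝ) ^ α) * (K * ((N : ℝ) + 1) ^ (-α)) := by
        refine Finset.sum_le_sum fun n hn => ?_
        have hn0 : 0 < n := (Finset.mem_Ioc.1 hn).1
        rw [← mul_sub, norm_mul, mul_assoc]
        refine mul_le_mul_of_nonneg_left ((hv _ _ (Nat.div_le_div_right hN)).trans ?_) (norm_nonneg _)
        have h1 : ((N : ℝ) + 1) ≤ (((N / n : ℕ) : ℝ) + 1) * n := by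
          have := Nat.lt_succ_of_le (le_refl (N / n))
          have := (Nat.div_lt_iff_lt_mul hn0).1 this
          exact_mod_cast this
        have h2 : (((N / n : ℕ) : ℝ) + 1) ^ (-α) ≤ (n : ℝ) ^ α * ((N : ℝ) + 1) ^ (-α) := by
          have hn0' : (0 : ℝ) < n := by exact_mod_cast hn0
          rw [Real.rpow_neg (by positivity), Real.rpow_neg (by positivity), ← div_eq_mul_inv, inv_eq_one_div,
            div_le_div_iff₀ (by positivity) (by positivity), one_mul, ← Real.mul_rpow (by positivity) (by positivity)]
          exact Real.rpow_le_rpow (by positivity) (by rwa [mul_comm]) hα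
        nlinarith
    _ ≤ _ := by
        rw [← Finset.sum_mul, mul_assoc]
        exact mul_le_mul_of_nonneg_right (hu N') (by positivity)

lemma tail_mono (v : ArithmeticFunction ℂ) (α β K : ℝ) (h : β ≤ α) (hK : 0 ≤ K) (hv : TailB v α K) : TailB v β K := by
  intro N N' hN
  refine (hv N N' hN).trans (mul_le_mul_of_nonneg_left ?_ hK)
  exact Real.rpow_le_rpow_of_exponent_le (by linarith [Nat.cast_nonneg (α := ℝ) N]) (by linarith)

lemma abel_tail (f : ℕ → ℝ) (hf0 : f 0 = 0) (K : ℝ) (hK : 0 ≤ K)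
    (h : ∀ N : ℕ, |∑ e ∈ Finset.range (N + 1), f e| ≤ K * Real.sqrt N) (N k : ℕ) :
    |∑ e ∈ Finset.Ioc 0 (N + k), f e / e - ∑ e ∈ Finset.Ioc 0 N, f e / e| ≤ 4 * K / Real.sqrt ((N : ℝ) + 1) := by
  set S : ℕ → ℝ := fun N => ∑ e ∈ Finset.range (N + 1), f e with hS
  have key : |∑ e ∈ Finset.Ioc 0 (N + k), f e / e - ∑ e ∈ Finset.Ioc 0 N, f e / e - S (N + k) / ((N + k : ℕ) + 1)
      + S N / (N + 1)| ≤ 2 * K * (1 / Real.sqrt ((N : ℝ) + 1) - 1 / Real.sqrt (((N + k : ℕ) : ℝ) + 1)) := by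
    induction k with
    | zero => simp
    | succ k ih =>
      set n : ℕ := N + k + 1 with hn
      have e1 : N + (k + 1) = n := by omega
      rw [e1]
      have e2 : ∑ e ∈ Finset.Ioc 0 n, f e / e = ∑ e ∈ Finset.Ioc 0 (N + k), f e / e + f n / n :=
        Finset.sum_Ioc_succ_top (Nat.zero_le _) _
      have e3 : S n = S (N + k) + f n := Finset.sum_range_succ _ _
      have hn1 : (n : ℝ) = ((N + k : ℕ) : ℝ) + 1 := by simp [hn]
      have hnpos : (0 : ℝ) < n := by rw [hn1]; positivity
      have e4 : ∑ e ∈ Finset.Ioc 0 n, f e / e - ∑ e ∈ Finset.Ioc 0 N, f e / e - S n / ((n : ℝ) + 1)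
          + S N / (N + 1) = (∑ e ∈ Finset.Ioc 0 (N + k), f e / e - ∑ e ∈ Finset.Ioc 0 N, f e / e -
          S (N + k) / ((N + k : ℕ) + 1) + S N / (N + 1)) + S n / (n * (n + 1)) := by
        rw [e2, ← hn1]
        have : f n = S n - S (N + k) := by rw [e3]; ring
        rw [this]
        field_simp
        ring
      rw [e4]
      refine (abs_add_le _ _).trans ?_
      have e5 : |S n / (n * (n + 1))| ≤ 2 * K * (1 / Real.sqrt (n : ℝ) - 1 / Real.sqrt ((n : ℝ) + 1)) := by
        rw [abs_div, abs_of_pos (by positivity : (0 : ℝ) < n * (n + 1))]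
        refine (div_le_div_of_nonneg_right (h n) (by positivity)).trans ?_
        set s := Real.sqrt (n : ℝ) with hs
        set t := Real.sqrt ((n : ℝ) + 1) with ht
        have hs0 : 0 < s := Real.sqrt_pos.2 hnpos
        have ht0 : 0 < t := Real.sqrt_pos.2 (by positivity)
        have hs2 : s ^ 2 = n := Real.sq_sqrt hnpos.le
        have ht2 : t ^ 2 = n + 1 := Real.sq_sqrt (by positivity)
        have hst : s ≤ t := Real.sqrt_le_sqrt (by linarith)
        rw [← ht2, ← hs2]
        have : 2 * K * (1 / s - 1 / t) - K * s / (s ^ 2 * t ^ 2) = K * ((t - s) / (s * t ^ 2 * (t + s))) := by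
          have h1 : t ^ 2 - s ^ 2 = 1 := by rw [hs2, ht2]; ring
          field_simp
          linear_combination K * 2 * t * h1
        have h3 : 0 ≤ K * ((t - s) / (s * t ^ 2 * (t + s))) := by
          have : 0 ≤ t - s := by linarith
          positivity
        linarith
      rw [← hn1] at ih
      rw [← hn1]
      linarith
  have b1 : ∀ m : ℕ, |S m / (m + 1)| ≤ K / Real.sqrt ((m : ℝ) + 1) := by
    intro m
    rw [abs_div, abs_of_pos (by positivity : (0 : ℝ) < m + 1)]
    refine (div_le_div_of_nonneg_right (h m) (by positivity)).trans ?_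
    have : (m : ℝ) + 1 = Real.sqrt ((m : ℝ) + 1) * Real.sqrt ((m : ℝ) + 1) := (Real.mul_self_sqrt (by positivity)).symm
    have h0 : 0 < Real.sqrt ((m : ℝ) + 1) := Real.sqrt_pos.2 (by positivity)
    rw [div_le_div_iff₀ (by positivity) h0]
    nth_rewrite 2 [this]
    have : Real.sqrt (m : ℝ) ≤ Real.sqrt ((m : ℝ) + 1) := Real.sqrt_le_sqrt (by linarith)
    rw [← mul_assoc]
    gcongr
  have b2 := b1 (N + k)
  have b3 := b1 N
  have h0 : 0 < Real.sqrt ((N : ℝ) + 1) := Real.sqrt_pos.2 (by positivity)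
  have b4 : K / Real.sqrt (((N + k : ℕ) : ℝ) + 1) ≤ K / Real.sqrt ((N : ℝ) + 1) := by
    refine div_le_div_of_nonneg_left hK h0 (Real.sqrt_le_sqrt ?_)
    push_cast; linarith [Nat.cast_nonneg (α := ℝ) k]
  have b5 : 0 ≤ 1 / Real.sqrt (((N + k : ℕ) : ℝ) + 1) := by positivity
  have b6 : 4 * K / Real.sqrt ((N : ℝ) + 1) = 4 * (K / Real.sqrt ((N : ℝ) + 1)) := by ring
  have b7 : 2 * K * (1 / Real.sqrt ((N : ℝ) + 1) - 1 / Real.sqrt (((N + k : ℕ) : ℝ) + 1)) ≤ 2 * (K / Real.sqrt ((N : ℝ) + 1)) := by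
    have : 0 ≤ 2 * K * (1 / Real.sqrt (((N + k : ℕ) : ℝ) + 1)) := by positivity
    have : 2 * (K / Real.sqrt ((N : ℝ) + 1)) = 2 * K * (1 / Real.sqrt ((N : ℝ) + 1)) := by ring
    linarith
  rw [b6]
  rw [abs_le] at *
  constructor <;> linarith [key.1, key.2, b2.1, b2.2, b3.1, b3.2]

lemma tail_h (A : ℤ) (K : ℝ) (hK : 0 ≤ K)
    (h : ∀ N : ℕ, |∑ e ∈ Finset.range (N + 1), chi A e| ≤ K * Real.sqrt N) : TailB (hF A) (1 / 2) (4 * K) := by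
  intro N N' hN
  obtain ⟨k, rfl⟩ := Nat.exists_eq_add_of_le hN
  have := abel_tail (chi A) (chi_zero A) K hK h N k
  have e : ∀ M : ℕ, ∑ n ∈ Finset.Ioc 0 M, hF A n = ((∑ e ∈ Finset.Ioc 0 M, chi A e / e : ℝ) : ℂ) := by
    intro M; push_cast; rfl
  rw [e, e, ← Complex.ofReal_sub, Complex.norm_real, Real.norm_eq_abs]
  refine this.trans (le_of_eq ?_)
  rw [Real.rpow_neg (by positivity), ← Real.sqrt_eq_rpow]
  rfl

end Tail2

section Tail3

lemma gF_sum (A : ℤ) (α : ℝ) (hα : α ≤ 1 / 2) (N : ℕ) :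
    ∑ m ∈ Finset.Ioc 0 N, ‖gF A m‖ * (m : ℝ) ^ α ≤ ∑' m : ℕ, (m : ℝ) ^ (-(3 / 2) : ℝ) := by
  have hs : Summable (fun m : ℕ => (m : ℝ) ^ (-(3 / 2) : ℝ)) := Real.summable_nat_rpow.2 (by norm_num)
  refine le_trans (Finset.sum_le_sum fun m hm => ?_) (hs.sum_le_tsum (Finset.Ioc 0 N) fun m _ => by positivity)
  have hm0 : 0 < m := (Finset.mem_Ioc.1 hm).1
  have hm1 : (1 : ℝ) ≤ m := by exact_mod_cast hm0
  have h1 : ‖gF A m‖ ≤ (m : ℝ) ^ (-2 : ℝ) := by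
    have : gF A m = (ArithmeticFunction.moebius m : ℂ) * (chi A m : ℂ) / (m : ℂ) ^ 2 := rfl
    rw [this, norm_div, norm_mul, Complex.norm_real, norm_pow, Complex.norm_natCast, Complex.norm_intCast,
      Real.rpow_neg (by positivity), ← one_div, show (2 : ℝ) = ((2 : ℕ) : ℝ) by norm_num, Real.rpow_natCast]
    refine div_le_div_of_nonneg_right ?_ (by positivity)
    have a1 : |((ArithmeticFunction.moebius m : ℤ) : ℝ)| ≤ 1 := by
      exact_mod_cast ArithmeticFunction.abs_moebius_le_one
    have a2 := chi_le A m
    rw [Real.norm_eq_abs]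
    exact mul_le_one₀ a1 (abs_nonneg _) a2
  calc _ ≤ (m : ℝ) ^ (-2 : ℝ) * (m : ℝ) ^ (1 / 2 : ℝ) := by
        gcongr
    _ = _ := by rw [← Real.rpow_add (by positivity)]; norm_num

/-- the monoid hom n ↦ n^{-s} -/
noncomputable def powHom (s : ℝ) : ℕ →* ℝ where
  toFun n := (n : ℝ) ^ (-s)
  map_one' := by simp
  map_mul' m n := by push_cast; exact Real.mul_rpow (Nat.cast_nonneg _) (Nat.cast_nonneg _)

lemma smooth_sum (s : ℝ) (hs : 0 < s) (n N : ℕ) :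
    ∑ m ∈ Finset.Ioc 0 N, (if m ≠ 0 ∧ m.primeFactors ⊆ n.primeFactors then (m : ℝ) ^ (-s) else 0) ≤
      ((1 - (2 : ℝ) ^ (-s))⁻¹) ^ n.primeFactors.card := by
  have hp : ∀ {p : ℕ}, p.Prime → (p : ℝ) ^ (-s) ≤ 2 ^ (-s) := fun {p} hp =>
    Real.rpow_le_rpow_of_nonpos (by norm_num) (by exact_mod_cast hp.two_le) (by linarith)
  have h2 : (2 : ℝ) ^ (-s) < 1 := Real.rpow_lt_one_of_one_lt_of_neg (by norm_num) (by linarith)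
  have key := EulerProduct.summable_and_hasSum_factoredNumbers_prod_filter_prime_geometric (f := powHom s)
    (fun {p} h => by
      have : powHom s p = (p : ℝ) ^ (-s) := rfl
      rw [this, Real.norm_of_nonneg (by positivity)]
      exact (hp h).trans_lt h2) n.primeFactors
  have hb : ∏ p ∈ n.primeFactors with p.Prime, (1 - powHom s p)⁻¹ ≤ ((1 - (2 : ℝ) ^ (-s))⁻¹) ^ n.primeFactors.card := by
    rw [Finset.filter_true_of_mem (fun p h => Nat.prime_of_mem_primeFactors h)]
    refine (Finset.prod_le_prod (fun p h => ?_) (fun p h => ?_)).trans (le_of_eq (Finset.prod_const _))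
    · have := hp (Nat.prime_of_mem_primeFactors h)
      have e : powHom s p = (p : ℝ) ^ (-s) := rfl
      rw [e]
      exact inv_nonneg.2 (by linarith)
    · have := hp (Nat.prime_of_mem_primeFactors h)
      have e : powHom s p = (p : ℝ) ^ (-s) := rfl
      rw [e]
      exact inv_anti₀ (by linarith) (by linarith)
  refine le_trans ?_ hb
  have hi := hasSum_subtype_iff_indicator.1 key.2
  refine le_trans (Finset.sum_le_sum fun m hm => ?_) (sum_le_hasSum (Finset.Ioc 0 N) (fun m _ => ?_) hi)
  · split_ifs with hc
    · rw [Set.indicator_of_mem]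
      · rfl
      · exact ⟨hc.1, fun p h => hc.2 (List.mem_toFinset.2 h)⟩
    · refine Set.indicator_nonneg (fun m _ => ?_) _
      exact Real.rpow_nonneg (Nat.cast_nonneg _) _
  · refine Set.indicator_nonneg (fun m _ => ?_) _
    exact Real.rpow_nonneg (Nat.cast_nonneg _) _

lemma cB_sum (a : Fin 4 → ℤ) (ha : ∀ i, a i ≠ 0) (s : ℝ) (hs : 0 < s) (N : ℕ) :
    ∑ m ∈ Finset.Ioc 0 N, ‖cB a m‖ * (m : ℝ) ^ (1 / 2 - s) ≤
      4 * (Delta4 a : ℝ) ^ (3 / 8 : ℝ) * ((1 - (2 : ℝ) ^ (-s))⁻¹) ^ (2 * (∏ i, a i).natAbs).primeFactors.card := by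
  have hD : (0 : ℝ) ≤ 4 * (Delta4 a : ℝ) ^ (3 / 8 : ℝ) := by positivity
  refine le_trans ?_ (mul_le_mul_of_nonneg_left (smooth_sum s hs (2 * (∏ i, a i).natAbs) N) hD)
  rw [Finset.mul_sum]
  refine Finset.sum_le_sum fun m hm => ?_
  have hm0 : 0 < m := (Finset.mem_Ioc.1 hm).1
  have hm0' : (0 : ℝ) < m := by exact_mod_cast hm0
  simp only [cB, ArithmeticFunction.coe_mk]
  split_ifs with hc
  · have h1 := cq_norm_le a m hm0.ne'
    have h2 := sqrt_gcd_le a ha m hm0.ne'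
    calc _ ≤ (4 * (m : ℝ)⁻¹ * ((m : ℝ) ^ (1 / 2 : ℝ) * (Delta4 a : ℝ) ^ (3 / 8 : ℝ))) * (m : ℝ) ^ (1 / 2 - s) := by
          refine mul_le_mul_of_nonneg_right (h1.trans ?_) (by positivity)
          exact mul_le_mul_of_nonneg_left h2 (by positivity)
      _ = _ := by
          rw [show (m : ℝ) ^ (-s) = (m : ℝ)⁻¹ * ((m : ℝ) ^ (1 / 2 : ℝ) * (m : ℝ) ^ (1 / 2 - s)) by
            rw [← Real.rpow_neg_one, ← Real.rpow_add hm0', ← Real.rpow_add hm0']; ring_nf]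
          ring
  · simp

theorem singular_tail (ε : ℝ) (hε : 0 < ε) (hε2 : ε ≤ 1 / 2) : ∃ C : ℝ, 1 ≤ C ∧ ∀ (a : Fin 4 → ℤ) (G : ℂ), (∀ i, a i ≠ 0) →
    ¬ IsSquare (∏ i, a i) → Filter.Tendsto (singularPartial a) Filter.atTop (nhds G) → ∀ T : ℕ,
    ‖G - singularPartial a T‖ ≤ C * ((∏ i, a i).natAbs : ℝ) ^ (3 / 16 + ε) * (Delta4 a : ℝ) ^ (3 / 8 : ℝ) *
      ((T : ℝ) + 1) ^ (-(1 / 2 - ε)) := by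
  have h2 : (2 : ℝ) ^ (-ε) < 1 := Real.rpow_lt_one_of_one_lt_of_neg (by norm_num) (by linarith)
  have h2' : (0 : ℝ) < 2 ^ (-ε) := by positivity
  set κ := (1 - (2 : ℝ) ^ (-ε))⁻¹ with hκ
  have hκ1 : 1 ≤ κ := (one_le_inv₀ (by linarith)).2 (by linarith)
  obtain ⟨C1, hC1, hc⟩ := char_sum (ε / 2) (by positivity)
  obtain ⟨C2, hC2, ho⟩ := omega_bound κ hκ1 (ε / 2) (by positivity)
  set Z := ∑' m : ℕ, (m : ℝ) ^ (-(3 / 2) : ℝ) with hZ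
  have hZ0 : 0 ≤ Z := tsum_nonneg fun m => by positivity
  refine ⟨4 * (C2 * 2) * (Z + 1) * (4 * C1), by
    have h1 : 1 ≤ Z + 1 := by linarith
    have h3 : 1 ≤ C2 * (Z + 1) := one_le_mul_of_one_le_of_one_le hC2 h1
    have h4 : 1 ≤ C2 * (Z + 1) * C1 := one_le_mul_of_one_le_of_one_le h3 hC1
    nlinarith, fun a G ha hsq hG T => ?_⟩
  set A := ∏ i, a i with hA
  have hA0 : A ≠ 0 := Finset.prod_ne_zero_iff.2 fun i _ => ha i
  have hAn : 0 < A.natAbs := Int.natAbs_pos.2 hA0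
  have hAn' : (0 : ℝ) < A.natAbs := by exact_mod_cast hAn
  set K := C1 * (A.natAbs : ℝ) ^ (3 / 16 + ε / 2) with hKd
  have hK : 0 ≤ K := by positivity
  have t1 := tail_mono _ _ (1 / 2 - ε) _ (by linarith) (by positivity) (tail_h A K hK (hc A hA0 hsq))
  have t2 := tail_mul (gF A) _ _ _ Z (by linarith) (by positivity) t1 (gF_sum A _ (by linarith))
  rw [← bF_eq] at t2
  have t3 := tail_mul (cB a) _ _ _ _ (by linarith) (by positivity) t2 (cB_sum a ha ε hε)
  rw [← cF_eq a hA0] at t3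
  have e : ∀ N, ∑ n ∈ Finset.Ioc 0 N, cF a n = singularPartial a N := by
    intro N
    unfold singularPartial
    have : Finset.Ioc 0 N = Finset.Icc 1 N := by ext; simp [Finset.mem_Ioc, Finset.mem_Icc, Nat.succ_le_iff]
    rw [this]
    refine Finset.sum_congr rfl fun q hq => ?_
    have : q ≠ 0 := by have := (Finset.mem_Icc.1 hq).1; omega
    simp only [cF, ArithmeticFunction.coe_mk, this, if_false, cq]
  have hlim : Tendsto (fun N' => ‖singularPartial a N' - singularPartial a T‖) atTop (nhds ‖G - singularPartial a T‖) :=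
    (hG.sub_const _).norm
  refine (le_of_tendsto hlim (Filter.eventually_atTop.2 ⟨T, fun N' hN' => ?_⟩))
  have h3 := t3 T N' hN'
  rw [e, e] at h3
  refine h3.trans ?_
  refine mul_le_mul_of_nonneg_right ?_ (by positivity)
  have o := ho (2 * A.natAbs) (by omega)
  have o2 : C2 * ((2 * A.natAbs : ℕ) : ℝ) ^ (ε / 2) ≤ C2 * 2 * (A.natAbs : ℝ) ^ (ε / 2) := by
    push_cast
    rw [Real.mul_rpow (by norm_num) hAn'.le, mul_assoc]
    refine mul_le_mul_of_nonneg_left (mul_le_mul_of_nonneg_right ?_ (by positivity)) (by linarith)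
    calc (2 : ℝ) ^ (ε / 2) ≤ 2 ^ (1 : ℝ) := Real.rpow_le_rpow_of_exponent_le (by norm_num) (by linarith)
      _ = 2 := by norm_num
  have o3 := o.trans o2
  have e2 : (A.natAbs : ℝ) ^ (3 / 16 + ε) = (A.natAbs : ℝ) ^ (3 / 16 + ε / 2) * (A.natAbs : ℝ) ^ (ε / 2) := by
    rw [← Real.rpow_add hAn']; ring_nf
  set D := (Delta4 a : ℝ) ^ (3 / 8 : ℝ) with hD
  have hD0 : 0 ≤ D := by positivity
  rw [e2]
  generalize κ ^ (2 * A.natAbs).primeFactors.card = X at o3 ⊢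
  calc 4 * D * X * (Z * (4 * K)) ≤ 4 * D * (C2 * 2 * (A.natAbs : ℝ) ^ (ε / 2)) * ((Z + 1) * (4 * K)) := by
        refine mul_le_mul (mul_le_mul_of_nonneg_left o3 (by positivity)) ?_ (by positivity) (by positivity)
        exact mul_le_mul_of_nonneg_right (by linarith) (by positivity)
    _ = _ := by rw [hKd]; ring

end Tail3

section Fre

lemma eC_cont : Continuous eC := by unfold eC; fun_prop

lemma eC_sq_deriv (c x : ℝ) : HasDerivAt (fun x : ℝ => eC (-(c * x ^ 2)))
    (-(4 * Real.pi * Complex.I * c * x) * eC (-(c * x ^ 2))) x := by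
  unfold eC
  have h0 : HasDerivAt (fun x : ℝ => (x : ℂ)) 1 x := Complex.ofRealCLM.hasDerivAt
  have h1 : HasDerivAt (fun x : ℝ => 2 * Real.pi * Complex.I * ((-(c * x ^ 2) : ℝ) : ℂ))
      (-(4 * Real.pi * Complex.I * c * x)) x := by
    have := ((h0.pow 2).const_mul (c : ℂ)).neg.const_mul (2 * Real.pi * Complex.I)
    convert! this using 1
    · ext y; simp
    · push_cast; ring
  have := h1.cexp
  convert! this using 1
  ring

lemma fresnel_tail (c : ℝ) (hc : c ≠ 0) (d b : ℝ) (hd : 0 < d) (hdb : d ≤ b) :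
    ‖∫ x in d..b, eC (-(c * x ^ 2))‖ ≤ 1 / (|c| * d) := by
  have hpos : ∀ x ∈ Set.uIcc d b, 0 < x := fun x hx => by
    rw [Set.uIcc_of_le hdb] at hx; exact hd.trans_le hx.1
  set k : ℂ := 4 * Real.pi * Complex.I * c with hk
  have hck : Continuous (fun x : ℝ => eC (-(c * x ^ 2))) := eC_cont.comp (by fun_prop)
  have hk0 : k ≠ 0 := by simp [hk, Real.pi_ne_zero, hc]
  have hder : ∀ x ∈ Set.uIcc d b, HasDerivAt (fun x : ℝ => eC (-(c * x ^ 2)) / (x : ℂ))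
      (-k * eC (-(c * x ^ 2)) - eC (-(c * x ^ 2)) / (x : ℂ) ^ 2) x := by
    intro x hx
    have hx0 : (x : ℂ) ≠ 0 := by exact_mod_cast (hpos x hx).ne'
    have := (eC_sq_deriv c x).div (Complex.ofRealCLM.hasDerivAt (x := x)) hx0
    convert! this using 1
    simp only [Complex.ofRealCLM_apply, Complex.ofReal_one]
    field_simp
    rw [hk]; ring
  have hi1 : IntervalIntegrable (fun x : ℝ => -k * eC (-(c * x ^ 2))) volume d b :=
    (hck.const_mul _ |>.intervalIntegrable _ _) 
  have hi2 : IntervalIntegrable (fun x : ℝ => eC (-(c * x ^ 2)) / (x : ℂ) ^ 2) volume d b := by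
    refine ContinuousOn.intervalIntegrable (ContinuousOn.div hck.continuousOn (by fun_prop) fun x hx => ?_)
    exact pow_ne_zero _ (by exact_mod_cast (hpos x hx).ne')
  have key := intervalIntegral.integral_eq_sub_of_hasDerivAt hder (hi1.sub hi2)
  rw [intervalIntegral.integral_sub hi1 hi2, intervalIntegral.integral_const_mul] at key
  set I := ∫ x in d..b, eC (-(c * x ^ 2)) with hI
  set J := ∫ x in d..b, eC (-(c * x ^ 2)) / (x : ℂ) ^ 2 with hJ
  have hJb : ‖J‖ ≤ 1 / d - 1 / b := by
    have h1 : ‖J‖ ≤ ∫ x in d..b, (x : ℝ) ^ (-2 : ℤ) := by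
      refine (intervalIntegral.norm_integral_le_integral_norm hdb).trans (le_of_eq ?_)
      refine intervalIntegral.integral_congr fun x hx => ?_
      simp only [norm_div, eC_norm, norm_pow, Complex.norm_real, Real.norm_of_nonneg (hpos x hx).le]
      simp [zpow_neg]
    rw [integral_zpow (Or.inr ⟨by norm_num, fun h => lt_irrefl _ (hpos 0 h)⟩)] at h1
    refine h1.trans (le_of_eq ?_)
    norm_num; ring
  have hb0 : 0 < b := hd.trans_le hdb
  have e1 : k * I = eC (-(c * d ^ 2)) / d - eC (-(c * b ^ 2)) / b - J := by linear_combination -key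
  have n1 : ‖k‖ * ‖I‖ ≤ 2 / d := by
    rw [← norm_mul, e1]
    refine (norm_sub_le _ _).trans ?_
    have := norm_sub_le (eC (-(c * d ^ 2)) / d) (eC (-(c * b ^ 2)) / b)
    simp only [norm_div, eC_norm, Complex.norm_real, Real.norm_of_nonneg hd.le, Real.norm_of_nonneg hb0.le] at this
    have e : 2 / d = 1 / d + 1 / b + (1 / d - 1 / b) := by ring
    rw [e]; linarith
  have nk : ‖k‖ = 4 * Real.pi * |c| := by
    simp [hk, abs_of_pos Real.pi_pos]
  rw [nk] at n1
  have hc' : 0 < |c| := abs_pos.2 hc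
  have hpi := Real.pi_gt_three
  rw [le_div_iff₀ (by positivity)] at n1 ⊢
  have : ‖I‖ * (|c| * d) * 2 ≤ 4 * Real.pi * |c| * ‖I‖ * d := by
    have : 0 ≤ ‖I‖ * (|c| * d) := by positivity
    nlinarith
  linarith

lemma fresnel (c : ℝ) (hc : c ≠ 0) (b : ℝ) (hb : 0 ≤ b) :
    ‖∫ x in (-b)..b, eC (-(c * x ^ 2))‖ ≤ 4 / Real.sqrt |c| := by
  have hck : Continuous (fun x : ℝ => eC (-(c * x ^ 2))) := eC_cont.comp (by fun_prop)
  have hc' : 0 < |c| := abs_pos.2 hc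
  set s := Real.sqrt |c| with hs
  have hs0 : 0 < s := Real.sqrt_pos.2 hc'
  have hs2 : |c| = s * s := (Real.mul_self_sqrt hc'.le).symm
  have half : ‖∫ x in (0 : ℝ)..b, eC (-(c * x ^ 2))‖ ≤ 2 / s := by
    rcases le_total b (1 / s) with h | h
    · have := intervalIntegral.norm_integral_le_of_norm_le_const (a := 0) (b := b) (C := 1)
        (f := fun x : ℝ => eC (-(c * x ^ 2))) (fun x _ => by simp [eC_norm])
      rw [sub_zero, abs_of_nonneg hb, one_mul] at this
      have h2 : 2 / s = 1 / s + 1 / s := by ring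
      have h3 : 0 < 1 / s := by positivity
      linarith
    · have h3 : 0 < 1 / s := by positivity
      rw [← intervalIntegral.integral_add_adjacent_intervals (hck.intervalIntegrable 0 (1 / s)) (hck.intervalIntegrable (1 / s) b)]
      refine (norm_add_le _ _).trans ?_
      have h1 := intervalIntegral.norm_integral_le_of_norm_le_const (a := 0) (b := 1 / s) (C := 1)
        (f := fun x : ℝ => eC (-(c * x ^ 2))) (fun x _ => by simp [eC_norm])
      rw [sub_zero, abs_of_nonneg h3.le, one_mul] at h1
      have h2 := fresnel_tail c hc (1 / s) b h3 h
      have h4 : 1 / (|c| * (1 / s)) = 1 / s := by rw [hs2]; field_simp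
      rw [h4] at h2
      have h2 : 2 / s = 1 / s + 1 / s := by ring
      linarith
  have e : ∫ x in (-b)..0, eC (-(c * x ^ 2)) = ∫ x in (0 : ℝ)..b, eC (-(c * x ^ 2)) := by
    have := intervalIntegral.integral_comp_neg (a := 0) (b := b) (fun x : ℝ => eC (-(c * x ^ 2)))
    simp only [neg_sq, neg_zero] at this
    exact this.symm
  rw [← intervalIntegral.integral_add_adjacent_intervals (hck.intervalIntegrable (-b) 0) (hck.intervalIntegrable 0 b), e]
  refine (norm_add_le _ _).trans ?_
  have h2 : 4 / s = 2 / s + 2 / s := by ring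
  linarith

lemma box_int (e : Fin 4 → ℤ) (θ b : ℝ) (hb : 0 ≤ b) :
    ∫ x in Metric.closedBall (0 : Fin 4 → ℝ) b, eC (-(θ * Gquad e x)) =
      ∏ i, ∫ x in (-b)..b, eC (-(θ * e i * x ^ 2)) := by
  have h1 : ∀ i, ∫ x in (-b)..b, eC (-(θ * e i * x ^ 2)) =
      ∫ x, (Set.Icc (-b) b).indicator (fun x => eC (-(θ * e i * x ^ 2))) x := by
    intro i
    rw [intervalIntegral.integral_of_le (by linarith), integral_indicator measurableSet_Icc, integral_Icc_eq_integral_Ioc]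
  simp only [h1]
  rw [← integral_fintype_prod_volume_eq_prod (fun (i : Fin 4) (x : ℝ) => (Set.Icc (-b) b).indicator (fun x => eC (-(θ * e i * x ^ 2))) x),
    ← integral_indicator Metric.isClosed_closedBall.measurableSet]
  congr 1
  ext x
  by_cases hx : x ∈ Metric.closedBall (0 : Fin 4 → ℝ) b
  · have hx' : ∀ i, x i ∈ Set.Icc (-b) b := by
      intro i
      rw [mem_closedBall_zero_iff, pi_norm_le_iff_of_nonneg hb] at hx
      exact abs_le.1 (hx i)
    rw [Set.indicator_of_mem hx, Finset.prod_congr rfl fun i _ => Set.indicator_of_mem (hx' i) _]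
    simp only [Gquad, Fin.sum_univ_four, Fin.prod_univ_four, ← eC_add]
    congr 1
    ring
  · rw [Set.indicator_of_notMem hx]
    have : ∃ i, x i ∉ Set.Icc (-b) b := by
      by_contra! hcon
      apply hx
      rw [mem_closedBall_zero_iff, pi_norm_le_iff_of_nonneg hb]
      exact fun i => abs_le.2 (hcon i)
    obtain ⟨i, hi⟩ := this
    exact (Finset.prod_eq_zero (Finset.mem_univ i) (Set.indicator_of_notMem hi _)).symm

lemma box_bound (e : Fin 4 → ℤ) (he : ∀ i, e i = 1 ∨ e i = -1) (θ b : ℝ) (hb : 0 ≤ b) (hb2 : b ≤ 5 / 4) :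
    ‖∫ x in Metric.closedBall (0 : Fin 4 → ℝ) b, eC (-(θ * Gquad e x))‖ ≤ 600 / (1 + θ ^ 2) := by
  rw [box_int e θ b hb, norm_prod]
  have habs : ∀ i, |θ * e i| = |θ| := fun i => by rcases he i with h | h <;> simp [h]
  rcases le_or_gt |θ| 1 with h | h
  · have h1 : ∀ i ∈ Finset.univ, ‖∫ x in (-b)..b, eC (-(θ * e i * x ^ 2))‖ ≤ 5 / 2 := by
      intro i _
      have := intervalIntegral.norm_integral_le_of_norm_le_const (a := -b) (b := b) (C := 1)
        (f := fun x : ℝ => eC (-(θ * e i * x ^ 2))) (fun x _ => by simp [eC_norm])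
      refine this.trans ?_
      rw [abs_of_nonneg (by linarith)]; linarith
    refine (Finset.prod_le_prod (fun i _ => norm_nonneg _) h1).trans ?_
    have : θ ^ 2 ≤ 1 := by rw [← sq_abs]; nlinarith [abs_nonneg θ]
    rw [le_div_iff₀ (by positivity)]
    simp only [Finset.prod_const, Finset.card_univ, Fintype.card_fin]
    nlinarith
  · have h1 : ∀ i ∈ Finset.univ, ‖∫ x in (-b)..b, eC (-(θ * e i * x ^ 2))‖ ≤ 4 / Real.sqrt |θ| := by
      intro i _
      have := fresnel (θ * e i) (fun h0 => by have := habs i; rw [h0, abs_zero] at this; linarith) b hb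
      rwa [habs] at this
    refine (Finset.prod_le_prod (fun i _ => norm_nonneg _) h1).trans ?_
    simp only [Finset.prod_const, Finset.card_univ, Fintype.card_fin]
    have h2 : Real.sqrt |θ| ^ 4 = θ ^ 2 := by
      rw [show (4 : ℕ) = 2 * 2 by norm_num, pow_mul, Real.sq_sqrt (abs_nonneg _), sq_abs]
    have h3 : 1 < θ ^ 2 := by rw [← sq_abs]; nlinarith
    rw [div_pow, h2, div_le_div_iff₀ (by positivity) (by positivity)]
    nlinarith

end Fre

section PH

lemma Gq_cont (e : Fin 4 → ℤ) : Continuous (Gquad e) := by unfold Gquad; fun_prop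

lemma eG_cont (e : Fin 4 → ℤ) (θ : ℝ) : Continuous (fun x => eC (-(θ * Gquad e x))) := by
  have := Gq_cont e
  exact eC_cont.comp (by fun_prop)

lemma shell_bound (e : Fin 4 → ℤ) (he : ∀ i, e i = 1 ∨ e i = -1) (θ : ℝ) (S : Set ℝ) (hS : S.OrdConnected)
    (hS2 : ∀ s ∈ S, s ≤ 5 / 4) :
    ‖∫ x in {x : Fin 4 → ℝ | ‖x‖ ∈ S}, eC (-(θ * Gquad e x))‖ ≤ 1200 / (1 + θ ^ 2) := by
  by_cases hne : (S ∩ Set.Ici 0).Nonempty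
  · set S' := S ∩ Set.Ici 0 with hS'
    have hbb : BddBelow S' := ⟨0, fun s hs => hs.2⟩
    have hba : BddAbove S' := ⟨5 / 4, fun s hs => hS2 s hs.1⟩
    set lo := sInf S' with hlo
    set hi := sSup S' with hhi
    have l0 : 0 ≤ lo := le_csInf hne fun s hs => hs.2
    have h54 : hi ≤ 5 / 4 := csSup_le hne fun s hs => hS2 s hs.1
    have lh : lo ≤ hi := by
      obtain ⟨s, hs⟩ := hne
      exact (csInf_le hbb hs).trans (le_csSup hba hs)
    have hae : {x : Fin 4 → ℝ | ‖x‖ ∈ S} =ᵐ[volume]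
        (Metric.closedBall 0 hi \ Metric.closedBall 0 lo : Set (Fin 4 → ℝ)) := by
      have n1 : ∀ᵐ x : Fin 4 → ℝ, x ∉ Metric.sphere (0 : Fin 4 → ℝ) lo :=
        measure_eq_zero_iff_ae_notMem.1 (Measure.addHaar_sphere volume 0 lo)
      have n2 : ∀ᵐ x : Fin 4 → ℝ, x ∉ Metric.sphere (0 : Fin 4 → ℝ) hi :=
        measure_eq_zero_iff_ae_notMem.1 (Measure.addHaar_sphere volume 0 hi)
      filter_upwards [n1, n2] with x h1 h2
      rw [mem_sphere_zero_iff_norm] at h1 h2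
      apply propext
      show ‖x‖ ∈ S ↔ x ∈ Metric.closedBall 0 hi \ Metric.closedBall 0 lo
      simp only [Set.mem_diff, mem_closedBall_zero_iff, not_le]
      constructor
      · intro h
        have : ‖x‖ ∈ S' := ⟨h, norm_nonneg _⟩
        exact ⟨le_csSup hba this, lt_of_le_of_ne (csInf_le hbb this) (Ne.symm h1)⟩
      · rintro ⟨h3, h4⟩
        obtain ⟨s, hs, hs1⟩ := exists_lt_of_csInf_lt hne h4
        obtain ⟨t, ht, ht1⟩ := exists_lt_of_lt_csSup hne (lt_of_le_of_ne h3 h2)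
        exact hS.out hs.1 ht.1 ⟨hs1.le, ht1.le⟩
    rw [setIntegral_congr_set hae, integral_diff Metric.isClosed_closedBall.measurableSet
      ((eG_cont e θ).continuousOn.integrableOn_compact (isCompact_closedBall _ _)) (Metric.closedBall_subset_closedBall lh)]
    refine (norm_sub_le _ _).trans ?_
    have b1 := box_bound e he θ hi (l0.trans lh) h54
    have b2 := box_bound e he θ lo l0 (lh.trans h54)
    have : 1200 / (1 + θ ^ 2) = 600 / (1 + θ ^ 2) + 600 / (1 + θ ^ 2) := by ring
    linarith
  · have : {x : Fin 4 → ℝ | ‖x‖ ∈ S} = ∅ := by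
      rw [Set.eq_empty_iff_forall_notMem]
      intro x hx
      exact hne ⟨‖x‖, hx, norm_nonneg _⟩
    rw [this]
    simp; positivity

/-- admissible radial weights -/
structure Wt (w : (Fin 4 → ℝ) → ℝ) : Prop where
  meas : Measurable w
  nn : ∀ x, 0 ≤ w x
  le1 : ∀ x, w x ≤ 1
  supp : ∀ x, 5 / 4 < ‖x‖ → w x = 0
  lev : ∀ τ : ℝ, 0 ≤ τ → ∃ S : Set ℝ, S.OrdConnected ∧ ∀ x, τ < w x ↔ ‖x‖ ∈ S ∧ ‖x‖ ≤ 5 / 4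

/-- the oscillatory integral -/
noncomputable def pH (w : (Fin 4 → ℝ) → ℝ) (e : Fin 4 → ℤ) (θ : ℝ) : ℂ :=
  ∫ x : Fin 4 → ℝ, (w x : ℂ) * eC (-(θ * Gquad e x))

lemma Wt.integrable {w : (Fin 4 → ℝ) → ℝ} (hw : Wt w) : Integrable w := by
  have h : Integrable ((Metric.closedBall (0 : Fin 4 → ℝ) (5 / 4)).indicator (fun _ => (1 : ℝ))) := by
    rw [integrable_indicator_iff Metric.isClosed_closedBall.measurableSet]
    exact integrableOn_const (isCompact_closedBall _ _).measure_lt_top.ne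
  refine h.mono' hw.meas.aestronglyMeasurable (ae_of_all _ fun x => ?_)
  rw [Real.norm_of_nonneg (hw.nn x)]
  by_cases hx : ‖x‖ ≤ 5 / 4
  · rw [Set.indicator_of_mem (by simpa using hx)]; exact hw.le1 x
  · rw [hw.supp x (not_le.1 hx)]; exact Set.indicator_nonneg (fun _ _ => zero_le_one) _

lemma pH_bound {w : (Fin 4 → ℝ) → ℝ} (hw : Wt w) (e : Fin 4 → ℤ) (he : ∀ i, e i = 1 ∨ e i = -1) (θ : ℝ) :
    ‖pH w e θ‖ ≤ 1200 / (1 + θ ^ 2) := by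
  have hE := eG_cont e θ
  have hlc : ∀ x, (w x : ℂ) * eC (-(θ * Gquad e x)) =
      ∫ τ in Set.Ioc (0 : ℝ) 1, (if τ < w x then (1 : ℂ) else 0) * eC (-(θ * Gquad e x)) := by
    intro x
    rw [integral_mul_const]
    congr 1
    have : (fun τ : ℝ => if τ < w x then (1 : ℂ) else 0) = (Set.Iio (w x)).indicator (fun _ => (1 : ℂ)) := by
      ext τ; simp [Set.indicator]
    rw [this, setIntegral_indicator measurableSet_Iio, setIntegral_const]
    have h2 : Set.Ioc (0 : ℝ) 1 ∩ Set.Iio (w x) = Set.Ioo 0 (w x) := by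
      ext τ
      simp only [Set.mem_inter_iff, Set.mem_Ioc, Set.mem_Iio, Set.mem_Ioo]
      constructor
      · rintro ⟨⟨a, b⟩, c⟩; exact ⟨a, c⟩
      · rintro ⟨a, c⟩; exact ⟨⟨a, (c.le.trans (hw.le1 x))⟩, c⟩
    rw [h2]
    simp [Measure.real, hw.nn x]
  unfold pH
  simp only [hlc]
  rw [integral_integral_swap]
  · have := norm_setIntegral_le_of_norm_le_const (μ := volume) (s := Set.Ioc (0 : ℝ) 1)
      (f := fun τ => ∫ x : Fin 4 → ℝ, (if τ < w x then (1 : ℂ) else 0) * eC (-(θ * Gquad e x)))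
      (C := 1200 / (1 + θ ^ 2)) (by simp) ?_
    · simpa [Measure.real] using this
    · intro τ hτ
      obtain ⟨S, hS, hS2⟩ := hw.lev τ hτ.1.le
      have h3 := shell_bound e he θ (S ∩ Set.Iic (5 / 4)) (hS.inter Set.ordConnected_Iic) (fun s hs => hs.2)
      have hms : MeasurableSet {x | τ < w x} := measurableSet_lt measurable_const hw.meas
      have e1 : {x : Fin 4 → ℝ | ‖x‖ ∈ S ∩ Set.Iic (5 / 4)} = {x | τ < w x} := by
        ext x; simp only [Set.mem_setOf_eq, Set.mem_inter_iff, Set.mem_Iic]; exact (hS2 x).symm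
      rw [e1, ← integral_indicator hms] at h3
      convert! h3 using 3
      ext x
      simp only [Set.indicator, Set.mem_setOf_eq]
      split_ifs <;> simp
  · have hm : Measurable (Function.uncurry fun (x : Fin 4 → ℝ) (τ : ℝ) =>
        (if τ < w x then (1 : ℂ) else 0) * eC (-(θ * Gquad e x))) := by
      refine Measurable.mul (Measurable.ite (measurableSet_lt measurable_snd (hw.meas.comp measurable_fst))
        measurable_const measurable_const) (hE.measurable.comp measurable_fst)
    have hb : Integrable (((Metric.closedBall (0 : Fin 4 → ℝ) (5 / 4)) ×ˢ (Set.univ : Set ℝ)).indicator (fun _ => (1 : ℝ)))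
        ((volume : Measure (Fin 4 → ℝ)).prod (volume.restrict (Set.Ioc (0 : ℝ) 1))) := by
      rw [integrable_indicator_iff (Metric.isClosed_closedBall.measurableSet.prod MeasurableSet.univ)]
      refine integrableOn_const ?_
      rw [Measure.prod_prod]
      refine ENNReal.mul_ne_top (isCompact_closedBall _ _).measure_lt_top.ne (by simp)
    have hae : ∀ᵐ z ∂((volume : Measure (Fin 4 → ℝ)).prod (volume.restrict (Set.Ioc (0 : ℝ) 1))), 0 < z.2 := by
      have h1 : ∀ᵐ t ∂(volume.restrict (Set.Ioc (0 : ℝ) 1)), 0 < t := by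
        filter_upwards [ae_restrict_mem measurableSet_Ioc] with t ht using ht.1
      exact Measure.quasiMeasurePreserving_snd.ae h1
    refine hb.mono' hm.aestronglyMeasurable ?_
    filter_upwards [hae] with z hz
    obtain ⟨x, τ⟩ := z
    simp only [Function.uncurry_apply_pair, norm_mul, eC_norm, mul_one]
    by_cases hx : ‖x‖ ≤ 5 / 4
    · rw [Set.indicator_of_mem (by simpa using hx)]
      split_ifs <;> simp
    · rw [hw.supp x (not_le.1 hx), if_neg (not_lt.2 (le_of_lt hz))]
      simp only [norm_zero]
      exact Set.indicator_nonneg (fun _ _ => zero_le_one) _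

lemma pH_cont {w : (Fin 4 → ℝ) → ℝ} (hw : Wt w) (e : Fin 4 → ℤ) : Continuous (pH w e) := by
  unfold pH
  refine continuous_of_dominated (bound := fun x => w x) (fun θ => ?_) (fun θ => ae_of_all _ fun x => ?_) hw.integrable
    (ae_of_all _ fun x => ?_)
  · exact (Complex.measurable_ofReal.comp hw.meas).aestronglyMeasurable.mul (eG_cont e θ).aestronglyMeasurable
  · simp [eC_norm, abs_of_nonneg (hw.nn x)]
  · exact continuous_const.mul (eC_cont.comp (by fun_prop))

lemma pH_integrable {w : (Fin 4 → ℝ) → ℝ} (hw : Wt w) (e : Fin 4 → ℤ) (he : ∀ i, e i = 1 ∨ e i = -1) :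
    Integrable (pH w e) := by
  have h : Integrable (fun θ : ℝ => 1200 * (1 + θ ^ 2)⁻¹) := integrable_inv_one_add_sq.const_mul _
  exact h.mono' (pH_cont hw e).aestronglyMeasurable (ae_of_all _ fun θ => by
    simpa [div_eq_mul_inv] using pH_bound hw e he θ)

lemma psi1_eq (t : ℝ) : psi1 t = expNegInvGlue (1 - t ^ 2) := by
  unfold psi1 expNegInvGlue
  by_cases h : |t| < 1
  · have : ¬ (1 - t ^ 2 ≤ 0) := by rw [not_le]; have := (sq_lt_one_iff_abs_lt_one t).2 h; linarith
    rw [if_pos h, if_neg this]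
  · have : (1 - t ^ 2 ≤ 0) := by
      have : ¬ t ^ 2 < 1 := fun h' => h ((sq_lt_one_iff_abs_lt_one t).1 h'); linarith
    rw [if_neg h, if_pos this]

lemma psi1_smooth : ContDiff ℝ ((⊤ : ℕ∞) : WithTop ℕ∞) psi1 := by
  have : psi1 = fun t => expNegInvGlue (1 - t ^ 2) := funext psi1_eq
  rw [this]
  have h := expNegInvGlue.contDiff (n := ⊤)
  exact h.comp (f := fun t : ℝ => 1 - t ^ 2) (by fun_prop)

lemma psi1_anti (s t : ℝ) (h : |s| ≤ |t|) : psi1 t ≤ psi1 s := by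
  rw [psi1_eq, psi1_eq]
  exact expNegInvGlue.monotone (by have := sq_le_sq.2 h; linarith)

lemma psi1_nonneg (t : ℝ) : 0 ≤ psi1 t := by rw [psi1_eq]; exact expNegInvGlue.nonneg _
lemma psi1_zero : psi1 0 = Real.exp (-1) := by simp [psi1]
lemma psi1_le (t : ℝ) : Real.exp 1 * psi1 t ≤ 1 := by
  have := psi1_anti 0 t (by simp)
  rw [psi1_zero] at this
  calc _ ≤ Real.exp 1 * Real.exp (-1) := by gcongr
    _ = 1 := by rw [← Real.exp_add]; simp

end PH

section Ww

lemma Wt.of_profile (f : ℝ → ℝ) (c : ℝ) (h1 : MonotoneOn f (Set.Iic c)) (h2 : AntitoneOn f (Set.Ici c))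
    (h3 : ∀ t, 0 ≤ f t) (h4 : ∀ t, f t ≤ 1) (h5 : ∀ t, 5 / 4 < t → f t = 0) : Wt (fun x => f ‖x‖) := by
  have hoc : ∀ τ : ℝ, {t | τ < f t}.OrdConnected := by
    intro τ
    refine ⟨fun x hx y hy z hz => ?_⟩
    rcases le_total z c with h | h
    · exact lt_of_lt_of_le hx (h1 (hz.1.trans h) h hz.1)
    · exact lt_of_lt_of_le hy (h2 h (h.trans hz.2) hz.2)
  have hf : Measurable f := measurable_of_Ioi fun τ => (hoc τ).measurableSet
  refine ⟨hf.comp measurable_norm, fun x => h3 _, fun x => h4 _, fun x hx => h5 _ hx, fun τ hτ => ⟨_, hoc τ, fun x => ?_⟩⟩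
  simp only [Set.mem_setOf_eq]
  refine ⟨fun h => ⟨h, ?_⟩, fun h => h.1⟩
  by_contra hc
  rw [h5 _ (not_lt.1 (fun h' => hc h'.le) |>.lt_of_ne (fun h' => hc h'.ge))] at h
  linarith

/-- generic trapezoid-like profile -/
noncomputable def prof (η L : ℝ) (t : ℝ) : ℝ :=
  if t ≤ η then 0
  else if t ≤ 2 * η then Real.exp 1 * psi1 (t / η - 2)
  else if t ≤ L then 1
  else if t ≤ L + η then Real.exp 1 * psi1 (t / η - L / η)
  else 0

lemma e_psi_nonneg (t : ℝ) : 0 ≤ Real.exp 1 * psi1 t := mul_nonneg (Real.exp_pos _).le (psi1_nonneg _)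

lemma prof_Wt (η L : ℝ) (hη : 0 < η) (hL : 2 * η ≤ L) (hL2 : L + η ≤ 5 / 4) : Wt (fun x => prof η L ‖x‖) := by
  have n := e_psi_nonneg
  have l := psi1_le
  refine Wt.of_profile _ (2 * η) ?_ ?_ ?_ ?_ ?_
  · intro s hs t ht hst
    simp only [Set.mem_Iic] at hs ht
    unfold prof
    by_cases h1 : s ≤ η
    · rw [if_pos h1]
      split_ifs <;> first | exact le_rfl | exact zero_le_one | exact n _
    · have h2 : ¬ t ≤ η := fun h => h1 (hst.trans h)
      rw [if_neg h1, if_neg h2, if_pos hs, if_pos ht]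
      refine mul_le_mul_of_nonneg_left (psi1_anti _ _ ?_) (Real.exp_pos _).le
      have e1 : t / η ≤ 2 := (div_le_iff₀ hη).2 ht
      have e2 : s / η ≤ t / η := div_le_div_of_nonneg_right hst hη.le
      rw [abs_of_nonpos (by linarith), abs_of_nonpos (by linarith)]
      linarith
  · intro s hs t ht hst
    simp only [Set.mem_Ici] at hs ht
    have h1 : ¬ s ≤ η := by intro h; linarith
    have h1' : ¬ t ≤ η := by intro h; linarith
    have e0 : Real.exp 1 * psi1 0 = 1 := by rw [psi1_zero, ← Real.exp_add]; simp
    have key : ∀ r, 2 * η ≤ r → r ≤ L → prof η L r = 1 := by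
      intro r hr hr2
      unfold prof
      rw [if_neg (by intro h; linarith)]
      by_cases h : r ≤ 2 * η
      · have : r = 2 * η := le_antisymm h hr
        rw [if_pos h, this, mul_div_assoc, div_self hη.ne', mul_one, sub_self, e0]
      · rw [if_neg h, if_pos hr2]
    have key2 : ∀ r, L < r → prof η L r = if r ≤ L + η then Real.exp 1 * psi1 (r / η - L / η) else 0 := by
      intro r hr
      unfold prof
      rw [if_neg (by intro h; linarith), if_neg (by intro h; linarith), if_neg (by intro h; linarith)]
    rcases le_or_gt s L with hs2 | hs2
    · rw [key s hs hs2]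
      rcases le_or_gt t L with ht2 | ht2
      · rw [key t ht ht2]
      · rw [key2 t ht2]
        split_ifs
        · exact l _
        · exact zero_le_one
    · rw [key2 s hs2, key2 t (hs2.trans_le hst)]
      by_cases h : t ≤ L + η
      · rw [if_pos h, if_pos (hst.trans h)]
        refine mul_le_mul_of_nonneg_left (psi1_anti _ _ ?_) (Real.exp_pos _).le
        have e1 : L / η ≤ s / η := div_le_div_of_nonneg_right hs2.le hη.le
        have e2 : s / η ≤ t / η := div_le_div_of_nonneg_right hst hη.le
        rw [abs_of_nonneg (by linarith), abs_of_nonneg (by linarith)]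
        linarith
      · rw [if_neg h]
        split_ifs
        · exact n _
        · exact le_rfl
  · intro t; unfold prof
    split_ifs <;> first | exact le_rfl | exact zero_le_one | exact n _
  · intro t; unfold prof
    split_ifs <;> first | exact le_rfl | exact zero_le_one | exact l _
  · intro t ht; unfold prof
    rw [if_neg (by intro h; linarith), if_neg (by intro h; linarith), if_neg (by intro h; linarith), if_neg (by intro h; linarith)]

lemma w1_Wt (η : ℝ) (h : η ∈ Set.Ioo (0 : ℝ) (1 / 4)) : Wt (w1 η) := by
  have := prof_Wt η (1 - η) h.1 (by linarith [h.2]) (by linarith [h.2])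
  convert! this using 1
  ext x
  unfold w1 prof
  rw [sub_add_cancel]

lemma w2_Wt (η : ℝ) (h : η ∈ Set.Ioo (0 : ℝ) (1 / 4)) : Wt (w2 η) := by
  have := prof_Wt η 1 h.1 (by linarith [h.2]) (by linarith [h.2])
  exact this

end Ww

section Uf

lemma psi1_out (t : ℝ) (h : 1 ≤ |t|) : psi1 t = 0 := by
  unfold psi1; rw [if_neg (not_lt.2 h)]

lemma psi1_pos (t : ℝ) (h : |t| < 1) : 0 < psi1 t := by
  unfold psi1; rw [if_pos h]; exact Real.exp_pos _

lemma psi43_cont : Continuous (fun s : ℝ => psi1 (4 * s - 3)) := psi1_smooth.continuous.comp (by fun_prop)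

lemma psi43_supp : HasCompactSupport (fun s : ℝ => psi1 (4 * s - 3)) := by
  refine HasCompactSupport.intro (isCompact_Icc (a := (1 / 2 : ℝ)) (b := 1)) fun x hx => psi1_out _ ?_
  rw [le_abs]
  simp only [Set.mem_Icc, not_and_or, not_le] at hx
  rcases hx with h | h
  · right; linarith
  · left; linarith

lemma psi43_int_pos : 0 < ∫ s : ℝ, psi1 (4 * s - 3) := by
  refine psi43_cont.integral_pos_of_hasCompactSupport_nonneg_nonzero psi43_supp (fun x => psi1_nonneg _) (x := 3 / 4) ?_
  norm_num [psi1_zero]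

lemma uFn_out (t : ℝ) (h : t ≤ 1 / 2 ∨ 1 ≤ t) : uFn t = 0 := by
  unfold uFn
  rw [psi1_out, mul_zero]
  rw [le_abs]
  rcases h with h | h
  · right; linarith
  · left; linarith

lemma uFn_smooth : ContDiff ℝ ((⊤ : ℕ∞) : WithTop ℕ∞) uFn := by
  unfold uFn
  exact contDiff_const.mul (psi1_smooth.comp (f := fun t : ℝ => 4 * t - 3) (by fun_prop))

lemma uFn_nonneg (t : ℝ) : 0 ≤ uFn t := mul_nonneg (inv_nonneg.2 psi43_int_pos.le) (psi1_nonneg _)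

lemma uFn_supp : HasCompactSupport uFn := by
  refine HasCompactSupport.intro (isCompact_Icc (a := (1 / 2 : ℝ)) (b := 1)) fun x hx => uFn_out _ ?_
  simp only [Set.mem_Icc, not_and_or, not_le] at hx
  rcases hx with h | h
  · left; linarith
  · right; linarith

lemma uFn_int : ∫ t, uFn t = 1 := by
  unfold uFn
  rw [integral_const_mul, inv_mul_cancel₀ psi43_int_pos.ne']

lemma abs_smooth (g : ℝ → ℝ) (h1 : ∀ t, 0 < t → ContDiffAt ℝ ((⊤ : ℕ∞) : WithTop ℕ∞) g t) (h2 : ∀ t, t < 1 / 2 → g t = 0) :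
    ContDiff ℝ ((⊤ : ℕ∞) : WithTop ℕ∞) (fun s => g |s|) := by
  rw [contDiff_iff_contDiffAt]
  intro s
  rcases eq_or_ne s 0 with rfl | hs
  · refine (contDiffAt_const (c := (0 : ℝ))).congr_of_eventuallyEq ?_
    have : ∀ᶠ s : ℝ in nhds 0, |s| < 1 / 2 := by
      have := continuous_abs.tendsto (0 : ℝ)
      rw [abs_zero] at this
      exact this.eventually (gt_mem_nhds (by norm_num))
    filter_upwards [this] with s hs using h2 _ hs
  · exact (h1 _ (abs_pos.2 hs)).comp s (contDiffAt_abs hs)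

lemma abs_supp (g : ℝ → ℝ) (h2 : ∀ t, 3 < t → g t = 0) : HasCompactSupport (fun s => g |s|) := by
  refine HasCompactSupport.intro (isCompact_Icc (a := (-3 : ℝ)) (b := 3)) fun x hx => h2 _ ?_
  by_contra hc
  exact hx (abs_le.1 (not_lt.1 hc))

/-- phi(s)=u(|s|)/|s| -/
noncomputable def phE (s : ℝ) : ℝ := uFn |s| / |s|
/-- k(s)=u(1/|s|)/|s| -/
noncomputable def kE (s : ℝ) : ℝ := uFn (1 / |s|) / |s|

lemma U_smooth : ContDiff ℝ ((⊤ : ℕ∞) : WithTop ℕ∞) (fun s => uFn |s|) :=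
  abs_smooth uFn (fun t _ => uFn_smooth.contDiffAt) (fun t h => uFn_out _ (Or.inl h.le))
lemma U_supp : HasCompactSupport (fun s => uFn |s|) := abs_supp _ fun t h => uFn_out _ (Or.inr (by linarith))

lemma phE_smooth : ContDiff ℝ ((⊤ : ℕ∞) : WithTop ℕ∞) phE := by
  refine abs_smooth (fun t => uFn t / t) (fun t h => uFn_smooth.contDiffAt.div contDiffAt_id h.ne') (fun t h => ?_)
  simp only [uFn_out _ (Or.inl h.le), zero_div]
lemma phE_supp : HasCompactSupport phE := abs_supp (fun t => uFn t / t) fun t h => by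
  simp only [uFn_out t (Or.inr (by linarith)), zero_div]

lemma kE_out (s : ℝ) (h : |s| ≤ 1 ∨ 2 ≤ |s|) : kE s = 0 := by
  unfold kE
  rw [uFn_out, zero_div]
  rcases h with h | h
  · rcases (abs_nonneg s).eq_or_lt with h0 | h0
    · left; rw [← h0]; norm_num
    · right; exact (one_le_div h0).2 h
  · left; exact one_div_le_one_div_of_le (by norm_num) h

lemma kE_smooth : ContDiff ℝ ((⊤ : ℕ∞) : WithTop ℕ∞) kE := by
  refine abs_smooth (fun t => uFn (1 / t) / t) (fun t h => ?_) (fun t h => ?_)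
  · refine ContDiffAt.div (uFn_smooth.contDiffAt.comp t (contDiffAt_const.div contDiffAt_id h.ne')) contDiffAt_id h.ne'
  · rcases le_or_gt t 0 with h0 | h0
    · show uFn (1 / t) / t = 0
      rw [uFn_out, zero_div]; left
      exact (div_nonpos_of_nonneg_of_nonpos zero_le_one h0).trans (by norm_num)
    · rw [uFn_out, zero_div]; right; exact (one_le_div h0).2 (by linarith)
lemma kE_supp : HasCompactSupport kE := abs_supp (fun t => uFn (1 / t) / t) fun t h => by
  rw [uFn_out, zero_div]; left; exact one_div_le_one_div_of_le (by norm_num) (by linarith)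

lemma kE_nonneg (s : ℝ) : 0 ≤ kE s := div_nonneg (uFn_nonneg _) (abs_nonneg _)

lemma U_int : ∫ t, uFn |t| = 2 := by
  rw [integral_comp_abs, ← integral_indicator measurableSet_Ioi]
  have : (Set.Ioi (0 : ℝ)).indicator uFn = uFn := by
    ext t
    by_cases h : t ∈ Set.Ioi (0 : ℝ)
    · rw [Set.indicator_of_mem h]
    · rw [Set.indicator_of_notMem h, uFn_out]; left; simp only [Set.mem_Ioi, not_lt] at h; linarith
  rw [this, uFn_int, mul_one]

lemma kE_lip : ∃ C : ℝ, 0 ≤ C ∧ (∀ s, kE s ≤ C) ∧ ∀ s t, |kE s - kE t| ≤ C * |s - t| := by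
  obtain ⟨C1, h1⟩ := kE_smooth.continuous.bounded_above_of_compact_support kE_supp
  obtain ⟨C2, h2⟩ := (kE_smooth.continuous_deriv (by simp)).bounded_above_of_compact_support kE_supp.deriv
  have hC1 : 0 ≤ C1 := (norm_nonneg _).trans (h1 0)
  have hC2 : 0 ≤ C2 := (norm_nonneg _).trans (h2 0)
  refine ⟨C1 + C2, by positivity, fun s => ?_, fun s t => ?_⟩
  · have := h1 s; rw [Real.norm_of_nonneg (kE_nonneg s)] at this; linarith
  · have := Convex.norm_image_sub_le_of_norm_deriv_le (f := kE) (C := C2) (s := Set.univ) (x := t) (y := s)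
      (fun x _ => kE_smooth.differentiable (by simp) x) (fun x _ => h2 x) convex_univ trivial trivial
    rw [Real.norm_eq_abs, Real.norm_eq_abs] at this
    nlinarith [abs_nonneg (s - t)]

end Uf

section Phi
open scoped FourierTransform SchwartzMap

lemma fourier_eC (f : ℝ → ℂ) (ξ : ℝ) : 𝓕 f ξ = ∫ v : ℝ, eC (-(v * ξ)) * f v := by
  rw [Real.fourier_real_eq_integral_exp_smul]
  refine integral_congr_ae (ae_of_all _ fun v => ?_)
  simp only [smul_eq_mul, eC]
  congr 2
  push_cast; ring

lemma fourierInv_eC (f : ℝ → ℂ) (ξ : ℝ) : 𝓕⁻ f ξ = ∫ v : ℝ, eC (v * ξ) * f v := by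
  rw [Real.fourierInv_eq_fourier_neg, fourier_eC]
  simp

noncomputable def UcS : 𝓢(ℝ, ℂ) :=
  HasCompactSupport.toSchwartzMap (f := fun s => ((uFn |s| : ℝ) : ℂ))
    (U_supp.comp_left (g := fun x : ℝ => (x : ℂ)) (by simp))
    (Complex.ofRealCLM.contDiff.comp U_smooth)

lemma UcS_apply (s : ℝ) : UcS s = ((uFn |s| : ℝ) : ℂ) := rfl

noncomputable def KS : 𝓢(ℝ, ℂ) := 𝓕 UcS

lemma KS_zero : KS 0 = 2 := by
  have : KS 0 = 𝓕 (UcS : ℝ → ℂ) 0 := by rw [KS, SchwartzMap.fourier_coe]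
  rw [this, fourier_eC]
  simp only [mul_zero, neg_zero, eC_zero, one_mul, UcS_apply]
  rw [integral_complex_ofReal, U_int]; simp

lemma KS_inv (t : ℝ) : ∫ v : ℝ, eC (v * t) * KS v = ((uFn |t| : ℝ) : ℂ) := by
  rw [← fourierInv_eC, ← SchwartzMap.fourierInv_coe, KS, FourierTransform.fourierInv_fourier_eq, UcS_apply]

lemma KS_bdd : ∃ C, 0 ≤ C ∧ ∀ x, ‖KS x‖ ≤ C := by
  obtain ⟨C, hC⟩ := KS.decay 0 0
  exact ⟨C, hC.1.le, fun x => by simpa using hC.2 x⟩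

noncomputable def PhiE (w : (Fin 4 → ℝ) → ℝ) (e : Fin 4 → ℤ) (s : ℝ) : ℂ := ∫ θ : ℝ, KS (s * θ) * pH w e θ

lemma PhiE_zero (w : (Fin 4 → ℝ) → ℝ) (e : Fin 4 → ℤ) : PhiE w e 0 = 2 * sigmaInfW w e := by
  unfold PhiE
  simp only [zero_mul, KS_zero]
  rw [integral_const_mul]; rfl

lemma PhiE_cont {w : (Fin 4 → ℝ) → ℝ} (hw : Wt w) (e : Fin 4 → ℤ) (he : ∀ i, e i = 1 ∨ e i = -1) :
    Continuous (PhiE w e) := by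
  obtain ⟨C, hC, h⟩ := KS_bdd
  have hp := pH_integrable hw e he
  refine continuous_of_dominated (bound := fun θ => C * ‖pH w e θ‖) (fun s => ?_) (fun s => ae_of_all _ fun x => ?_)
    (hp.norm.const_mul _) (ae_of_all _ fun x => ?_)
  · exact ((KS.continuous.comp (by fun_prop)).mul (pH_cont hw e)).aestronglyMeasurable
  · rw [norm_mul]; gcongr; exact h _
  · exact (KS.continuous.comp (by fun_prop)).mul continuous_const

lemma PhiE_eq {w : (Fin 4 → ℝ) → ℝ} (hw : Wt w) (e : Fin 4 → ℤ) (s : ℝ) (hs : s ≠ 0) :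
    PhiE w e s = ∫ x, ((|s|⁻¹ * (w x * uFn (|Gquad e x| / |s|)) : ℝ) : ℂ) := by
  unfold PhiE pH
  have hK : Integrable (fun θ => KS (s * θ)) := KS.integrable.comp_mul_left' hs
  have hwc : Integrable (fun x => (w x : ℂ)) := hw.integrable.ofReal
  have hi : Integrable (fun p : ℝ × (Fin 4 → ℝ) => KS (s * p.1) * ((w p.2 : ℂ) * eC (-(p.1 * Gquad e p.2))))
      (volume.prod volume) := by
    have h1 := hK.mul_prod hwc
    have h2 : Continuous (fun p : ℝ × (Fin 4 → ℝ) => eC (-(p.1 * Gquad e p.2))) := by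
      have := Gq_cont e
      exact eC_cont.comp (by fun_prop)
    have h3 := h1.mul_bdd (c := 1) h2.aestronglyMeasurable (ae_of_all _ fun p => (eC_norm _).le)
    refine h3.congr (ae_of_all _ fun p => ?_)
    simp only; ring
  calc ∫ θ : ℝ, KS (s * θ) * ∫ x, (w x : ℂ) * eC (-(θ * Gquad e x))
      = ∫ θ : ℝ, ∫ x, KS (s * θ) * ((w x : ℂ) * eC (-(θ * Gquad e x))) := by
        refine integral_congr_ae (ae_of_all _ fun θ => ?_)
        simp only; rw [integral_const_mul]
    _ = ∫ x, ∫ θ : ℝ, KS (s * θ) * ((w x : ℂ) * eC (-(θ * Gquad e x))) := integral_integral_swap hi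
    _ = _ := by
        refine integral_congr_ae (ae_of_all _ fun x => ?_)
        simp only
        have h4 : ∀ θ : ℝ, KS (s * θ) * ((w x : ℂ) * eC (-(θ * Gquad e x))) =
            (fun φ : ℝ => (w x : ℂ) * (eC (φ * (-(Gquad e x) / s)) * KS φ)) (s * θ) := fun θ => by
          have : (s * θ) * (-(Gquad e x) / s) = -(θ * Gquad e x) := by field_simp
          simp only [this]; ring
        rw [integral_congr_ae (ae_of_all _ h4),
          Measure.integral_comp_mul_left (fun φ : ℝ => (w x : ℂ) * (eC (φ * (-(Gquad e x) / s)) * KS φ)) s, integral_const_mul, KS_inv, abs_div, abs_neg, abs_inv]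
        simp only [Complex.real_smul]; push_cast; ring

lemma PhiE_even {w : (Fin 4 → ℝ) → ℝ} (hw : Wt w) (e : Fin 4 → ℤ) (s : ℝ) :
    PhiE w e (-s) = PhiE w e s := by
  rcases eq_or_ne s 0 with rfl | hs
  · simp
  · rw [PhiE_eq hw e s hs, PhiE_eq hw e (-s) (neg_ne_zero.2 hs), abs_neg]

lemma Wt.G_le {w : (Fin 4 → ℝ) → ℝ} (hw : Wt w) (e : Fin 4 → ℤ) (he : ∀ i, e i = 1 ∨ e i = -1) (x : Fin 4 → ℝ)
    (h : w x ≠ 0) : |Gquad e x| ≤ 25 / 4 := by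
  have hx : ‖x‖ ≤ 5 / 4 := by
    by_contra hh; exact h (hw.supp x (not_le.1 hh))
  have hi : ∀ i, |(e i : ℝ) * x i ^ 2| ≤ 25 / 16 := fun i => by
    have h1 : |(e i : ℝ)| = 1 := by rcases he i with h | h <;> simp [h]
    have h2 : |x i| ≤ 5 / 4 := (norm_le_pi_norm x i).trans hx
    rw [abs_mul, h1, one_mul, abs_pow]
    calc |x i| ^ 2 ≤ (5 / 4) ^ 2 := by gcongr
      _ = _ := by norm_num
  unfold Gquad
  calc _ ≤ ∑ i, |(e i : ℝ) * x i ^ 2| := Finset.abs_sum_le_sum_abs _ _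
    _ ≤ ∑ i : Fin 4, (25 / 16 : ℝ) := Finset.sum_le_sum fun i _ => hi i
    _ = _ := by simp; norm_num

lemma Wt.u_out {w : (Fin 4 → ℝ) → ℝ} (hw : Wt w) (e : Fin 4 → ℤ) (he : ∀ i, e i = 1 ∨ e i = -1) (x : Fin 4 → ℝ)
    (s : ℝ) (hs : 13 ≤ s) : w x * uFn (|Gquad e x| / s) = 0 := by
  by_cases h : w x = 0
  · rw [h, zero_mul]
  · rw [uFn_out, mul_zero]; left
    rw [div_le_iff₀ (by linarith)]
    linarith [hw.G_le e he x h]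

lemma PhiE_out {w : (Fin 4 → ℝ) → ℝ} (hw : Wt w) (e : Fin 4 → ℤ) (he : ∀ i, e i = 1 ∨ e i = -1) (s : ℝ)
    (hs : 13 ≤ |s|) : PhiE w e s = 0 := by
  rw [PhiE_eq hw e s (by rintro rfl; norm_num at hs)]
  simp [hw.u_out e he _ _ hs]

end Phi

section Poi
open scoped FourierTransform SchwartzMap

lemma G_null (e : Fin 4 → ℤ) (he : ∀ i, e i = 1 ∨ e i = -1) : ∀ᵐ x : Fin 4 → ℝ, Gquad e x ≠ 0 := by
  have hm := (volume_preserving_piFinSuccAbove (fun _ : Fin 4 => ℝ) 0).symm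
  have hS : MeasurableSet {x : Fin 4 → ℝ | Gquad e x = 0} := (isClosed_eq (Gq_cont e) continuous_const).measurableSet
  refine (measure_eq_zero_iff_ae_notMem (s := {x : Fin 4 → ℝ | Gquad e x = 0})).1 ?_
  rw [← hm.measure_preimage hS.nullMeasurableSet,
    Measure.volume_eq_prod, Measure.prod_apply_symm (hm.measurable hS), lintegral_eq_zero_iff' ?_]
  · refine ae_of_all _ fun y => ?_
    simp only [Pi.zero_apply]
    set c : ℝ := ∑ i : Fin 3, (e i.succ : ℝ) * y i ^ 2 with hc
    have hsub : (fun x => (x, y)) ⁻¹' ((MeasurableEquiv.piFinSuccAbove (fun _ : Fin 4 => ℝ) 0).symm ⁻¹' {x | Gquad e x = 0})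
        ⊆ {Real.sqrt |c|, -Real.sqrt |c|} := by
      intro x hx
      have hx : Gquad e (Fin.cons x y) = 0 := by
        have : (MeasurableEquiv.piFinSuccAbove (fun _ : Fin 4 => ℝ) 0).symm (x, y) = Fin.cons x y := by
          ext i; simp [MeasurableEquiv.piFinSuccAbove]
        rw [← this]; exact hx
      unfold Gquad at hx
      rw [Fin.sum_univ_succ] at hx
      simp only [Fin.cons_zero, Fin.cons_succ] at hx
      rw [← hc] at hx
      have h2 : x ^ 2 = |c| := by
        have h0 := sq_nonneg x
        rcases he 0 with h | h <;> rw [h] at hx <;> push_cast at hx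
        · rw [abs_of_nonpos (by linarith)]; linarith
        · rw [abs_of_nonneg (by linarith)]; linarith
      have h3 : x ^ 2 = Real.sqrt |c| ^ 2 := by rw [Real.sq_sqrt (abs_nonneg _), h2]
      rcases sq_eq_sq_iff_eq_or_eq_neg.1 h3 with h | h <;> simp [h]
    exact measure_mono_null hsub ((Set.toFinite _).measure_zero _)
  · exact (measurable_measure_prodMk_right (hm.measurable hS)).aemeasurable

lemma uFn_bdd : ∃ C, 0 ≤ C ∧ ∀ t, uFn t ≤ C := by
  obtain ⟨C, h⟩ := uFn_smooth.continuous.bounded_above_of_compact_support uFn_supp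
  refine ⟨C, (norm_nonneg _).trans (h 0), fun t => (le_abs_self _).trans (h t)⟩

lemma PhiE_supp {w : (Fin 4 → ℝ) → ℝ} (hw : Wt w) (e : Fin 4 → ℤ) (he : ∀ i, e i = 1 ∨ e i = -1) :
    HasCompactSupport (PhiE w e) := by
  refine HasCompactSupport.intro (isCompact_Icc (a := (-13 : ℝ)) (b := 13)) fun s hs => PhiE_out hw e he s ?_
  by_contra h
  exact hs (abs_le.1 (not_le.1 h).le)

lemma PhiE_integrable {w : (Fin 4 → ℝ) → ℝ} (hw : Wt w) (e : Fin 4 → ℤ) (he : ∀ i, e i = 1 ∨ e i = -1) :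
    Integrable (PhiE w e) := (PhiE_cont hw e he).integrable_of_hasCompactSupport (PhiE_supp hw e he)

lemma kE_integrable : Integrable kE := kE_smooth.continuous.integrable_of_hasCompactSupport kE_supp

lemma ne0_ae : ∀ᵐ s : ℝ, s ≠ 0 := by
  have : volume ({0} : Set ℝ) = 0 := measure_singleton 0
  rw [measure_eq_zero_iff_ae_notMem] at this
  simpa using this

lemma gE_integrable {w : (Fin 4 → ℝ) → ℝ} (hw : Wt w) (e : Fin 4 → ℤ) (he : ∀ i, e i = 1 ∨ e i = -1) :
    Integrable (fun p : ℝ × (Fin 4 → ℝ) => |p.1|⁻¹ * (w p.2 * uFn (|Gquad e p.2| / |p.1|))) (volume.prod volume) := by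
  have hwm := hw.meas
  have hum := uFn_smooth.continuous.measurable
  have hGm := (Gq_cont e).measurable
  have hmeas : Measurable (fun p : ℝ × (Fin 4 → ℝ) => |p.1|⁻¹ * (w p.2 * uFn (|Gquad e p.2| / |p.1|))) := by
    fun_prop
  rw [integrable_prod_iff hmeas.aestronglyMeasurable]
  constructor
  · obtain ⟨C, hC, h⟩ := uFn_bdd
    refine ae_of_all _ fun s => ?_
    show Integrable (fun x => |s|⁻¹ * (w x * uFn (|Gquad e x| / |s|)))
    refine Integrable.const_mul (f := fun x => w x * uFn (|Gquad e x| / |s|)) ?_ _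
    refine hw.integrable.mul_bdd (c := C) ?_ (ae_of_all _ fun x => ?_)
    · exact (by fun_prop : Measurable fun x => uFn (|Gquad e x| / |s|)).aestronglyMeasurable
    · rw [Real.norm_of_nonneg (uFn_nonneg _)]; exact h _
  · refine (PhiE_integrable hw e he).norm.congr ?_
    filter_upwards [ne0_ae] with s hs
    rw [PhiE_eq hw e s hs, integral_complex_ofReal, Complex.norm_real, Real.norm_of_nonneg]
    · refine integral_congr_ae (ae_of_all _ fun x => ?_)
      simp only
      rw [Real.norm_of_nonneg]
      have := hw.nn x; have := uFn_nonneg (|Gquad e x| / |s|)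
      positivity
    · refine integral_nonneg fun x => ?_
      have := hw.nn x; have := uFn_nonneg (|Gquad e x| / |s|)
      simp only [Pi.zero_apply]
      positivity

lemma PhiE_fourier {w : (Fin 4 → ℝ) → ℝ} (hw : Wt w) (e : Fin 4 → ℤ) (he : ∀ i, e i = 1 ∨ e i = -1) (ξ : ℝ) :
    𝓕 (PhiE w e) ξ = ∫ t : ℝ, (kE t : ℂ) * pH w e (t * ξ) := by
  have hG := Gq_cont e
  have hi : Integrable (fun p : ℝ × (Fin 4 → ℝ) =>
      eC (-(p.1 * ξ)) * ((|p.1|⁻¹ * (w p.2 * uFn (|Gquad e p.2| / |p.1|)) : ℝ) : ℂ)) (volume.prod volume) := by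
    refine (gE_integrable hw e he).ofReal.bdd_mul (c := 1) ?_ (ae_of_all _ fun p => (eC_norm _).le)
    exact (eC_cont.comp (by fun_prop)).aestronglyMeasurable
  have hi2 : Integrable (fun p : ℝ × (Fin 4 → ℝ) =>
      (kE p.1 : ℂ) * ((w p.2 : ℂ) * eC (-((p.1 * ξ) * Gquad e p.2)))) (volume.prod volume) := by
    have h1 := (kE_integrable.ofReal (𝕜 := ℂ)).mul_prod (hw.integrable.ofReal (𝕜 := ℂ))
    have h2 : Continuous (fun p : ℝ × (Fin 4 → ℝ) => eC (-((p.1 * ξ) * Gquad e p.2))) := 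
      eC_cont.comp (by fun_prop)
    have h3 := h1.mul_bdd (c := 1) h2.aestronglyMeasurable (ae_of_all _ fun p => (eC_norm _).le)
    refine h3.congr (ae_of_all _ fun p => ?_)
    simp only [mul_assoc]; rfl
  calc 𝓕 (PhiE w e) ξ = ∫ s : ℝ, ∫ x, eC (-(s * ξ)) * ((|s|⁻¹ * (w x * uFn (|Gquad e x| / |s|)) : ℝ) : ℂ) := by
        rw [fourier_eC]
        refine integral_congr_ae ?_
        filter_upwards [ne0_ae] with s hs
        rw [integral_const_mul, PhiE_eq hw e s hs]
    _ = ∫ x, ∫ s : ℝ, eC (-(s * ξ)) * ((|s|⁻¹ * (w x * uFn (|Gquad e x| / |s|)) : ℝ) : ℂ) := integral_integral_swap hi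
    _ = ∫ x, ∫ t : ℝ, (kE t : ℂ) * ((w x : ℂ) * eC (-((t * ξ) * Gquad e x))) := by
        refine integral_congr_ae ?_
        filter_upwards [G_null e he] with x hx
        set y := Gquad e x with hy
        have hy0 : |y| ≠ 0 := abs_ne_zero.2 hx
        have h1 := Measure.integral_comp_mul_left
          (fun s : ℝ => eC (-(s * ξ)) * ((|s|⁻¹ * (w x * uFn (|y| / |s|)) : ℝ) : ℂ)) y
        have h2 : ∫ s : ℝ, eC (-(s * ξ)) * ((|s|⁻¹ * (w x * uFn (|y| / |s|)) : ℝ) : ℂ) =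
            ((|y| : ℝ) : ℂ) * ∫ t : ℝ, eC (-((y * t) * ξ)) * ((|y * t|⁻¹ * (w x * uFn (|y| / |y * t|)) : ℝ) : ℂ) := by
          rw [h1, abs_inv, Complex.real_smul, Complex.ofReal_inv, ← mul_assoc, mul_inv_cancel₀, one_mul]
          exact_mod_cast hy0
        rw [h2, ← integral_const_mul]
        refine integral_congr_ae (ae_of_all _ fun t => ?_)
        have h3 : |y| / |y * t| = 1 / |t| := by
          rw [abs_mul, div_mul_eq_div_div, div_self hy0]
        have h4 : -((y * t) * ξ) = -((t * ξ) * y) := by ring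
        simp only [h3, h4]
        rw [abs_mul, kE]
        push_cast
        have : ((|y| : ℝ) : ℂ) ≠ 0 := by exact_mod_cast hy0
        field_simp
    _ = ∫ t : ℝ, ∫ x, (kE t : ℂ) * ((w x : ℂ) * eC (-((t * ξ) * Gquad e x))) := (integral_integral_swap hi2).symm
    _ = _ := by
        refine integral_congr_ae (ae_of_all _ fun t => ?_)
        simp only
        rw [integral_const_mul]; rfl

end Poi

section Poi2
open scoped FourierTransform SchwartzMap

noncomputable def phS : 𝓢(ℝ, ℂ) :=
  HasCompactSupport.toSchwartzMap (f := fun s => ((phE s : ℝ) : ℂ))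
    (phE_supp.comp_left (g := fun x : ℝ => (x : ℂ)) (by simp))
    (Complex.ofRealCLM.contDiff.comp phE_smooth)

lemma phS_apply (s : ℝ) : phS s = ((phE s : ℝ) : ℂ) := rfl

noncomputable def phF : 𝓢(ℝ, ℂ) := 𝓕 phS

lemma phE_int : ∫ s, phE s = ∫ s, kE s := by
  have h1 : ∫ s, phE s = 2 * ∫ s in Set.Ioi (0 : ℝ), uFn s / s := integral_comp_abs (f := fun s => uFn s / s)
  have h2 : ∫ s, kE s = 2 * ∫ s in Set.Ioi (0 : ℝ), uFn (1 / s) / s := integral_comp_abs (f := fun s => uFn (1 / s) / s)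
  rw [h1, h2, ← integral_comp_rpow_Ioi (fun s => uFn s / s) (p := -1) (by norm_num)]
  congr 1
  refine setIntegral_congr_fun measurableSet_Ioi fun x hx => ?_
  have hx : 0 < x := hx
  simp only [smul_eq_mul, abs_neg, abs_one, one_mul]
  rw [show (-1 - 1 : ℝ) = -(2 : ℕ) by norm_num, Real.rpow_neg hx.le, Real.rpow_natCast, Real.rpow_neg_one, one_div]
  field_simp

noncomputable def fE (w : (Fin 4 → ℝ) → ℝ) (e : Fin 4 → ℤ) (s : ℝ) : ℂ := pH w e 0 * phS s - PhiE w e s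

lemma fE_fourier {w : (Fin 4 → ℝ) → ℝ} (hw : Wt w) (e : Fin 4 → ℤ) (he : ∀ i, e i = 1 ∨ e i = -1) (ξ : ℝ) :
    𝓕 (fE w e) ξ = pH w e 0 * phF ξ - ∫ t : ℝ, (kE t : ℂ) * pH w e (t * ξ) := by
  have h1 : phF ξ = 𝓕 (phS : ℝ → ℂ) ξ := by rw [phF, SchwartzMap.fourier_coe]
  rw [← PhiE_fourier hw e he, h1, fourier_eC, fourier_eC, fourier_eC, ← integral_const_mul, ← integral_sub]
  · refine integral_congr_ae (ae_of_all _ fun v => ?_)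
    simp only [fE]; ring
  · refine Integrable.const_mul (phS.integrable.bdd_mul (c := 1) ?_ (ae_of_all _ fun p => (eC_norm _).le)) _
    exact (eC_cont.comp (by fun_prop)).aestronglyMeasurable
  · refine (PhiE_integrable hw e he).bdd_mul (c := 1) ?_ (ae_of_all _ fun p => (eC_norm _).le)
    exact (eC_cont.comp (by fun_prop)).aestronglyMeasurable

lemma fE_fourier_zero {w : (Fin 4 → ℝ) → ℝ} (hw : Wt w) (e : Fin 4 → ℤ) (he : ∀ i, e i = 1 ∨ e i = -1) :
    𝓕 (fE w e) 0 = 0 := by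
  have h1 : phF 0 = 𝓕 (phS : ℝ → ℂ) 0 := by rw [phF, SchwartzMap.fourier_coe]
  rw [fE_fourier hw e he, h1, fourier_eC]
  simp only [mul_zero, neg_zero, eC_zero, one_mul, phS_apply]
  rw [integral_mul_const, integral_complex_ofReal, integral_complex_ofReal, phE_int]
  ring

lemma fE_fourier_bound : ∃ C : ℝ, 0 ≤ C ∧ ∀ {w : (Fin 4 → ℝ) → ℝ} (hw : Wt w) (e : Fin 4 → ℤ)
    (he : ∀ i, e i = 1 ∨ e i = -1) (ξ : ℝ), ‖𝓕 (fE w e) ξ‖ ≤ C / ξ ^ 2 := by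
  obtain ⟨C, hC0, hC⟩ := phF.decay 2 0
  have hk : 0 ≤ ∫ s, kE s := integral_nonneg kE_nonneg
  refine ⟨1200 * C + 1200 * ∫ s, kE s, by positivity, fun {w} hw e he ξ => ?_⟩
  rcases eq_or_ne ξ 0 with rfl | hξ
  · rw [fE_fourier_zero hw e he]; simp
  have hξ2 : 0 < ξ ^ 2 := by positivity
  rw [fE_fourier hw e he]
  have h1 : ‖phF ξ‖ ≤ C / ξ ^ 2 := by
    have := hC ξ
    simp only [norm_iteratedFDeriv_zero, Real.norm_eq_abs, sq_abs] at this
    rw [le_div_iff₀ hξ2]; linarith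
  have h0 : ‖pH w e 0‖ ≤ 1200 := by simpa using pH_bound hw e he 0
  have h2 : ‖∫ t : ℝ, (kE t : ℂ) * pH w e (t * ξ)‖ ≤ ∫ t, kE t * (1200 / ξ ^ 2) := by
    refine norm_integral_le_of_norm_le (kE_integrable.mul_const _) (ae_of_all _ fun t => ?_)
    rw [norm_mul, Complex.norm_real, Real.norm_of_nonneg (kE_nonneg t)]
    rcases le_or_gt |t| 1 with h | h
    · rw [kE_out t (Or.inl h)]; simp
    · refine mul_le_mul_of_nonneg_left ((pH_bound hw e he _).trans ?_) (kE_nonneg t)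
      have : 1 ≤ t ^ 2 := by rw [one_le_sq_iff_one_le_abs]; exact h.le
      gcongr
      nlinarith
  rw [integral_mul_const] at h2
  calc _ ≤ ‖pH w e 0 * phF ξ‖ + ‖∫ t : ℝ, (kE t : ℂ) * pH w e (t * ξ)‖ := norm_sub_le _ _
    _ ≤ 1200 * (C / ξ ^ 2) + (∫ t, kE t) * (1200 / ξ ^ 2) := by rw [norm_mul]; gcongr
    _ = _ := by ring

noncomputable def Istar (w : (Fin 4 → ℝ) → ℝ) (e : Fin 4 → ℤ) (r : ℝ) : ℂ :=
  ∫ x, (w x : ℂ) * (hFn r (Gquad e x) : ℂ)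

lemma pH_zero (w : (Fin 4 → ℝ) → ℝ) (e : Fin 4 → ℤ) : pH w e 0 = ∫ x, (w x : ℂ) := by
  unfold pH; simp [eC_zero]

lemma fE_out {w : (Fin 4 → ℝ) → ℝ} (hw : Wt w) (e : Fin 4 → ℤ) (he : ∀ i, e i = 1 ∨ e i = -1) (s : ℝ)
    (hs : 13 ≤ |s|) : fE w e s = 0 := by
  unfold fE
  rw [PhiE_out hw e he s hs, phS_apply, phE, uFn_out |s| (Or.inr (by linarith))]; simp

lemma fE_cont {w : (Fin 4 → ℝ) → ℝ} (hw : Wt w) (e : Fin 4 → ℤ) (he : ∀ i, e i = 1 ∨ e i = -1) :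
    Continuous (fE w e) := (continuous_const.mul phS.continuous).sub (PhiE_cont hw e he)

lemma fE_even {w : (Fin 4 → ℝ) → ℝ} (hw : Wt w) (e : Fin 4 → ℤ) (s : ℝ) : fE w e (-s) = fE w e s := by
  unfold fE
  rw [PhiE_even hw, phS_apply, phS_apply, phE, abs_neg]; rfl

lemma fE_zero (w : (Fin 4 → ℝ) → ℝ) (e : Fin 4 → ℤ) : fE w e 0 = -(2 * sigmaInfW w e) := by
  unfold fE
  rw [PhiE_zero, phS_apply, phE]; simp

lemma fE_pos {w : (Fin 4 → ℝ) → ℝ} (hw : Wt w) (e : Fin 4 → ℤ) (s : ℝ) (hs : 0 < s) :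
    fE w e s = ∫ x, (w x : ℂ) * ((s⁻¹ * (uFn s - uFn (|Gquad e x| / s)) : ℝ) : ℂ) := by
  obtain ⟨C, hC, h⟩ := uFn_bdd
  have hGm := (Gq_cont e).measurable
  have hum := uFn_smooth.continuous.measurable
  unfold fE
  rw [PhiE_eq hw e s hs.ne', pH_zero, ← integral_mul_const, ← integral_sub]
  · refine integral_congr_ae (ae_of_all _ fun x => ?_)
    simp only
    rw [phS_apply, phE, abs_of_pos hs]; push_cast; ring
  · exact (hw.integrable.ofReal).mul_const _
  · refine Integrable.ofReal (Integrable.const_mul (hw.integrable.mul_bdd (c := C) ?_ (ae_of_all _ fun x => ?_)) _)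
    · exact (by fun_prop : Measurable fun x => uFn (|Gquad e x| / |s|)).aestronglyMeasurable
    · rw [Real.norm_of_nonneg (uFn_nonneg _)]; exact h _

lemma fE_pos_int {w : (Fin 4 → ℝ) → ℝ} (hw : Wt w) (e : Fin 4 → ℤ) (s : ℝ) :
    Integrable fun x => (w x : ℂ) * ((s⁻¹ * (uFn s - uFn (|Gquad e x| / s)) : ℝ) : ℂ) := by
  obtain ⟨C, hC, h⟩ := uFn_bdd
  have hGm := (Gq_cont e).measurable
  have hum := uFn_smooth.continuous.measurable
  refine (hw.integrable.ofReal).mul_bdd (c := |s⁻¹| * C) ?_ (ae_of_all _ fun x => ?_)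
  · exact (by fun_prop : Measurable fun x => (((s⁻¹ * (uFn s - uFn (|Gquad e x| / s)) : ℝ) : ℂ))).aestronglyMeasurable
  · rw [Complex.norm_real, Real.norm_eq_abs, abs_mul]
    gcongr
    have h1 := h s; have h2 := h (|Gquad e x| / s)
    have h3 := uFn_nonneg s; have h4 := uFn_nonneg (|Gquad e x| / s)
    rw [abs_le]; constructor <;> linarith

lemma Istar_eq {w : (Fin 4 → ℝ) → ℝ} (hw : Wt w) (e : Fin 4 → ℤ) (he : ∀ i, e i = 1 ∨ e i = -1) (r : ℝ) (hr : 0 < r)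
    (N : ℕ) (hN : 13 ≤ r * (N + 1)) : Istar w e r = ∑ j ∈ Finset.range N, fE w e (r * (j + 1)) := by
  have h1 : ∀ j : ℕ, fE w e (r * (j + 1)) = ∫ x, (w x : ℂ) * (((r * (j + 1))⁻¹ * (uFn (r * (j + 1)) - uFn (|Gquad e x| / (r * (j + 1)))) : ℝ) : ℂ) :=
    fun j => fE_pos hw e _ (by positivity)
  simp_rw [h1]
  rw [← integral_finset_sum _ fun j _ => fE_pos_int hw e _]
  unfold Istar
  refine integral_congr_ae (ae_of_all _ fun x => ?_)
  simp only
  by_cases hx : w x = 0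
  · simp [hx]
  rw [← Finset.mul_sum, ← Complex.ofReal_sum, hFn, tsum_eq_sum]
  intro j hj
  have hj : N ≤ j := by simpa using hj
  have h13 : 13 ≤ r * ((j : ℝ) + 1) := hN.trans (by gcongr)
  have := hw.u_out e he x _ h13
  rw [(mul_eq_zero.1 this).resolve_left hx, uFn_out _ (Or.inr (by linarith))]; simp

lemma Istar_out {w : (Fin 4 → ℝ) → ℝ} (hw : Wt w) (e : Fin 4 → ℤ) (he : ∀ i, e i = 1 ∨ e i = -1) (r : ℝ)
    (hr : 13 ≤ r) : Istar w e r = 0 := by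
  rw [Istar_eq hw e he r (by linarith) 0 (by simpa using hr)]; simp

/-- Poisson terms -/
noncomputable def Etm (w : (Fin 4 → ℝ) → ℝ) (e : Fin 4 → ℤ) (r : ℝ) (m : ℤ) : ℂ := (r⁻¹ : ℂ) * 𝓕 (fE w e) (m / r)

lemma Etm_bound : ∃ C : ℝ, 0 ≤ C ∧ ∀ {w : (Fin 4 → ℝ) → ℝ} (hw : Wt w) (e : Fin 4 → ℤ)
    (he : ∀ i, e i = 1 ∨ e i = -1) (r : ℝ) (hr : 0 < r) (m : ℤ), ‖Etm w e r m‖ ≤ C * r * (1 / (m : ℝ) ^ 2) := by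
  obtain ⟨C, hC, h⟩ := fE_fourier_bound
  refine ⟨C, hC, fun {w} hw e he r hr m => ?_⟩
  unfold Etm
  rw [norm_mul, norm_inv, Complex.norm_real, Real.norm_of_nonneg hr.le]
  calc _ ≤ r⁻¹ * (C / (m / r) ^ 2) := by gcongr; exact h hw e he _
    _ = _ := by field_simp

lemma sum_m2 : HasSum (fun m : ℤ => 1 / (m : ℝ) ^ 2) (∑' m : ℤ, 1 / (m : ℝ) ^ 2) :=
  (Real.summable_one_div_int_pow.2 (by norm_num)).hasSum

lemma Etm_summable {w : (Fin 4 → ℝ) → ℝ} (hw : Wt w) (e : Fin 4 → ℤ) (he : ∀ i, e i = 1 ∨ e i = -1) (r : ℝ) (hr : 0 < r) :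
    Summable (Etm w e r) := by
  obtain ⟨C, hC, h⟩ := Etm_bound
  exact Summable.of_norm_bounded (sum_m2.summable.mul_left (C * r)) (h hw e he r hr)

lemma fE_scale_fourier (w : (Fin 4 → ℝ) → ℝ) (e : Fin 4 → ℤ) (r : ℝ) (hr : 0 < r) (ξ : ℝ) :
    𝓕 (fun t => fE w e (r * t)) ξ = (r⁻¹ : ℂ) * 𝓕 (fE w e) (ξ / r) := by
  rw [fourier_eC, fourier_eC]
  have h1 := Measure.integral_comp_mul_left (fun v : ℝ => eC (-(v * (ξ / r))) * fE w e v) r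
  rw [abs_of_pos (inv_pos.2 hr), Complex.real_smul] at h1
  rw [← Complex.ofReal_inv, ← h1]
  refine integral_congr_ae (ae_of_all _ fun t => ?_)
  have : r * t * (ξ / r) = t * ξ := by field_simp
  simp only [this]

lemma Istar_poisson {w : (Fin 4 → ℝ) → ℝ} (hw : Wt w) (e : Fin 4 → ℤ) (he : ∀ i, e i = 1 ∨ e i = -1) (r : ℝ) (hr : 0 < r) :
    2 * Istar w e r = 2 * sigmaInfW w e + ∑' m : ℤ, Etm w e r m := by
  have hc : Continuous (fun t => fE w e (r * t)) := (fE_cont hw e he).comp (by fun_prop)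
  have hz : ∀ t, 13 / r ≤ |t| → fE w e (r * t) = 0 := fun t ht => by
    refine fE_out hw e he _ ?_
    rw [abs_mul, abs_of_pos hr]
    rw [div_le_iff₀ hr] at ht; linarith
  have hE : (fun n : ℤ => 𝓕 (fun t => fE w e (r * t)) n) = Etm w e r := by
    ext n; exact fE_scale_fourier w e r hr n
  have hO : (fun t => fE w e (r * t)) =O[cocompact ℝ] fun x : ℝ => |x| ^ (-2 : ℝ) := by
    have : (fun t => fE w e (r * t)) =ᶠ[cocompact ℝ] fun _ => 0 := by
      have := (isCompact_Icc (a := -(13 / r)) (b := 13 / r)).compl_mem_cocompact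
      filter_upwards [this] with t ht
      refine hz t ?_
      by_contra h
      exact ht (abs_le.1 (not_le.1 h).le)
    exact this.trans_isBigO (Asymptotics.isBigO_zero _ _)
  have hP := Real.tsum_eq_tsum_fourier_of_rpow_decay_of_summable hc (b := 2) (by norm_num) hO
    (by rw [hE]; exact Etm_summable hw e he r hr) 0
  simp only [QuotientAddGroup.mk_zero, fourier_eval_zero, mul_one, zero_add] at hP
  have hE' : ∀ n : ℤ, 𝓕 (fun t => fE w e (r * t)) n = Etm w e r n := fun n => congrFun hE n
  simp_rw [hE'] at hP
  rw [← hP]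
  obtain ⟨N, hN⟩ := exists_nat_ge (13 / r)
  have hN2 : 13 ≤ r * (N + 1) := by
    rw [div_le_iff₀ hr] at hN; nlinarith
  have hfin : (Function.support fun n : ℤ => fE w e (r * n)).Finite := by
    refine (Set.finite_Icc (-(N : ℤ)) N).subset fun n hn => ?_
    by_contra h
    refine hn (hz n (hN.trans ?_))
    have : (N : ℤ) ≤ |n| := by
      by_contra h2
      exact h (abs_le.1 (not_le.1 h2).le)
    exact_mod_cast this
  rw [tsum_int_eq_zero_add_two_mul_tsum_pnat (fun n => by push_cast; rw [mul_neg, fE_even hw]) (summable_of_hasFiniteSupport hfin)]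
  have h5 : ∑' n : ℕ+, fE w e (r * ((n : ℕ) : ℤ)) = Istar w e r := by
    rw [tsum_pnat_eq_tsum_succ (f := fun n : ℕ => fE w e (r * ((n : ℕ) : ℤ))), Istar_eq hw e he r hr N hN2, tsum_eq_sum (s := Finset.range N)]
    · refine Finset.sum_congr rfl fun j _ => by push_cast; rfl
    · intro j hj
      have hj : N ≤ j := by simpa using hj
      refine hz _ (hN.trans ?_)
      push_cast
      rw [abs_of_nonneg (by positivity)]
      have : (N : ℝ) ≤ j := by exact_mod_cast hj
      linarith
  have h6 : fE w e (r * ((0 : ℤ) : ℝ)) = -(2 * sigmaInfW w e) := by rw [Int.cast_zero, mul_zero, fE_zero]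
  rw [h5, h6]
  simp only [two_nsmul, nsmul_eq_mul]
  push_cast
  ring

lemma Istar_sigma : ∃ C : ℝ, 0 ≤ C ∧ ∀ {w : (Fin 4 → ℝ) → ℝ} (hw : Wt w) (e : Fin 4 → ℤ)
    (he : ∀ i, e i = 1 ∨ e i = -1) (r : ℝ) (hr : 0 < r), ‖Istar w e r - sigmaInfW w e‖ ≤ C * r := by
  obtain ⟨C, hC, h⟩ := Etm_bound
  have hS : 0 ≤ ∑' m : ℤ, 1 / (m : ℝ) ^ 2 := tsum_nonneg fun m => by positivity
  refine ⟨C * ∑' m : ℤ, 1 / (m : ℝ) ^ 2, by positivity, fun {w} hw e he r hr => ?_⟩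
  have h1 := tsum_of_norm_bounded (sum_m2.mul_left (C * r)) (h hw e he r hr)
  have h2 : Istar w e r - sigmaInfW w e = (1 / 2) * ∑' m : ℤ, Etm w e r m := by
    linear_combination (1 / 2) * Istar_poisson hw e he r hr
  rw [h2, norm_mul]
  have : ‖(1 / 2 : ℂ)‖ = 1 / 2 := by norm_num
  rw [this]
  nlinarith [norm_nonneg (∑' m : ℤ, Etm w e r m)]

end Poi2

section Lip
open scoped FourierTransform SchwartzMap

lemma phF_lip : ∃ C : ℝ, 0 ≤ C ∧ ∀ (r r' : ℝ) (m : ℤ), 0 < r → r ≤ r' → m ≠ 0 →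
    ‖(r⁻¹ : ℂ) * phF (m / r) - (r'⁻¹ : ℂ) * phF (m / r')‖ ≤ C * (r' - r) * (1 / (m : ℝ) ^ 2) := by
  obtain ⟨C1, hC1, h1⟩ := phF.decay 2 0
  obtain ⟨C2, hC2, h2⟩ := phF.decay 3 1
  refine ⟨C1 + C2, by positivity, fun r r' m hr hrr hm => ?_⟩
  have hm' : (m : ℝ) ≠ 0 := by exact_mod_cast hm
  have hd : ∀ ρ ∈ Set.Icc r r', HasDerivWithinAt (fun ρ : ℝ => (ρ⁻¹ : ℂ) * phF (m / ρ))
      ((((-(ρ ^ 2)⁻¹ : ℝ)) : ℂ) * phF (m / ρ) + (ρ⁻¹ : ℂ) * (((m : ℝ) * (-(ρ ^ 2)⁻¹)) • deriv phF (m / ρ))) (Set.Icc r r') ρ := by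
    intro ρ hρ
    have hρ0 : ρ ≠ 0 := by have := hρ.1; linarith
    have a1 : HasDerivAt (fun ρ : ℝ => ρ⁻¹) (-(ρ ^ 2)⁻¹) ρ := hasDerivAt_inv hρ0
    have a2 : HasDerivAt (fun ρ : ℝ => (ρ⁻¹ : ℂ)) ((-(ρ ^ 2)⁻¹ : ℝ) : ℂ) ρ := by
      have := a1.ofReal_comp
      refine this.congr_of_eventuallyEq (Eventually.of_forall fun x => ?_)
      simp
    have a3 : HasDerivAt (fun ρ : ℝ => (m : ℝ) / ρ) ((m : ℝ) * (-(ρ ^ 2)⁻¹)) ρ := by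
      simpa [div_eq_mul_inv] using a1.const_mul (m : ℝ)
    have a4 : HasDerivAt (phF : ℝ → ℂ) (deriv phF ((m : ℝ) / ρ)) ((m : ℝ) / ρ) := phF.differentiableAt.hasDerivAt
    have a5 := HasDerivAt.scomp ρ a4 a3
    exact (a2.mul a5).hasDerivWithinAt
  have hb : ∀ ρ ∈ Set.Icc r r', ‖((((-(ρ ^ 2)⁻¹ : ℝ)) : ℂ) * phF (m / ρ) + (ρ⁻¹ : ℂ) * (((m : ℝ) * (-(ρ ^ 2)⁻¹)) • deriv phF (m / ρ)))‖
      ≤ (C1 + C2) * (1 / (m : ℝ) ^ 2) := by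
    intro ρ hρ
    have hρ0 : 0 < ρ := by have := hρ.1; linarith
    have b1 := h1 ((m : ℝ) / ρ)
    have b2 := h2 ((m : ℝ) / ρ)
    rw [norm_iteratedFDeriv_eq_norm_iteratedDeriv, iteratedDeriv_one] at b2
    simp only [norm_iteratedFDeriv_zero] at b1
    rw [Real.norm_eq_abs, abs_div, abs_of_pos hρ0] at b1 b2
    have hma : 0 < |(m : ℝ)| := abs_pos.2 hm'
    rw [← sq_abs (m : ℝ)]
    refine (norm_add_le _ _).trans ?_
    rw [norm_mul, norm_mul, norm_smul, norm_inv, Complex.norm_real, Complex.norm_real, Real.norm_eq_abs, Real.norm_eq_abs,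
      Real.norm_eq_abs, abs_mul, abs_neg, abs_of_pos hρ0, abs_of_pos (by positivity : 0 < (ρ ^ 2)⁻¹)]
    have c1 : (ρ ^ 2)⁻¹ * ‖phF ((m : ℝ) / ρ)‖ ≤ C1 * (1 / |(m : ℝ)| ^ 2) := by
      rw [mul_one_div, le_div_iff₀ (by positivity)]
      refine le_trans (le_of_eq ?_) b1
      field_simp
    have c2 : ρ⁻¹ * (|(m : ℝ)| * (ρ ^ 2)⁻¹ * ‖deriv phF ((m : ℝ) / ρ)‖) ≤ C2 * (1 / |(m : ℝ)| ^ 2) := by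
      rw [mul_one_div, le_div_iff₀ (by positivity)]
      refine le_trans (le_of_eq ?_) b2
      field_simp
    linarith
  have := Convex.norm_image_sub_le_of_norm_hasDerivWithin_le hd hb (convex_Icc r r') (Set.right_mem_Icc.2 hrr) (Set.left_mem_Icc.2 hrr)
  refine this.trans (le_of_eq ?_)
  rw [Real.norm_eq_abs, abs_sub_comm, abs_of_nonneg (by linarith)]
  ring

lemma kE_scale (w : (Fin 4 → ℝ) → ℝ) (e : Fin 4 → ℤ) (r : ℝ) (hr : 0 < r) (m : ℤ) (hm : m ≠ 0) :
    (r⁻¹ : ℂ) * ∫ t : ℝ, (kE t : ℂ) * pH w e (t * (m / r)) =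
      ((|(m : ℝ)|⁻¹ : ℝ) : ℂ) * ∫ θ : ℝ, (kE (r / m * θ) : ℂ) * pH w e θ := by
  have hm' : (m : ℝ) ≠ 0 := by exact_mod_cast hm
  have h1 := Measure.integral_comp_mul_left (fun t : ℝ => (kE t : ℂ) * pH w e (t * (m / r))) (r / m)
  have h2 : ∀ θ : ℝ, r / m * θ * (m / r) = θ := fun θ => by field_simp
  simp only [h2] at h1
  rw [h1, Complex.real_smul, ← mul_assoc, ← Complex.ofReal_mul, ← Complex.ofReal_inv]
  congr 2
  rw [inv_div, abs_div, abs_of_pos hr]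
  have : |(m : ℝ)| ≠ 0 := abs_ne_zero.2 hm'
  field_simp

lemma kE_int_lip : ∃ C : ℝ, 0 ≤ C ∧ ∀ {w : (Fin 4 → ℝ) → ℝ} (hw : Wt w) (e : Fin 4 → ℤ)
    (he : ∀ i, e i = 1 ∨ e i = -1) (r r' : ℝ) (m : ℤ), 0 < r → r ≤ r' → r' ≤ 2 * r → m ≠ 0 →
    ‖(∫ θ : ℝ, (kE (r / m * θ) : ℂ) * pH w e θ) - ∫ θ : ℝ, (kE (r' / m * θ) : ℂ) * pH w e θ‖ ≤ C * (r' - r) * (1 / |(m : ℝ)|) := by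
  obtain ⟨C, hC, hk, hl⟩ := kE_lip
  refine ⟨9600 * C, by positivity, fun {w} hw e he r r' m hr hrr hr2 hm => ?_⟩
  have hm' : (m : ℝ) ≠ 0 := by exact_mod_cast hm
  have hma : 0 < |(m : ℝ)| := abs_pos.2 hm'
  have hr'0 : 0 < r' := by linarith
  have hIntg : ∀ ρ : ℝ, Integrable (fun θ : ℝ => (kE (ρ / m * θ) : ℂ) * pH w e θ) := fun ρ => by
    refine (pH_integrable hw e he).bdd_mul (c := C) ?_ (ae_of_all _ fun θ => ?_)
    · exact (Complex.continuous_ofReal.comp (kE_smooth.continuous.comp (by fun_prop))).aestronglyMeasurable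
    · rw [Complex.norm_real, Real.norm_of_nonneg (kE_nonneg _)]; exact hk _
  rw [← integral_sub (hIntg r) (hIntg r')]
  set T := 2 * |(m : ℝ)| / r with hT
  have hT0 : 0 < T := by positivity
  have hz : ∀ θ ∉ Set.Icc (-T) T, (kE (r / m * θ) : ℂ) * pH w e θ - (kE (r' / m * θ) : ℂ) * pH w e θ = 0 := by
    intro θ hθ
    have h1 : T < |θ| := by
      by_contra h; exact hθ (abs_le.1 (not_lt.1 h))
    have h2 : 2 ≤ |r / m * θ| := by
      rw [abs_mul, abs_div, abs_of_pos hr]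
      rw [hT, div_lt_iff₀ hr] at h1
      rw [div_mul_eq_mul_div, le_div_iff₀ hma]; linarith
    have h3 : 2 ≤ |r' / m * θ| := by
      refine h2.trans ?_
      rw [abs_mul, abs_div, abs_mul, abs_div, abs_of_pos hr, abs_of_pos hr'0]
      gcongr
    rw [kE_out _ (Or.inr h2), kE_out _ (Or.inr h3)]; simp
  rw [← setIntegral_eq_integral_of_forall_compl_eq_zero hz]
  have hb : ∀ θ ∈ Set.Icc (-T) T, ‖(kE (r / m * θ) : ℂ) * pH w e θ - (kE (r' / m * θ) : ℂ) * pH w e θ‖ ≤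
      C * ((r' - r) / |(m : ℝ)|) * (1200 * (r' / |(m : ℝ)|)) := by
    intro θ _
    have hrhs : 0 ≤ C * ((r' - r) / |(m : ℝ)|) * (1200 * (r' / |(m : ℝ)|)) := by
      have : 0 ≤ r' - r := by linarith
      positivity
    rcases le_or_gt |r' / m * θ| 1 with h | h
    · have h2 : |r / m * θ| ≤ 1 := by
        refine le_trans ?_ h
        rw [abs_mul, abs_div, abs_mul, abs_div, abs_of_pos hr, abs_of_pos hr'0]
        gcongr
      rw [kE_out _ (Or.inl h2), kE_out _ (Or.inl h)]; simpa using hrhs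
    · rw [← sub_mul, norm_mul, ← Complex.ofReal_sub, Complex.norm_real, Real.norm_eq_abs]
      have h1 := hl (r / m * θ) (r' / m * θ)
      have h2 : |r / m * θ - r' / m * θ| = (r' - r) / |(m : ℝ)| * |θ| := by
        rw [← sub_mul, ← sub_div, abs_mul, abs_div, abs_sub_comm, abs_of_nonneg (by linarith : 0 ≤ r' - r)]
      rw [h2] at h1
      have hθ : |(m : ℝ)| / r' < |θ| := by
        rw [abs_mul, abs_div, abs_of_pos hr'0, div_mul_eq_mul_div, lt_div_iff₀ hma] at h
        rw [div_lt_iff₀ hr'0]; linarith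
      have hθ0 : 0 < |θ| := lt_trans (by positivity) hθ
      have hsq : 0 < θ ^ 2 := by rw [← sq_abs]; positivity
      have h3 : |θ| * ‖pH w e θ‖ ≤ 1200 * (r' / |(m : ℝ)|) := by
        calc |θ| * ‖pH w e θ‖ ≤ |θ| * (1200 / (1 + θ ^ 2)) := by gcongr; exact pH_bound hw e he θ
          _ ≤ |θ| * (1200 / |θ| ^ 2) := by rw [sq_abs]; refine mul_le_mul_of_nonneg_left (div_le_div_of_nonneg_left (by norm_num) hsq (by linarith)) hθ0.le
          _ = 1200 * |θ|⁻¹ := by field_simp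
          _ ≤ 1200 * (|(m : ℝ)| / r')⁻¹ := by gcongr
          _ = _ := by rw [inv_div]
      calc _ ≤ C * ((r' - r) / |(m : ℝ)| * |θ|) * ‖pH w e θ‖ := by gcongr
        _ = C * ((r' - r) / |(m : ℝ)|) * (|θ| * ‖pH w e θ‖) := by ring
        _ ≤ _ := by
          have : 0 ≤ r' - r := by linarith
          gcongr
  have := norm_setIntegral_le_of_norm_le_const (μ := volume) (s := Set.Icc (-T) T) (by simp) hb
  refine this.trans ?_
  have hv : volume.real (Set.Icc (-T) T) = 2 * T := by
    rw [Real.volume_real_Icc_of_le (by linarith)]; ring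
  rw [hv, hT]
  have e1 : C * ((r' - r) / |(m : ℝ)|) * (1200 * (r' / |(m : ℝ)|)) * (2 * (2 * |(m : ℝ)| / r)) =
      4800 * C * (r' - r) * (1 / |(m : ℝ)|) * (r' / r) := by field_simp; ring
  rw [e1]
  have e2 : r' / r ≤ 2 := by rw [div_le_iff₀ hr]; exact hr2
  have : 0 ≤ r' - r := by linarith
  calc _ ≤ 4800 * C * (r' - r) * (1 / |(m : ℝ)|) * 2 := by gcongr
    _ = _ := by ring

lemma Etm_lip : ∃ C : ℝ, 0 ≤ C ∧ ∀ {w : (Fin 4 → ℝ) → ℝ} (hw : Wt w) (e : Fin 4 → ℤ)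
    (he : ∀ i, e i = 1 ∨ e i = -1) (r r' : ℝ) (m : ℤ), 0 < r → r ≤ r' → r' ≤ 2 * r →
    ‖Etm w e r m - Etm w e r' m‖ ≤ C * (r' - r) * (1 / (m : ℝ) ^ 2) := by
  obtain ⟨C1, hC1, h1⟩ := phF_lip
  obtain ⟨C2, hC2, h2⟩ := kE_int_lip
  refine ⟨1200 * C1 + C2, by positivity, fun {w} hw e he r r' m hr hrr hr2 => ?_⟩
  rcases eq_or_ne m 0 with rfl | hm
  · simp [Etm, fE_fourier_zero hw e he]
  unfold Etm
  rw [fE_fourier hw e he, fE_fourier hw e he, mul_sub, mul_sub, kE_scale w e r hr m hm, kE_scale w e r' (by linarith) m hm]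
  have a1 := h1 r r' m hr hrr hm
  have a2 := h2 hw e he r r' m hr hrr hr2 hm
  have h0 : ‖pH w e 0‖ ≤ 1200 := by simpa using pH_bound hw e he 0
  set X := ∫ θ : ℝ, (kE (r / m * θ) : ℂ) * pH w e θ
  set Y := ∫ θ : ℝ, (kE (r' / m * θ) : ℂ) * pH w e θ
  have : (r⁻¹ : ℂ) * (pH w e 0 * phF (m / r)) - ((|(m : ℝ)|⁻¹ : ℝ) : ℂ) * X - ((r'⁻¹ : ℂ) * (pH w e 0 * phF (m / r')) - ((|(m : ℝ)|⁻¹ : ℝ) : ℂ) * Y)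
      = pH w e 0 * ((r⁻¹ : ℂ) * phF (m / r) - (r'⁻¹ : ℂ) * phF (m / r')) - ((|(m : ℝ)|⁻¹ : ℝ) : ℂ) * (X - Y) := by ring
  rw [this]
  refine (norm_sub_le _ _).trans ?_
  rw [norm_mul, norm_mul, Complex.norm_real, Real.norm_of_nonneg (by positivity)]
  calc _ ≤ 1200 * (C1 * (r' - r) * (1 / (m : ℝ) ^ 2)) + |(m : ℝ)|⁻¹ * (C2 * (r' - r) * (1 / |(m : ℝ)|)) := by
        gcongr
    _ = _ := by
        rw [← sq_abs (m : ℝ)]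
        have : |(m : ℝ)| ≠ 0 := abs_ne_zero.2 (by exact_mod_cast hm)
        field_simp

lemma Istar_lip : ∃ C : ℝ, 0 ≤ C ∧ ∀ {w : (Fin 4 → ℝ) → ℝ} (hw : Wt w) (e : Fin 4 → ℤ)
    (he : ∀ i, e i = 1 ∨ e i = -1) (r r' : ℝ), 0 < r → r ≤ r' → r' ≤ 2 * r →
    ‖Istar w e r - Istar w e r'‖ ≤ C * (r' - r) := by
  obtain ⟨C, hC, h⟩ := Etm_lip
  have hS : 0 ≤ ∑' m : ℤ, 1 / (m : ℝ) ^ 2 := tsum_nonneg fun m => by positivity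
  refine ⟨C * ∑' m : ℤ, 1 / (m : ℝ) ^ 2, by positivity, fun {w} hw e he r r' hr hrr hr2 => ?_⟩
  have hr' : 0 < r' := by linarith
  have h1 := tsum_of_norm_bounded (sum_m2.mul_left (C * (r' - r))) (fun m => h hw e he r r' m hr hrr hr2)
  rw [(Etm_summable hw e he r hr).tsum_sub (Etm_summable hw e he r' hr')] at h1
  have h2 : Istar w e r - Istar w e r' = (1 / 2) * (∑' m : ℤ, Etm w e r m - ∑' m : ℤ, Etm w e r' m) := by
    linear_combination (1 / 2) * Istar_poisson hw e he r hr - (1 / 2) * Istar_poisson hw e he r' hr'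
  rw [h2, norm_mul]
  have : ‖(1 / 2 : ℂ)‖ = 1 / 2 := by norm_num
  rw [this]
  nlinarith [norm_nonneg (∑' m : ℤ, Etm w e r m - ∑' m : ℤ, Etm w e r' m)]

end Lip

section FinSec

lemma integral_diag (D : Fin 4 → ℝ) (hD : ∀ i, 0 < D i) (f : (Fin 4 → ℝ) → ℂ) :
    ∫ x, f x = ((∏ i, D i : ℝ) : ℂ) * ∫ y : Fin 4 → ℝ, f (fun i => D i * y i) := by
  have hdet : (Matrix.diagonal D).det = ∏ i, D i := Matrix.det_diagonal
  have hpos : 0 < ∏ i, D i := Finset.prod_pos fun i _ => hD i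
  have h := Real.smul_map_diagonal_volume_pi (D := D) (by rw [hdet]; exact hpos.ne')
  have hfun : ∀ y, Matrix.toLin' (Matrix.diagonal D) y = fun i => D i * y i := fun y => by
    ext i; simp [Matrix.mulVec_diagonal]
  have hemb : MeasurableEmbedding (Matrix.toLin' (Matrix.diagonal D)) := by
    refine Continuous.measurableEmbedding (LinearMap.continuous_on_pi _) fun x y hxy => ?_
    rw [hfun, hfun] at hxy
    ext i
    exact mul_left_cancel₀ (hD i).ne' (congrFun hxy i)
  conv_lhs => rw [← h]
  rw [integral_smul_measure, hemb.integral_map, hdet, abs_of_pos hpos, ENNReal.toReal_ofReal hpos.le, Complex.real_smul]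
  simp only [hfun]

lemma Pvec_prod (a : Fin 4 → ℤ) (B : ℝ) (hB : 0 ≤ B) :
    ∏ i, Pvec a B i = B ^ 2 / (((∏ i, a i).natAbs : ℝ) ^ ((1 : ℝ) / 2)) := by
  unfold Pvec
  simp only [Real.sqrt_eq_rpow]
  rw [Real.finset_prod_rpow _ _ fun i _ => by positivity, Finset.prod_div_distrib, Real.div_rpow (by simp; positivity) (by positivity)]
  congr 1
  · simp only [Finset.prod_const, Finset.card_univ, Fintype.card_fin]
    rw [← Real.sqrt_eq_rpow, show B ^ 4 = (B ^ 2) ^ 2 by ring, Real.sqrt_sq (by positivity)]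
  · congr 1
    simp only [Fin.prod_univ_four, Int.natAbs_mul]; push_cast; ring

lemma Iqa_eq (w : (Fin 4 → ℝ) → ℝ) (a : Fin 4 → ℤ) (ha : ∀ i, a i ≠ 0) (B : ℝ) (hB : 0 < B) (q : ℝ) :
    Iqa w a B 0 q = ((B ^ 2 / (((∏ i, a i).natAbs : ℝ) ^ ((1 : ℝ) / 2)) : ℝ) : ℂ) *
      Istar w (fun i => Int.sign (a i)) (q / Real.sqrt B) := by
  have hn : ∀ i, (0 : ℝ) < ((a i).natAbs : ℝ) := fun i => by exact_mod_cast Int.natAbs_pos.2 (ha i)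
  have hP : ∀ i, 0 < Pvec a B i := fun i => Real.sqrt_pos.2 (div_pos hB (hn i))
  unfold Iqa Istar
  rw [integral_diag (Pvec a B) hP, Pvec_prod a B hB.le]
  congr 1
  refine integral_congr_ae (ae_of_all _ fun y => ?_)
  have h1 : (fun i => Pvec a B i * y i / Pvec a B i) = y := by
    ext i; have := (hP i).ne'; field_simp
  have h2 : (∑ i, (a i : ℝ) * (Pvec a B i * y i) ^ 2) / B = Gquad (fun i => Int.sign (a i)) y := by
    unfold Gquad
    rw [Finset.sum_div]
    refine Finset.sum_congr rfl fun i _ => ?_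
    have h3 : Pvec a B i ^ 2 = B / ((a i).natAbs : ℝ) := Real.sq_sqrt (div_pos hB (hn i)).le
    have h4 : (a i : ℝ) = (Int.sign (a i) : ℝ) * ((a i).natAbs : ℝ) := by
      have h5 := congrArg (fun z : ℤ => (z : ℝ)) (Int.sign_mul_natAbs (a i))
      simp only [Int.cast_mul, Int.cast_natCast] at h5
      exact h5.symm
    rw [mul_pow, h3]
    have := (hn i).ne'
    conv_lhs => rw [h4]
    field_simp
  simp only [h1, h2]
  simp [eC_zero]

lemma abel_id (R f : ℕ → ℂ) (M : ℕ) :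
    ∑ q ∈ Finset.range (M + 1), (R q - R (q + 1)) * f (q + 1) =
      R 0 * f 1 + ∑ q ∈ Finset.range M, R (q + 1) * (f (q + 2) - f (q + 1)) - R (M + 1) * f (M + 1) := by
  induction M with
  | zero => simp; ring
  | succ n ih => rw [Finset.sum_range_succ, ih, Finset.sum_range_succ]; ring

lemma sum_rpow_bound (s : ℝ) (hs : 0 < s) (hs2 : s ≤ 1 / 2) (M : ℕ) :
    ∑ q ∈ Finset.range M, ((q : ℝ) + 1) ^ (-(1 / 2 - s)) ≤ 2 * (M : ℝ) ^ (1 / 2 + s) := by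
  have h1 : ∀ N : ℕ, ∑ q ∈ Finset.range N, (Real.sqrt ((q : ℝ) + 1))⁻¹ ≤ 2 * Real.sqrt N := by
    intro N
    induction N with
    | zero => simp
    | succ n ih =>
      rw [Finset.sum_range_succ]
      have hx : 0 < Real.sqrt ((n : ℝ) + 1) := by positivity
      have e1 := Real.sq_sqrt (show (0 : ℝ) ≤ n by positivity)
      have e2 := Real.sq_sqrt (show (0 : ℝ) ≤ (n : ℝ) + 1 by positivity)
      have : (Real.sqrt ((n : ℝ) + 1))⁻¹ ≤ 2 * Real.sqrt ((n : ℝ) + 1) - 2 * Real.sqrt n := by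
        rw [inv_le_iff_one_le_mul₀ hx]
        nlinarith [sq_nonneg (Real.sqrt ((n : ℝ) + 1) - Real.sqrt n)]
      push_cast
      linarith
  rcases Nat.eq_zero_or_pos M with rfl | hM
  · simp; positivity
  have hM0 : (0 : ℝ) < M := by exact_mod_cast hM
  calc _ ≤ ∑ q ∈ Finset.range M, (M : ℝ) ^ s * (Real.sqrt ((q : ℝ) + 1))⁻¹ := by
        refine Finset.sum_le_sum fun q hq => ?_
        have hq : ((q : ℝ) + 1) ≤ M := by exact_mod_cast Finset.mem_range.1 hq
        rw [show -(1 / 2 - s) = s + -(1 / 2) by ring, Real.rpow_add (by positivity), Real.rpow_neg (by positivity), Real.sqrt_eq_rpow]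
        gcongr
    _ = (M : ℝ) ^ s * ∑ q ∈ Finset.range M, (Real.sqrt ((q : ℝ) + 1))⁻¹ := by rw [Finset.mul_sum]
    _ ≤ (M : ℝ) ^ s * (2 * Real.sqrt M) := by gcongr; exact h1 M
    _ = _ := by rw [Real.sqrt_eq_rpow, Real.rpow_add hM0]; ring

lemma main_abel (ε' : ℝ) (h0 : 0 < ε') (h1 : ε' ≤ 1 / 2) : ∃ C : ℝ, 0 < C ∧
      ∀ (a : Fin 4 → ℤ) (B : ℝ) (w : (Fin 4 → ℝ) → ℝ) (G : ℂ), 1 ≤ B → (∀ i, a i ≠ 0) →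
        ¬ IsSquare (∏ i, a i) → Wt w →
        Filter.Tendsto (singularPartial a) Filter.atTop (nhds G) →
        ‖(∑' q : ℕ, if q = 0 then 0 else cq a q * Istar w (fun i => Int.sign (a i)) ((q : ℝ) / Real.sqrt B)) -
            G * sigmaInfW w (fun i => Int.sign (a i))‖ ≤
          C * ((∏ i, a i).natAbs : ℝ) ^ (3 / 16 + ε') * (Delta4 a : ℝ) ^ (3 / 8 : ℝ) * B ^ (-(1 / 4 : ℝ) + ε' / 2) := by
  obtain ⟨C0, hC0, hR⟩ := singular_tail ε' h0 h1
  obtain ⟨C1, hC1, hσ⟩ := Istar_sigma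
  obtain ⟨C2, hC2, hL⟩ := Istar_lip
  refine ⟨28 * C0 * (C1 + C2 + 1), by positivity, fun a B w G hB ha hA hw hG => ?_⟩
  set e : Fin 4 → ℤ := fun i => Int.sign (a i) with he_def
  have he : ∀ i, e i = 1 ∨ e i = -1 := fun i => by
    rcases lt_or_gt_of_ne (ha i) with h | h
    · right; exact Int.sign_eq_neg_one_of_neg h
    · left; exact Int.sign_eq_one_of_pos h
  have hs1 : 1 ≤ Real.sqrt B := Real.one_le_sqrt.2 hB
  have hs0 : 0 < Real.sqrt B := by linarith
  set f : ℕ → ℂ := fun q => Istar w e ((q : ℝ) / Real.sqrt B) with hf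
  set R : ℕ → ℂ := fun q => G - singularPartial a q with hRdef
  obtain ⟨M, hM1, hM2⟩ : ∃ M : ℕ, 13 * Real.sqrt B ≤ M + 1 ∧ ((M : ℝ) + 1) ≤ 14 * Real.sqrt B := by
    have hc := Nat.ceil_lt_add_one (show 0 ≤ 13 * Real.sqrt B by positivity)
    have hc2 := Nat.le_ceil (13 * Real.sqrt B)
    have hpos : 0 < ⌈13 * Real.sqrt B⌉₊ := Nat.ceil_pos.2 (by positivity)
    obtain ⟨M, hM⟩ := Nat.exists_eq_succ_of_ne_zero hpos.ne'
    rw [hM] at hc hc2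
    push_cast at hc hc2
    exact ⟨M, by simpa using hc2, by linarith⟩
  have hfz : ∀ q : ℕ, M + 1 ≤ q → f q = 0 := fun q hq => by
    refine Istar_out hw e he _ ?_
    rw [le_div_iff₀ hs0]
    have : ((M : ℝ) + 1) ≤ q := by exact_mod_cast hq
    linarith
  have hc : ∀ q : ℕ, cq a (q + 1) = R q - R (q + 1) := fun q => by
    simp only [hRdef, singularPartial, cq]
    rw [Finset.sum_Icc_succ_top (by omega)]; ring
  have hsum : (∑' q : ℕ, if q = 0 then 0 else cq a q * f q) =
      ∑ q ∈ Finset.range (M + 1), (R q - R (q + 1)) * f (q + 1) := by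
    rw [tsum_eq_sum (s := Finset.range (M + 2)), Finset.sum_range_succ']
    · simp only [Nat.add_eq_zero_iff, one_ne_zero, and_false, if_false, if_true, add_zero]
      exact Finset.sum_congr rfl fun q _ => by rw [hc]
    · intro q hq
      rw [hfz q (by simp at hq; omega)]; simp
  have hgoal : (∑' q : ℕ, if q = 0 then 0 else cq a q * Istar w e ((q : ℝ) / Real.sqrt B)) - G * sigmaInfW w e =
      R 0 * (f 1 - sigmaInfW w e) + ∑ q ∈ Finset.range M, R (q + 1) * (f (q + 2) - f (q + 1)) := by
    have hG0 : R 0 = G := by simp [hRdef, singularPartial]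
    have := abel_id R f M
    rw [hfz (M + 1) le_rfl] at this
    show (∑' q : ℕ, if q = 0 then 0 else cq a q * f q) - G * sigmaInfW w e = _
    rw [hsum, this, ← hG0]; ring
  rw [hgoal]
  set X : ℝ := C0 * ((∏ i, a i).natAbs : ℝ) ^ (3 / 16 + ε') * (Delta4 a : ℝ) ^ (3 / 8 : ℝ) with hX
  have hX0 : 0 ≤ X := by positivity
  have hR' : ∀ q : ℕ, ‖R q‖ ≤ X * ((q : ℝ) + 1) ^ (-(1 / 2 - ε')) := fun q => hR a G ha hA hG q
  have hf1 : ‖f 1 - sigmaInfW w e‖ ≤ C1 / Real.sqrt B := by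
    have := hσ hw e he ((1 : ℕ) / Real.sqrt B) (by positivity)
    refine this.trans (le_of_eq (by push_cast; ring))
  have hfd : ∀ q : ℕ, ‖f (q + 2) - f (q + 1)‖ ≤ C2 / Real.sqrt B := fun q => by
    have := hL hw e he (((q + 1 : ℕ) : ℝ) / Real.sqrt B) (((q + 2 : ℕ) : ℝ) / Real.sqrt B) (by positivity)
      (by gcongr; omega) (by
        rw [← mul_div_assoc]; gcongr; push_cast; linarith [(Nat.cast_nonneg q : (0 : ℝ) ≤ q)])
    rw [norm_sub_rev]
    refine this.trans (le_of_eq ?_)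
    push_cast; ring
  set S := ∑ q ∈ Finset.range (M + 1), ((q : ℝ) + 1) ^ (-(1 / 2 - ε')) with hS
  have hSb := sum_rpow_bound ε' h0 h1 (M + 1)
  have hS0 : 0 ≤ S := Finset.sum_nonneg fun q _ => by positivity
  have hbound : ‖R 0 * (f 1 - sigmaInfW w e) + ∑ q ∈ Finset.range M, R (q + 1) * (f (q + 2) - f (q + 1))‖ ≤
      X * ((C1 + C2 + 1) / Real.sqrt B) * S := by
    rw [hS, Finset.sum_range_succ', mul_add, add_comm (X * _ * _), Finset.mul_sum]
    refine (norm_add_le _ _).trans (add_le_add ?_ ((norm_sum_le _ _).trans (Finset.sum_le_sum fun q _ => ?_)))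
    · rw [norm_mul]
      calc _ ≤ (X * (((0 : ℕ) : ℝ) + 1) ^ (-(1 / 2 - ε'))) * (C1 / Real.sqrt B) := by
            gcongr; exact hR' 0
        _ ≤ (X * (((0 : ℕ) : ℝ) + 1) ^ (-(1 / 2 - ε'))) * ((C1 + C2 + 1) / Real.sqrt B) := by
            gcongr; linarith
        _ = _ := by ring
    · rw [norm_mul]
      calc _ ≤ (X * (((q + 1 : ℕ) : ℝ) + 1) ^ (-(1 / 2 - ε'))) * (C2 / Real.sqrt B) := by
            gcongr
            · exact hR' (q + 1)
            · exact hfd q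
        _ ≤ (X * (((q + 1 : ℕ) : ℝ) + 1) ^ (-(1 / 2 - ε'))) * ((C1 + C2 + 1) / Real.sqrt B) := by
            gcongr; linarith
        _ = _ := by ring
  refine hbound.trans ?_
  have hSb2 : S ≤ 28 * B ^ (1 / 4 + ε' / 2) := by
    refine hSb.trans ?_
    have hB0 : 0 < B := by linarith
    calc 2 * ((M + 1 : ℕ) : ℝ) ^ (1 / 2 + ε') ≤ 2 * (14 * Real.sqrt B) ^ (1 / 2 + ε') := by
          gcongr; push_cast; exact hM2
      _ = 2 * (14 ^ (1 / 2 + ε') * B ^ (1 / 4 + ε' / 2)) := by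
          rw [Real.mul_rpow (by norm_num) hs0.le, Real.sqrt_eq_rpow, ← Real.rpow_mul hB0.le]
          congr 3; ring
      _ ≤ 2 * (14 ^ (1 : ℝ) * B ^ (1 / 4 + ε' / 2)) := by
          gcongr
          · norm_num
          · linarith
      _ = _ := by rw [Real.rpow_one]; ring
  have hB0 : 0 < B := by linarith
  calc X * ((C1 + C2 + 1) / Real.sqrt B) * S ≤ X * ((C1 + C2 + 1) / Real.sqrt B) * (28 * B ^ (1 / 4 + ε' / 2)) := by gcongr
    _ = X * (C1 + C2 + 1) * 28 * (B ^ (1 / 4 + ε' / 2) * (Real.sqrt B)⁻¹) := by ring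
    _ = X * (C1 + C2 + 1) * 28 * B ^ (-(1 / 4 : ℝ) + ε' / 2) := by
        rw [Real.sqrt_eq_rpow, ← Real.rpow_neg hB0.le, ← Real.rpow_add hB0]; congr 2; ring
    _ = _ := by rw [hX]; ring

end FinSec

/-- Proposition 4.8: the asymptotic for the main term `M(B)`. -/
theorem statement_9 (ε : ℝ) (hε : 0 < ε) :
    ∃ C : ℝ, 0 < C ∧
      ∀ (η : ℝ) (a : Fin 4 → ℤ) (B : ℝ) (w : (Fin 4 → ℝ) → ℝ) (G : ℂ),
        η ∈ Set.Ioo (0 : ℝ) (1 / 4) → 1 ≤ B → η⁻¹ ≤ B →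
        (∀ i, a i ≠ 0) → (∀ i, ((a i).natAbs : ℝ) ≤ B) →
        ¬ IsSquare (∏ i, a i) → (w = w1 η ∨ w = w2 η) →
        Filter.Tendsto (singularPartial a) Filter.atTop (nhds G) →
        ‖(B : ℂ)⁻¹ * (∑' q : ℕ, if q = 0 then 0 else
              (1 / (q : ℂ) ^ 4) * Sqa a 0 q * Iqa w a B 0 (q : ℝ)) -
            G * sigmaInfW w (fun i => Int.sign (a i)) * (B : ℂ) /
              ((((∏ i, a i).natAbs : ℝ) ^ ((1 : ℝ) / 2) : ℝ) : ℂ)‖ ≤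
          C * η⁻¹ ^ 2 * B ^ ((3 : ℝ) / 4 + ε) * (Delta4 a : ℝ) ^ ((3 : ℝ) / 8) /
            (((∏ i, a i).natAbs : ℝ) ^ ((5 : ℝ) / 16)) := by
  set ε' := min (ε / 5) (1 / 2) with hε'
  have h0 : 0 < ε' := lt_min (by positivity) (by norm_num)
  have h1 : ε' ≤ 1 / 2 := min_le_right _ _
  have h5 : ε' ≤ ε / 5 := min_le_left _ _
  obtain ⟨C, hC, hmain⟩ := main_abel ε' h0 h1
  refine ⟨C, hC, fun η a B w G hη hB hηB ha haB hA hw hG => ?_⟩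
  have hW : Wt w := by
    rcases hw with rfl | rfl
    · exact w1_Wt η hη
    · exact w2_Wt η hη
  have hB0 : 0 < B := by linarith
  have key := hmain a B w G hB ha hA hW hG
  set e : Fin 4 → ℤ := fun i => Int.sign (a i) with he
  set N : ℝ := ((∏ i, a i).natAbs : ℝ) with hN
  have hN1 : 1 ≤ N := by
    rw [hN]
    exact_mod_cast Nat.one_le_iff_ne_zero.2 (Int.natAbs_ne_zero.2 (Finset.prod_ne_zero_iff.2 fun i _ => ha i))
  have hN0 : 0 < N := by linarith
  have hNB : N ≤ B ^ 4 := by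
    have : N = ∏ i, ((a i).natAbs : ℝ) := by
      rw [hN]; simp only [Fin.prod_univ_four, Int.natAbs_mul]; push_cast; ring
    rw [this]
    calc _ ≤ ∏ _i : Fin 4, B := Finset.prod_le_prod (fun i _ => by positivity) fun i _ => haB i
      _ = B ^ 4 := by simp
  have hsum : (∑' q : ℕ, if q = 0 then 0 else (1 / (q : ℂ) ^ 4) * Sqa a 0 q * Iqa w a B 0 (q : ℝ)) =
      ((B ^ 2 / N ^ ((1 : ℝ) / 2) : ℝ) : ℂ) *
        ∑' q : ℕ, if q = 0 then 0 else cq a q * Istar w e ((q : ℝ) / Real.sqrt B) := by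
    rw [← tsum_mul_left]
    refine tsum_congr fun q => ?_
    by_cases hq : q = 0
    · simp [hq]
    · rw [if_neg hq, if_neg hq, Iqa_eq w a ha B hB0, cq]; ring
  rw [hsum]
  have hBc : (B : ℂ) ≠ 0 := by exact_mod_cast hB0.ne'
  have hNh : 0 < N ^ ((1 : ℝ) / 2) := by positivity
  have hNc : ((N ^ ((1 : ℝ) / 2) : ℝ) : ℂ) ≠ 0 := by exact_mod_cast hNh.ne'
  set SS := ∑' q : ℕ, if q = 0 then 0 else cq a q * Istar w e ((q : ℝ) / Real.sqrt B)
  have heq : (B : ℂ)⁻¹ * (((B ^ 2 / N ^ ((1 : ℝ) / 2) : ℝ) : ℂ) * SS) - G * sigmaInfW w e * (B : ℂ) / ((N ^ ((1 : ℝ) / 2) : ℝ) : ℂ) =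
      ((B / N ^ ((1 : ℝ) / 2) : ℝ) : ℂ) * (SS - G * sigmaInfW w e) := by
    rw [Complex.ofReal_div, Complex.ofReal_div, Complex.ofReal_pow]
    field_simp
  rw [heq, norm_mul, Complex.norm_real, Real.norm_of_nonneg (by positivity)]
  have hη1 : 1 ≤ η⁻¹ ^ 2 := by
    have : 1 ≤ η⁻¹ := (one_le_inv₀ hη.1).2 (by linarith [hη.2])
    exact one_le_pow₀ this
  calc B / N ^ ((1 : ℝ) / 2) * ‖SS - G * sigmaInfW w e‖
      ≤ B / N ^ ((1 : ℝ) / 2) * (C * N ^ (3 / 16 + ε') * (Delta4 a : ℝ) ^ (3 / 8 : ℝ) * B ^ (-(1 / 4 : ℝ) + ε' / 2)) := by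
        gcongr
    _ = C * (Delta4 a : ℝ) ^ (3 / 8 : ℝ) * (B * B ^ (-(1 / 4 : ℝ) + ε' / 2)) * (N ^ (3 / 16 + ε') / N ^ ((1 : ℝ) / 2)) := by ring
    _ = C * (Delta4 a : ℝ) ^ (3 / 8 : ℝ) * B ^ (3 / 4 + ε' / 2) * (N ^ ε' / N ^ ((5 : ℝ) / 16)) := by
        congr 1
        · congr 1
          nth_rewrite 1 [← Real.rpow_one B]
          rw [← Real.rpow_add hB0]; congr 1; ring
        · rw [← Real.rpow_sub hN0, ← Real.rpow_sub hN0]; congr 1; ring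
    _ ≤ C * (Delta4 a : ℝ) ^ (3 / 8 : ℝ) * B ^ (3 / 4 + ε' / 2) * (B ^ (4 * ε') / N ^ ((5 : ℝ) / 16)) := by
        gcongr
        calc N ^ ε' ≤ (B ^ 4) ^ ε' := by gcongr
          _ = B ^ (4 * ε') := by
            rw [← Real.rpow_natCast, ← Real.rpow_mul hB0.le]; norm_num
    _ = C * (Delta4 a : ℝ) ^ (3 / 8 : ℝ) * B ^ (3 / 4 + ε' / 2 + 4 * ε') / N ^ ((5 : ℝ) / 16) := by
        rw [Real.rpow_add hB0 (3 / 4 + ε' / 2) (4 * ε')]; ring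
    _ ≤ C * (Delta4 a : ℝ) ^ (3 / 8 : ℝ) * B ^ (3 / 4 + ε) / N ^ ((5 : ℝ) / 16) := by
        have hp : B ^ (3 / 4 + ε' / 2 + 4 * ε') ≤ B ^ (3 / 4 + ε) :=
          Real.rpow_le_rpow_of_exponent_le hB (by linarith)
        gcongr ?_ / _
        exact mul_le_mul_of_nonneg_left hp (by positivity)
    _ = C * 1 * B ^ ((3 : ℝ) / 4 + ε) * (Delta4 a : ℝ) ^ ((3 : ℝ) / 8) / N ^ ((5 : ℝ) / 16) := by ring
    _ ≤ _ := by gcongr
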